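/- Green–Tao theorem: the prime numbers contain arbitrarily long arithmetic progressions; that is, for every positive integer k there exist a natural number b and a positive integer d such that b, b + d, b + 2d, …, b + (k−1)d are all prime. -/

import Mathlib

open Finset Filter Topology
open scoped BigOperators Classical


namespace GT

/-! ## Averages over finite types -/

/-- Average of a real function over a finite type. -/
noncomputable def av {X : Type*} [Finite X] (f : X → ℝ) : ℝ :=
  (@Finset.sum X ℝ _ (@Finset.univ X (Fintype.ofFinite X)) f) / Nat.card X

section av
variable {X Y : Type*} [Finite X] [Finite Y]

lemma av_eq [Fintype X] (f : X → ℝ) : av f = (∑ x, f x) / Fintype.card X := by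
  unfold av
  rw [Nat.card_eq_fintype_card]
  congr!

lemma sum_eq_av [Fintype X] (f : X → ℝ) : (∑ x, f x) = Fintype.card X * av f := by
  rw [av_eq]
  rcases isEmpty_or_nonempty X with h | h
  · simp
  · field_simp

lemma av_add (f g : X → ℝ) : av (fun x => f x + g x) = av f + av g := by
  have := Fintype.ofFinite X
  simp only [av_eq, Finset.sum_add_distrib, add_div]

lemma av_sub (f g : X → ℝ) : av (fun x => f x - g x) = av f - av g := by
  have := Fintype.ofFinite X
  simp only [av_eq, Finset.sum_sub_distrib, sub_div]

lemma av_neg (f : X → ℝ) : av (fun x => - f x) = - av f := by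
  have := Fintype.ofFinite X
  simp only [av_eq, Finset.sum_neg_distrib, neg_div]

lemma av_mul_left (c : ℝ) (f : X → ℝ) : av (fun x => c * f x) = c * av f := by
  have := Fintype.ofFinite X
  simp only [av_eq, ← Finset.mul_sum, mul_div_assoc]

lemma av_mul_right (c : ℝ) (f : X → ℝ) : av (fun x => f x * c) = av f * c := by
  simp only [mul_comm _ c, av_mul_left]

lemma av_const [Nonempty X] (c : ℝ) : av (fun _ : X => c) = c := by
  have := Fintype.ofFinite X
  simp [av_eq]

lemma av_zero : av (fun _ : X => (0 : ℝ)) = 0 := by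
  have := Fintype.ofFinite X
  simp [av_eq]

lemma av_mono {f g : X → ℝ} (h : ∀ x, f x ≤ g x) : av f ≤ av g := by
  have := Fintype.ofFinite X
  simp only [av_eq]
  gcongr
  exact h _

lemma av_nonneg {f : X → ℝ} (h : ∀ x, 0 ≤ f x) : 0 ≤ av f := by
  rw [← av_zero (X := X)]; exact av_mono h

lemma av_congr {f g : X → ℝ} (h : ∀ x, f x = g x) : av f = av g := by
  rw [funext h]

lemma av_sum {ι : Type*} (s : Finset ι) (f : ι → X → ℝ) :
    av (fun x => ∑ i ∈ s, f i x) = ∑ i ∈ s, av (f i) := by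
  have := Fintype.ofFinite X
  simp only [av_eq]
  rw [Finset.sum_comm, Finset.sum_div]

lemma av_equiv (e : X ≃ Y) (f : Y → ℝ) : av (fun x => f (e x)) = av f := by
  have := Fintype.ofFinite X
  have := Fintype.ofFinite Y
  simp only [av_eq]
  rw [Fintype.card_congr e, e.sum_comp]

lemma av_bij (e : X → Y) (he : Function.Bijective e) (f : Y → ℝ) :
    av (fun x => f (e x)) = av f := av_equiv (Equiv.ofBijective e he) f

lemma av_prod (f : X × Y → ℝ) : av f = av (fun x => av (fun y => f (x, y))) := by
  have := Fintype.ofFinite X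
  have := Fintype.ofFinite Y
  simp only [av_eq]
  rw [Fintype.sum_prod_type, Fintype.card_prod, ← Finset.sum_div, div_div]
  push_cast
  rw [mul_comm]

lemma av_comm (f : X → Y → ℝ) :
    av (fun x => av (fun y => f x y)) = av (fun y => av (fun x => f x y)) := by
  rw [← av_prod (fun p : X × Y => f p.1 p.2), ← av_prod (fun p : Y × X => f p.2 p.1)]
  exact av_equiv (Equiv.prodComm X Y) (fun p : Y × X => f p.2 p.1)

lemma abs_av_le (f : X → ℝ) : |av f| ≤ av (fun x => |f x|) := by
  rw [abs_le]
  constructor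
  · rw [← av_neg]; exact av_mono fun x => neg_abs_le _
  · exact av_mono fun x => le_abs_self _

lemma exists_le_of_le_av [Nonempty X] {f : X → ℝ} {c : ℝ} (h : c ≤ av f) : ∃ x, c ≤ f x := by
  by_contra! hc
  have := Fintype.ofFinite X
  have : av f < c := by
    rw [av_eq, div_lt_iff₀ (by exact_mod_cast Fintype.card_pos)]
    calc ∑ x, f x < ∑ x : X, c := Finset.sum_lt_sum_of_nonempty Finset.univ_nonempty fun x _ => hc x
      _ = _ := by simp [mul_comm]
  linarith

lemma av_le_of_le [Nonempty X] {f : X → ℝ} {c : ℝ} (h : ∀ x, f x ≤ c) : av f ≤ c := by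
  rw [← av_const (X := X) c]; exact av_mono h

lemma le_av_of_le [Nonempty X] {f : X → ℝ} {c : ℝ} (h : ∀ x, c ≤ f x) : c ≤ av f := by
  rw [← av_const (X := X) c]; exact av_mono h

lemma av_cauchy (f g : X → ℝ) :
    av (fun x => f x * g x) ^ 2 ≤ av (fun x => f x ^ 2) * av (fun x => g x ^ 2) := by
  have := Fintype.ofFinite X
  simp only [av_eq]
  rw [div_pow, div_mul_div_comm, ← pow_two]
  gcongr
  exact Finset.sum_mul_sq_le_sq_mul_sq _ _ _

lemma av_sq_le [Nonempty X] (f : X → ℝ) : av f ^ 2 ≤ av (fun x => f x ^ 2) := by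
  have := av_cauchy (fun _ : X => (1 : ℝ)) f
  simpa [av_const] using this

lemma av_mul_av (f : X → ℝ) (g : Y → ℝ) :
    av f * av g = av (fun x => av (fun y => f x * g y)) := by
  simp only [av_mul_left, av_mul_right]

/-- weighted Cauchy–Schwarz -/
lemma av_cauchy_weight {w f : X → ℝ} (hw : ∀ x, 0 ≤ w x) :
    av (fun x => w x * f x) ^ 2 ≤ av w * av (fun x => w x * f x ^ 2) := by
  have := av_cauchy (fun x => Real.sqrt (w x)) (fun x => Real.sqrt (w x) * f x)
  simp only [← mul_assoc, Real.mul_self_sqrt (hw _), mul_pow, Real.sq_sqrt (hw _)] at this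
  exact this

/-- a single value is at most card times the average -/
lemma le_card_mul_av {f : X → ℝ} (hf : ∀ x, 0 ≤ f x) (x : X) : f x ≤ Nat.card X * av f := by
  have := Fintype.ofFinite X
  rw [Nat.card_eq_fintype_card, ← sum_eq_av]
  exact Finset.single_le_sum (f := f) (fun i _ => hf i) (Finset.mem_univ x)

lemma av_le_one_of_bdd {f : X → ℝ} (h : ∀ x, f x ≤ 1) : av f ≤ 1 := by
  rcases isEmpty_or_nonempty X with hX | hX
  · have : f = fun _ => 0 := funext fun x => (hX.false x).elim
    rw [this, av_zero]; norm_num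
  · exact av_le_of_le h

/-- functions on a sum index type -/
lemma av_sumArrow {ι κ : Type*} {α : Type*} [Finite ι] [Finite κ] [Finite α]
    (F : (ι ⊕ κ → α) → ℝ) :
    av F = av (fun x : ι → α => av (fun y : κ → α => F (Sum.elim x y))) := by
  rw [← av_prod (fun p : (ι → α) × (κ → α) => F (Sum.elim p.1 p.2))]
  rw [← av_equiv (Equiv.sumArrowEquivProdArrow ι κ α).symm F]
  rfl

end av

/-- indicator of a proposition -/
noncomputable def ind (p : Prop) : ℝ := if p then 1 else 0

lemma ind_nonneg (p : Prop) : 0 ≤ ind p := by unfold ind; split_ifs <;> norm_num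
lemma ind_le_one (p : Prop) : ind p ≤ 1 := by unfold ind; split_ifs <;> norm_num
lemma ind_true {p : Prop} (h : p) : ind p = 1 := by simp [ind, h]
lemma ind_false {p : Prop} (h : ¬ p) : ind p = 0 := by simp [ind, h]
lemma ind_mono {p q : Prop} (h : p → q) : ind p ≤ ind q := by
  by_cases hp : p <;> by_cases hq : q <;> simp_all [ind]
lemma ind_congr {p q : Prop} (h : p ↔ q) : ind p = ind q := by simp [ind, h]
lemma ind_and (p q : Prop) : ind (p ∧ q) = ind p * ind q := by
  by_cases hp : p <;> by_cases hq : q <;> simp_all [ind]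
lemma ind_not (p : Prop) : ind (¬ p) = 1 - ind p := by
  unfold ind; split_ifs <;> norm_num
lemma ind_mul_self (p : Prop) : ind p * ind p = ind p := by
  unfold ind; split_ifs <;> norm_num
lemma ind_forall_finset {ι : Type*} (s : Finset ι) (p : ι → Prop) :
    ind (∀ i ∈ s, p i) = ∏ i ∈ s, ind (p i) := by
  by_cases h : ∀ i ∈ s, p i
  · rw [ind_true h, Finset.prod_eq_one]; intro i hi; exact ind_true (h i hi)
  · rw [ind_false h]; push Not at h; obtain ⟨i, hi, h⟩ := h
    exact (Finset.prod_eq_zero hi (ind_false h)).symm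
lemma ind_exists_le {ι : Type*} [Fintype ι] (p : ι → Prop) :
    ind (∃ i, p i) ≤ ∑ i, ind (p i) := by
  by_cases h : ∃ i, p i
  · obtain ⟨i, hi⟩ := h
    calc ind (∃ i, p i) ≤ ind (p i) := by rw [ind_true hi]; exact ind_le_one _
      _ ≤ _ := Finset.single_le_sum (f := fun i => ind (p i)) (fun i _ => ind_nonneg _) (Finset.mem_univ i)
  · rw [ind_false h]; exact Finset.sum_nonneg fun i _ => ind_nonneg _

/-- density of a set -/
noncomputable def dens {X : Type*} [Finite X] (A : Set X) : ℝ := av (fun x => ind (x ∈ A))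

/-- Markov: an average `≥ c` of a `[0,1]`-function exceeds `c/2` on a set of density `≥ c/2`. -/
lemma markov_dens {X : Type*} [Finite X] [Nonempty X] {f : X → ℝ} {c : ℝ} (h1 : ∀ x, f x ≤ 1)
    (hc : 0 ≤ c) (h : c ≤ av f) : c / 2 ≤ av (fun x => ind (c / 2 ≤ f x)) := by
  have : av f ≤ av (fun x => ind (c / 2 ≤ f x) + c / 2) := by
    apply av_mono; intro x
    by_cases hx : c / 2 ≤ f x
    · rw [ind_true hx]; linarith [h1 x]
    · rw [ind_false hx]; push Not at hx; linarith
  rw [av_add, av_const] at this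
  linarith

/-- Pigeonhole -/
lemma pigeon_av {X : Type*} [Finite X] {ι : Type*} [Finite ι] {f : X → ℝ} {c : ℝ}
    (p : ι → X → Prop) (hc : c ≤ av f) (hι : Nonempty ι)
    (h : ∀ x, f x ≤ ind (∃ i, p i x)) : ∃ i, c / Nat.card ι ≤ av (fun x => ind (p i x)) := by
  have := Fintype.ofFinite ι
  have h1 : c ≤ ∑ i, av (fun x => ind (p i x)) := by
    rw [← av_sum]
    exact hc.trans (av_mono fun x => (h x).trans (ind_exists_le _))
  by_contra! hcon
  have : ∑ i, av (fun x => ind (p i x)) < ∑ i : ι, c / Nat.card ι :=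
    Finset.sum_lt_sum_of_nonempty Finset.univ_nonempty fun i _ => hcon i
  simp only [sum_const, card_univ, nsmul_eq_mul, Nat.card_eq_fintype_card] at this
  rw [mul_div_cancel₀] at this
  · linarith
  · exact_mod_cast Fintype.card_ne_zero

end GT
namespace GT

/-! ## Combinatorial subspaces and density Hales–Jewett -/

section words
variable {ι κ μ α : Type}

def Proper (f : ι → α ⊕ κ) : Prop := ∀ e, ∃ i, f i = Sum.inr e

def ev (f : ι → α ⊕ κ) (x : κ → α) : ι → α := fun i => Sum.elim id x (f i)

def lev (f : ι → Option α) (a : α) : ι → α := fun i => (f i).getD a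

def HasLine (A : Set (ι → α)) : Prop :=
  ∃ f : ι → Option α, (∃ i, f i = none) ∧ ∀ a, lev f a ∈ A

def HasSub (κ : Type) (A : Set (ι → α)) : Prop :=
  ∃ f : ι → α ⊕ κ, Proper f ∧ ∀ x, ev f x ∈ A

def tcomp (f : ι → α ⊕ κ) (g : κ → α ⊕ μ) : ι → α ⊕ μ := fun i => Sum.elim Sum.inl g (f i)

lemma ev_tcomp (f : ι → α ⊕ κ) (g : κ → α ⊕ μ) (x : μ → α) :
    ev (tcomp f g) x = ev f (ev g x) := by
  funext i
  simp only [ev, tcomp]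
  rcases f i with a | e <;> simp [ev]

lemma proper_tcomp {f : ι → α ⊕ κ} {g : κ → α ⊕ μ} (hf : Proper f) (hg : Proper g) :
    Proper (tcomp f g) := by
  intro e
  obtain ⟨i, hi⟩ := hg e
  obtain ⟨j, hj⟩ := hf i
  exact ⟨j, by simp [tcomp, hj, hi]⟩

lemma ev_injective {f : ι → α ⊕ κ} (hf : Proper f) : Function.Injective (ev f) := by
  intro x y h
  funext e
  obtain ⟨i, hi⟩ := hf e
  have := congrFun h i
  simpa [ev, hi] using this

lemma HasLine.of_ev {f : ι → α ⊕ κ} (hf : Proper f) {A : Set (ι → α)}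
    (h : HasLine {x | ev f x ∈ A}) : HasLine A := by
  obtain ⟨l, ⟨e, he⟩, hl⟩ := h
  refine ⟨fun i => Sum.elim some l (f i), ?_, fun a => ?_⟩
  · obtain ⟨i, hi⟩ := hf e
    exact ⟨i, by simp [hi, he]⟩
  · have := hl a
    simp only [Set.mem_setOf_eq] at this
    convert this using 1
    funext i
    simp only [lev, ev]
    rcases f i with b | e <;> simp [lev]

/-- fix the second block -/
def tl {ι₂ : Type} (f : ι → α ⊕ κ) (y : ι₂ → α) : ι ⊕ ι₂ → α ⊕ κ :=
  Sum.elim f (fun i => Sum.inl (y i))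
def tr {ι₁ : Type} (x : ι₁ → α) (f : ι → α ⊕ κ) : ι₁ ⊕ ι → α ⊕ κ :=
  Sum.elim (fun i => Sum.inl (x i)) f

lemma proper_tl {ι₂ : Type} {f : ι → α ⊕ κ} (hf : Proper f) (y : ι₂ → α) : Proper (tl f y) :=
  fun e => let ⟨i, hi⟩ := hf e; ⟨Sum.inl i, by simpa [tl] using hi⟩
lemma proper_tr {ι₁ : Type} {f : ι → α ⊕ κ} (hf : Proper f) (x : ι₁ → α) : Proper (tr x f) :=
  fun e => let ⟨i, hi⟩ := hf e; ⟨Sum.inr i, by simpa [tr] using hi⟩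
lemma ev_tl {ι₂ : Type} (f : ι → α ⊕ κ) (y : ι₂ → α) (x : κ → α) :
    ev (tl f y) x = Sum.elim (ev f x) y := by
  funext i; rcases i with i | i <;> simp [ev, tl]
lemma ev_tr {ι₁ : Type} (f : ι → α ⊕ κ) (y : ι₁ → α) (x : κ → α) :
    ev (tr y f) x = Sum.elim y (ev f x) := by
  funext i; rcases i with i | i <;> simp [ev, tr]

def DHJ (α : Type) [Finite α] : Prop :=
  ∀ δ : ℝ, 0 < δ → ∃ (ι : Type) (_ : Finite ι), ∀ A : Set (ι → α), δ ≤ dens A → HasLine A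

end words

section
variable {α : Type} [Finite α]

lemma dens_nonempty {X : Type*} [Finite X] {A : Set X} (h : 0 < dens A) : ∃ x, x ∈ A := by
  by_contra! hc
  have : dens A = 0 := by
    unfold dens
    rw [av_congr (g := fun _ => 0) (fun x => ind_false (hc x)), av_zero]
  linarith

lemma dens_le_one {X : Type*} [Finite X] (A : Set X) : dens A ≤ 1 :=
  av_le_one_of_bdd fun _ => ind_le_one _

lemma dens_nonneg {X : Type*} [Finite X] (A : Set X) : 0 ≤ dens A :=
  av_nonneg fun _ => ind_nonneg _

lemma dens_sum {ι₁ ι₂ : Type} [Finite ι₁] [Finite ι₂] (A : Set (ι₁ ⊕ ι₂ → α)) :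
    dens A = av (fun y : ι₂ → α => dens {x : ι₁ → α | Sum.elim x y ∈ A}) := by
  unfold dens
  rw [av_sumArrow, av_comm]; rfl

lemma dens_sum' {ι₁ ι₂ : Type} [Finite ι₁] [Finite ι₂] (A : Set (ι₁ ⊕ ι₂ → α)) :
    dens A = av (fun x : ι₁ → α => dens {y : ι₂ → α | Sum.elim x y ∈ A}) := by
  unfold dens
  rw [av_sumArrow]; rfl

def MDHJ (α κ : Type) [Finite α] : Prop :=
  ∀ δ : ℝ, 0 < δ → ∃ (ι : Type) (_ : Finite ι), ∀ A : Set (ι → α), δ ≤ dens A → HasSub κ A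

theorem mdhj [Nonempty α] (h : DHJ α) (κ : Type) [Finite κ] : MDHJ α κ := by
  refine Finite.induction_empty_option (P := fun κ => MDHJ α κ) ?_ ?_ ?_ κ
  · intro κ κ' e hκ δ hδ
    obtain ⟨ι, hι, H⟩ := hκ δ hδ
    refine ⟨ι, hι, fun A hA => ?_⟩
    obtain ⟨f, hf, hfA⟩ := H A hA
    refine ⟨fun i => (f i).map id e, fun j => ?_, fun x => ?_⟩
    · obtain ⟨i, hi⟩ := hf (e.symm j)
      exact ⟨i, by simp [hi]⟩
    · convert hfA (x ∘ e) using 1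
      funext i
      simp only [ev]
      rcases f i with a | b <;> simp
  · intro δ hδ
    refine ⟨Empty, inferInstance, fun A hA => ?_⟩
    obtain ⟨x, hx⟩ := dens_nonempty (hδ.trans_le hA)
    refine ⟨fun i => Sum.inl (x i), fun e => e.elim, fun _ => ?_⟩
    convert hx using 1
  · intro κ _ ih δ hδ
    obtain ⟨ι₁, _, H1⟩ := h (δ / 2) (by linarith)
    have hn : (0 : ℝ) < Nat.card (ι₁ → Option α) := by exact_mod_cast Nat.card_pos
    obtain ⟨ι₂, _, H2⟩ := ih (δ / 2 / Nat.card (ι₁ → Option α)) (by positivity)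
    refine ⟨ι₁ ⊕ ι₂, inferInstance, fun A hA => ?_⟩
    rw [dens_sum] at hA
    have m := markov_dens (fun y => dens_le_one _) hδ.le hA
    obtain ⟨l, hl⟩ := pigeon_av
      (fun (l : ι₁ → Option α) (y : ι₂ → α) => (∃ i, l i = none) ∧ ∀ a, Sum.elim (lev l a) y ∈ A)
      m inferInstance (fun y => ind_mono fun hy => H1 _ hy)
    obtain ⟨g, hg, hgA⟩ := H2 {y | (∃ i, l i = none) ∧ ∀ a, Sum.elim (lev l a) y ∈ A} hl
    refine ⟨Sum.elim (fun i => (l i).elim (Sum.inr none) Sum.inl) (fun i => (g i).map id some),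
      fun e => ?_, fun x => ?_⟩
    · rcases e with _ | e
      · obtain ⟨a⟩ := ‹Nonempty α›
        obtain ⟨i, hi⟩ := (hgA fun _ => a).1
        exact ⟨Sum.inl i, by simp [hi]⟩
      · obtain ⟨i, hi⟩ := hg e
        exact ⟨Sum.inr i, by simp [hi]⟩
    · convert (hgA (fun e => x (some e))).2 (x none) using 1
      funext i
      rcases i with i | i
      · simp only [ev, lev, Sum.elim_inl]
        rcases l i with _ | b <;> simp
      · simp only [ev, Sum.elim_inr]
        rcases g i with _ | b <;> simp

/-- replace the letter `none` by `a` -/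
def nz {ι : Type} (a : α) (x : ι → Option α) : ι → Option α := fun i => some ((x i).getD a)

def Ins {ι : Type} (a : α) (D : Set (ι → Option α)) : Prop := ∀ x, x ∈ D ↔ nz a x ∈ D

lemma nz_nz {ι : Type} (a : α) (x : ι → Option α) : nz a (nz a x) = nz a x := by
  funext i; simp [nz]

lemma nz_ev {ι κ : Type} (a : α) (f : ι → Option α ⊕ κ) (x : κ → Option α) :
    nz a (ev f (nz a x)) = nz a (ev f x) := by
  funext i; simp only [nz, ev]; rcases f i with b | e <;> simp [nz]

lemma Ins.ev {ι κ : Type} {a : α} {D : Set (ι → Option α)} (h : Ins a D) (f : ι → Option α ⊕ κ) :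
    Ins a {x | ev f x ∈ D} := by
  intro x
  simp only [Set.mem_setOf_eq]
  rw [h (GT.ev f x), h (GT.ev f (nz a x)), nz_ev]

lemma nz_elim {ι₁ ι₂ : Type} (a : α) (x : ι₁ → Option α) (y : ι₂ → Option α) :
    nz a (Sum.elim x y) = Sum.elim (nz a x) (nz a y) := by
  funext i; rcases i with i | i <;> simp [nz]

lemma Ins.right {ι₁ ι₂ : Type} {a : α} {D : Set (ι₁ ⊕ ι₂ → Option α)} (h : Ins a D)
    (x : ι₁ → Option α) : Ins a {y | Sum.elim x y ∈ D} := by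
  intro y
  simp only [Set.mem_setOf_eq]
  rw [h (Sum.elim x y), h (Sum.elim x (nz a y)), nz_elim, nz_elim, nz_nz]

lemma Ins.left {ι₁ ι₂ : Type} {a : α} {D : Set (ι₁ ⊕ ι₂ → Option α)} (h : Ins a D)
    (y : ι₂ → Option α) : Ins a {x | Sum.elim x y ∈ D} := by
  intro x
  simp only [Set.mem_setOf_eq]
  rw [h (Sum.elim x y), h (Sum.elim (nz a x) y), nz_elim, nz_elim, nz_nz]

lemma av_range {X Z : Type*} [Finite X] [Finite Z] (e : Z → X)
    (he : Function.Injective e) (F : X → ℝ) :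
    av (fun x => F x * ind (x ∈ Set.range e)) = (Nat.card Z / Nat.card X : ℝ) * av (fun z => F (e z)) := by
  have := Fintype.ofFinite X
  have := Fintype.ofFinite Z
  rw [av_eq, Nat.card_eq_fintype_card, Nat.card_eq_fintype_card, div_mul_eq_mul_div, ← sum_eq_av]
  congr 1
  rw [← Finset.sum_image (s := Finset.univ) (g := e) (f := F) (fun a _ b _ h => he h)]
  rw [← Finset.sum_subset (Finset.subset_univ (Finset.univ.image e))]
  · apply Finset.sum_congr rfl
    intro x hx
    rw [ind_true, mul_one]
    simpa using hx
  · intro x _ hx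
    rw [ind_false, mul_zero]
    simpa using hx

lemma HasSub.right {ι₁ ι₂ κ : Type} {A : Set (ι₁ ⊕ ι₂ → α)} (x : ι₁ → α)
    (h : HasSub κ {y | Sum.elim x y ∈ A}) : HasSub κ A := by
  obtain ⟨f, hf, h⟩ := h
  exact ⟨tr x f, proper_tr hf x, fun z => by rw [ev_tr]; exact h z⟩

lemma HasSub.left {ι₁ ι₂ κ : Type} {A : Set (ι₁ ⊕ ι₂ → α)} (y : ι₂ → α)
    (h : HasSub κ {x | Sum.elim x y ∈ A}) : HasSub κ A := by
  obtain ⟨f, hf, h⟩ := h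
  exact ⟨tl f y, proper_tl hf y, fun z => by rw [ev_tl]; exact h z⟩

theorem ins_mdhj [Nonempty α] {κ : Type} (h : MDHJ α κ) {η : ℝ} (hη : 0 < η) :
    ∃ (ι : Type) (_ : Finite ι), ∀ (a : α) (D : Set (ι → Option α)), Ins a D → η ≤ dens D →
      HasSub κ D := by
  obtain ⟨ι₀, _, H0⟩ := h (η / 2) (by linarith)
  let q : ℝ := Nat.card (ι₀ → α) / Nat.card (ι₀ → Option α)
  have hq0 : 0 < q := by
    have h1 : (0 : ℝ) < Nat.card (ι₀ → Option α) := by exact_mod_cast Nat.card_pos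
    have h2 : (0 : ℝ) < Nat.card (ι₀ → α) := by exact_mod_cast Nat.card_pos
    positivity
  let emb : (ι₀ → α) → (ι₀ → Option α) := fun z i => some (z i)
  have hemb : Function.Injective emb := fun x y hxy => by
    funext i; have := congrFun hxy i; simpa [emb] using this
  have hqav : av (fun x => ind (x ∈ Set.range emb)) = q := by
    have := av_range emb hemb (fun _ => 1)
    simpa [av_const] using this
  have hq1 : q ≤ 1 := by rw [← hqav]; exact av_le_one_of_bdd fun _ => ind_le_one _
  have claim : ∀ s : ℕ, ∃ (ι : Type) (_ : Finite ι), ∀ (a : α) (D : Set (ι → Option α)), Ins a D →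
      ¬ HasSub κ D → dens D ≤ η / 2 + (1 - q) ^ s := by
    intro s
    induction s with
    | zero =>
      refine ⟨Empty, inferInstance, fun a D _ _ => ?_⟩
      have := dens_le_one D
      simp only [pow_zero]; linarith
    | succ s ih =>
      obtain ⟨ι₁, _, H1⟩ := ih
      refine ⟨ι₀ ⊕ ι₁, inferInstance, fun a D hD hno => ?_⟩
      have e1 : dens D = av (fun x : ι₀ → Option α =>
          dens {y : ι₁ → Option α | Sum.elim x y ∈ D} * ind (x ∈ Set.range emb)) +
          av (fun x : ι₀ → Option α =>
          dens {y : ι₁ → Option α | Sum.elim x y ∈ D} * (1 - ind (x ∈ Set.range emb))) := by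
        rw [dens_sum', ← av_add]
        apply av_congr; intro x; ring
      have b1 : av (fun x : ι₀ → Option α =>
          dens {y : ι₁ → Option α | Sum.elim x y ∈ D} * ind (x ∈ Set.range emb)) ≤ q * (η / 2) := by
        rw [av_range emb hemb (fun x => dens {y : ι₁ → Option α | Sum.elim x y ∈ D})]
        apply mul_le_mul_of_nonneg_left _ hq0.le
        unfold dens
        rw [av_comm]
        apply av_le_of_le
        intro y
        by_contra! hy
        obtain ⟨f, hf, hfA⟩ := H0 {z | Sum.elim (emb z) y ∈ D} hy.le
        apply hno
        refine HasSub.left y ⟨fun i => (f i).map some id, fun e => ?_, fun x => ?_⟩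
        · obtain ⟨i, hi⟩ := hf e
          exact ⟨i, by simp [hi]⟩
        · have := hfA (fun e => (x e).getD a)
          simp only [Set.mem_setOf_eq] at this ⊢
          rw [hD] at this ⊢
          convert this using 1
          rw [nz_elim, nz_elim]
          congr 1
          funext i
          simp only [nz, ev, emb]
          rcases f i with b | e <;> simp
      have b2 : av (fun x : ι₀ → Option α =>
          dens {y : ι₁ → Option α | Sum.elim x y ∈ D} * (1 - ind (x ∈ Set.range emb))) ≤
          (1 - q) * (η / 2 + (1 - q) ^ s) := by
        calc _ ≤ av (fun x : ι₀ → Option α => (η / 2 + (1 - q) ^ s) *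
              (1 - ind (x ∈ Set.range emb))) := by
              apply av_mono; intro x
              apply mul_le_mul_of_nonneg_right
              · exact H1 a _ (hD.right x) (fun hs => hno (hs.right x))
              · linarith [ind_le_one (x ∈ Set.range emb)]
          _ = _ := by
              rw [av_mul_left, av_sub, av_const, hqav]; ring
      rw [e1, pow_succ]
      nlinarith
  obtain ⟨s, hs⟩ := exists_pow_lt_of_lt_one (show (0 : ℝ) < η / 2 by linarith)
    (show 1 - q < 1 by linarith)
  obtain ⟨ι, hι, H⟩ := claim s
  refine ⟨ι, hι, fun a D hD hd => ?_⟩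
  by_contra hno
  linarith [H a D hD hno]

def NoPos {ι : Type} (κ : Type) [Finite κ] (g : (ι → Option α) → ℝ) : Prop :=
  ∀ f : ι → Option α ⊕ κ, Proper f → av (fun x => g (ev f x)) ≤ 0

theorem pl_one [Nonempty α] {κ : Type} [Finite κ] (h : MDHJ α κ) {η : ℝ} (hη : 0 < η) :
    ∃ (ι : Type) (_ : Finite ι), ∀ (a : α) (D : Set (ι → Option α)), Ins a D →
      ∀ g : (ι → Option α) → ℝ, (∀ x, g x ≤ 1) → NoPos κ g →
        av (fun x => g x * ind (x ∈ D)) ≤ η := by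
  obtain ⟨ι', _, H⟩ := ins_mdhj h (show 0 < η / 2 / 2 by linarith)
  have hn : (0 : ℝ) < Nat.card (ι' → Option α ⊕ κ) := by
    have : Nonempty (ι' → Option α ⊕ κ) := ⟨fun _ => Sum.inl none⟩
    exact_mod_cast Nat.card_pos
  have hX : (0 : ℝ) < Nat.card (ι' → Option α) := by exact_mod_cast Nat.card_pos
  have hZ : (0 : ℝ) < Nat.card (κ → Option α) := by exact_mod_cast Nat.card_pos
  let c : ℝ := Nat.card (κ → Option α) / Nat.card (ι' → Option α)
  have hc : 0 < c := by positivity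
  let ξ : ℝ := min 1 (c * (η / 2 / 2 / Nat.card (ι' → Option α ⊕ κ)))
  have hξ0 : 0 < ξ := lt_min one_pos (by positivity)
  have hξ1 : ξ ≤ 1 := min_le_left _ _
  have claim : ∀ t : ℕ, ∃ (ι : Type) (_ : Finite ι), ∀ (a : α) (D : Set (ι → Option α)), Ins a D →
      ∀ g : (ι → Option α) → ℝ, (∀ x, g x ≤ 1) → NoPos κ g →
        av (fun x => g x * ind (x ∈ D)) ≤ η / 2 + (1 - ξ) ^ t * dens D := by
    intro t
    induction t with
    | zero =>
      refine ⟨Empty, inferInstance, fun a D _ g hg _ => ?_⟩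
      have : av (fun x => g x * ind (x ∈ D)) ≤ dens D :=
        av_mono fun x => by nlinarith [hg x, ind_nonneg (x ∈ D)]
      simp only [pow_zero]; linarith
    | succ t ih =>
      obtain ⟨ι₁, _, H1⟩ := ih
      refine ⟨ι' ⊕ ι₁, inferInstance, fun a D hD g hg hpos => ?_⟩
      by_cases hsmall : dens D < η / 2
      · have : av (fun x => g x * ind (x ∈ D)) ≤ dens D :=
          av_mono fun x => by nlinarith [hg x, ind_nonneg (x ∈ D)]
        have := mul_nonneg (pow_nonneg (show 0 ≤ 1 - ξ by linarith) (t + 1)) (dens_nonneg D)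
        linarith
      push Not at hsmall
      have hsmall' := hsmall
      rw [dens_sum] at hsmall'
      have m := markov_dens (fun y => dens_le_one _) (by linarith) hsmall'
      obtain ⟨f, hf⟩ := pigeon_av (fun (f : ι' → Option α ⊕ κ) (y : ι₁ → Option α) =>
          Proper f ∧ ∀ x, Sum.elim (ev f x) y ∈ D)
          m ⟨fun _ => Sum.inl none⟩ (fun y => ind_mono fun hy => H a _ (hD.left y) hy)
      have hfp : Proper f := by
        by_contra hnf
        have : av (fun y : ι₁ → Option α =>
            ind (Proper f ∧ ∀ x, Sum.elim (ev f x) y ∈ D)) = 0 := by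
          rw [av_congr (g := fun _ => 0) (fun x => ind_false (fun hh => hnf hh.1)), av_zero]
        rw [this] at hf
        have : 0 < η / 2 / 2 / Nat.card (ι' → Option α ⊕ κ) := by positivity
        linarith
      let Y : Set (ι₁ → Option α) := {y | ∀ x, Sum.elim (ev f x) y ∈ D}
      have hY : η / 2 / 2 / Nat.card (ι' → Option α ⊕ κ) ≤ dens Y :=
        hf.trans (av_mono fun y => ind_mono fun hh => hh.2)
      let U : Set (ι' → Option α) := Set.range (ev f)
      have hUY : ∀ x y, x ∈ U → y ∈ Y → Sum.elim x y ∈ D := by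
        rintro _ y ⟨z, rfl⟩ hy; exact hy z
      let D' : (ι' → Option α) → Set (ι₁ → Option α) :=
        fun x => {y | Sum.elim x y ∈ D ∧ ¬ (x ∈ U ∧ y ∈ Y)}
      have split : ∀ x y, ind (Sum.elim x y ∈ D) = ind (y ∈ Y) * ind (x ∈ U) + ind (y ∈ D' x) := by
        intro x y
        by_cases h1 : x ∈ U ∧ y ∈ Y
        · rw [ind_true h1.1, ind_true h1.2, ind_true (hUY x y h1.1 h1.2),
            ind_false (fun hh => hh.2 h1)]; norm_num
        · have : ind (y ∈ Y) * ind (x ∈ U) = 0 := by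
            rw [← ind_and, ind_false]; tauto
          rw [this, zero_add]
          exact ind_congr ⟨fun hh => ⟨hh, h1⟩, fun hh => hh.1⟩
      have hDs : dens D = c * dens Y + av (fun x => dens (D' x)) := by
        rw [dens_sum']
        unfold dens
        simp only [Set.mem_setOf_eq, split]
        simp only [av_add, av_mul_right]
        congr 1
        rw [av_mul_left]
        have := av_range (ev f) (ev_injective hfp) (fun _ => 1)
        simp only [one_mul, av_const, mul_one] at this
        rw [this]; ring
      have hgs : av (fun x => g x * ind (x ∈ D)) =
          av (fun y => ind (y ∈ Y) * av (fun x => g (Sum.elim x y) * ind (x ∈ U))) +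
          av (fun x => av (fun y => g (Sum.elim x y) * ind (y ∈ D' x))) := by
        rw [av_sumArrow]
        simp only [split, mul_add, av_add]
        congr 1
        rw [av_comm]
        apply av_congr; intro y
        rw [← av_mul_left]
        apply av_congr; intro x; ring
      have t1 : av (fun y => ind (y ∈ Y) * av (fun x => g (Sum.elim x y) * ind (x ∈ U))) ≤ 0 := by
        rw [← av_zero (X := ι₁ → Option α)]
        apply av_mono; intro y
        have := av_range (ev f) (ev_injective hfp) (fun x => g (Sum.elim x y))
        rw [this]
        have h2 := hpos (tl f y) (proper_tl hfp y)
        simp only [ev_tl] at h2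
        have : c * av (fun z => g (Sum.elim (ev f z) y)) ≤ 0 :=
          mul_nonpos_of_nonneg_of_nonpos hc.le h2
        exact mul_nonpos_of_nonneg_of_nonpos (ind_nonneg _) this
      have t2 : av (fun x => av (fun y => g (Sum.elim x y) * ind (y ∈ D' x))) ≤
          η / 2 + (1 - ξ) ^ t * av (fun x => dens (D' x)) := by
        rw [← av_mul_left]
        conv_rhs => rw [← av_const (X := ι' → Option α) (η / 2)]
        rw [← av_add]
        apply av_mono; intro x
        refine H1 a (D' x) ?_ _ (fun y => hg _) ?_
        · intro y
          have h1 := hD.right x y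
          have h2 : y ∈ Y ↔ nz a y ∈ Y := forall_congr' fun z => hD.right (ev f z) y
          simp only [Set.mem_setOf_eq] at h1
          simp only [D', Set.mem_setOf_eq, h1, h2]
        · intro f' hf'
          have := hpos (tr x f') (proper_tr hf' x)
          simpa only [ev_tr] using this
      have hξ : ξ ≤ c * dens Y := (min_le_right _ _).trans (mul_le_mul_of_nonneg_left hY hc.le)
      have h3 : av (fun x => dens (D' x)) ≤ (1 - ξ) * dens D := by
        nlinarith [dens_le_one D]
      have h4 := mul_le_mul_of_nonneg_left h3 (pow_nonneg (show 0 ≤ 1 - ξ by linarith) t)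
      rw [pow_succ, mul_assoc]
      linarith
  obtain ⟨s, hs⟩ := exists_pow_lt_of_lt_one (show (0 : ℝ) < η / 2 by linarith)
    (show 1 - ξ < 1 by linarith)
  obtain ⟨ι, hι, H⟩ := claim s
  refine ⟨ι, hι, fun a D hD g hg hp => ?_⟩
  have h1 := H a D hD g hg hp
  have h2 : (1 - ξ) ^ s * dens D ≤ (1 - ξ) ^ s * 1 :=
    mul_le_mul_of_nonneg_left (dens_le_one D) (pow_nonneg (by linarith) s)
  linarith

theorem pl [Nonempty α] (h : DHJ α) (J : Finset α) :
    ∀ (κ : Type) [Finite κ] (η : ℝ), 0 < η →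
    ∃ (ι : Type) (_ : Finite ι), ∀ E : α → Set (ι → Option α), (∀ a, Ins a (E a)) →
      ∀ g : (ι → Option α) → ℝ, (∀ x, g x ≤ 1) → NoPos κ g →
        av (fun x => g x * ind (∀ a ∈ J, x ∈ E a)) ≤ η := by
  induction J using Finset.induction_on with
  | empty =>
    intro κ _ η hη
    refine ⟨κ, inferInstance, fun E _ g hg hp => ?_⟩
    have := hp Sum.inr (fun e => ⟨e, rfl⟩)
    have h2 : ∀ x, ev (Sum.inr : κ → Option α ⊕ κ) x = x := fun x => rfl
    simp only [h2] at this
    simp only [Finset.notMem_empty, false_imp_iff, implies_true, ind_true, mul_one]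
    linarith
  | insert a J _ ih =>
    intro κ _ η hη
    obtain ⟨κ', _, H1⟩ := ih κ (η / 2) (by linarith)
    obtain ⟨ι, hι, H2⟩ := pl_one (mdhj h κ') (show 0 < η / 2 by linarith)
    refine ⟨ι, hι, fun E hE g hg hp => ?_⟩
    have key := H2 a (E a) (hE a) (fun x => g x * ind (∀ b ∈ J, x ∈ E b) - η / 2) ?_ ?_
    · simp only [sub_mul, av_sub, av_mul_left] at key
      have h3 : η / 2 * av (fun x => ind (x ∈ E a)) ≤ η / 2 * 1 :=
        mul_le_mul_of_nonneg_left (dens_le_one (E a)) (by linarith)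
      have h4 : av (fun x => g x * ind (∀ b ∈ insert a J, x ∈ E b)) =
          av (fun x => g x * ind (∀ b ∈ J, x ∈ E b) * ind (x ∈ E a)) := by
        apply av_congr; intro x
        rw [mul_assoc, ← ind_and]
        congr 1
        apply ind_congr
        simp only [Finset.forall_mem_insert]; tauto
      rw [h4]; linarith
    · intro x
      have := hg x
      have h1 := ind_nonneg (∀ b ∈ J, x ∈ E b)
      have h2 := ind_le_one (∀ b ∈ J, x ∈ E b)
      nlinarith
    · intro f hf
      have := H1 (fun b => {x | ev f x ∈ E b}) (fun b => (hE b).ev f) (fun x => g (ev f x))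
        (fun x => hg _) ?_
      · rw [av_sub, av_const]
        simpa using this
      · intro f' hf'
        have := hp (tcomp f f') (proper_tcomp hf hf')
        simpa only [ev_tcomp] using this

end
end GT
namespace GT

/-! ## Graham–Rothschild theorem for lines -/

def wd {ι κ α : Type} (f : ι → α ⊕ κ) (a : κ → Option α) : ι → Option α :=
  fun i => Sum.elim some a (f i)

theorem gr_none (α : Type) [Finite α] (κ : Type) [Finite κ] :
    ∀ (C : Type) [Finite C], ∃ (ι : Type) (_ : Finite ι), ∀ c : (ι → Option α) → C,
      ∃ f : ι → α ⊕ κ, Proper f ∧ ∀ a b : κ → Option α, (∀ e, a e = none ↔ b e = none) →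
        c (wd f a) = c (wd f b) := by
  refine Finite.induction_empty_option (P := fun κ => ∀ (C : Type) [Finite C],
    ∃ (ι : Type) (_ : Finite ι), ∀ c : (ι → Option α) → C,
      ∃ f : ι → α ⊕ κ, Proper f ∧ ∀ a b : κ → Option α, (∀ e, a e = none ↔ b e = none) →
        c (wd f a) = c (wd f b)) ?_ ?_ ?_ κ
  · intro κ κ' e hκ C _
    obtain ⟨ι, hι, H⟩ := hκ C
    refine ⟨ι, hι, fun c => ?_⟩
    obtain ⟨f, hf, hfc⟩ := H c
    refine ⟨fun i => (f i).map id e, fun j => ?_, fun a b hab => ?_⟩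
    · obtain ⟨i, hi⟩ := hf (e.symm j)
      exact ⟨i, by simp [hi]⟩
    · have hw : ∀ a : κ' → Option α, wd (fun i => (f i).map id e) a = wd f (a ∘ e) := by
        intro a; funext i; simp only [wd]
        rcases f i with x | x <;> simp
      rw [hw, hw]
      exact hfc _ _ fun j => hab (e j)
  · intro C _
    refine ⟨Empty, inferInstance, fun c => ⟨fun i => i.elim, fun e => e.elim, fun a b _ => ?_⟩⟩
    congr 1
    funext i; exact i.elim
  · intro κ _ ih C _
    obtain ⟨ι₂, _, H2⟩ := ih (Option α → C)
    obtain ⟨ι₁, _, H1⟩ := Combinatorics.Line.exists_mono_in_high_dimension α ((ι₂ → Option α) → C)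
    refine ⟨ι₁ ⊕ ι₂, inferInstance, fun c => ?_⟩
    obtain ⟨l, col, hl⟩ := H1 (fun u v => c (Sum.elim (fun i => some (u i)) v))
    let L : Option α → ι₁ → Option α := fun o i => (l.idxFun i).elim o some
    have hL : ∀ (x : α) v, c (Sum.elim (L (some x)) v) = col v := by
      intro x v
      rw [← hl x]
      congr 2
      funext i
      simp only [L, Combinatorics.Line.apply_def]
      rcases l.idxFun i with _ | y <;> simp
    obtain ⟨g, hg, hgc⟩ := H2 (fun v o => c (Sum.elim (L o) v))
    refine ⟨Sum.elim (fun i => (l.idxFun i).elim (Sum.inr none) Sum.inl)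
      (fun i => (g i).map id some), fun e => ?_, fun a b hab => ?_⟩
    · rcases e with _ | e
      · obtain ⟨i, hi⟩ := l.proper
        exact ⟨Sum.inl i, by simp [hi]⟩
      · obtain ⟨i, hi⟩ := hg e
        exact ⟨Sum.inr i, by simp [hi]⟩
    · have hw : ∀ a : Option κ → Option α,
          wd (Sum.elim (fun i => (l.idxFun i).elim (Sum.inr none) Sum.inl)
            (fun i => (g i).map id some)) a =
          Sum.elim (L (a none)) (wd g (fun e => a (some e))) := by
        intro a; funext i
        rcases i with i | i
        · simp only [wd, L, Sum.elim_inl]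
          rcases l.idxFun i with _ | y <;> simp
        · simp only [wd, Sum.elim_inr]
          rcases g i with _ | y <;> simp
      rw [hw, hw]
      have h1 := congrFun (hgc (fun e => a (some e)) (fun e => b (some e)) (fun e => hab _)) (a none)
      rw [h1]
      rcases ha : a none with _ | x
      · rw [(hab none).1 ha]
      · rcases hb : b none with _ | y
        · rw [(hab none).2 hb] at ha; simp at ha
        · rw [hL, hL]

theorem fu_min (C : Type) [Finite C] (n : ℕ) : ∃ (τ : Type) (_ : Finite τ), ∀ χ : Set τ → C,
    ∃ p : τ → Option (Fin n), (∀ e, ∃ t, p t = some e) ∧ ∀ (i : Fin n) (S S' : Set (Fin n)),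
      i ∈ S → i ∈ S' → (∀ j < i, j ∉ S) → (∀ j < i, j ∉ S') →
        χ {t | ∃ e ∈ S, p t = some e} = χ {t | ∃ e ∈ S', p t = some e} := by
  induction n with
  | zero => exact ⟨Empty, inferInstance, fun χ => ⟨fun t => t.elim, fun e => e.elim0, fun i => i.elim0⟩⟩
  | succ n ih =>
    obtain ⟨τ', _, H'⟩ := ih
    obtain ⟨τ₀, _, H0⟩ := Combinatorics.Subspace.exists_mono_in_high_dimension Bool C τ'
    refine ⟨Option τ₀, inferInstance, fun χ => ?_⟩
    obtain ⟨l, col, hl⟩ := H0 (fun x => χ {t | ∀ s, t = some s → x s = true})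
    obtain ⟨p, hp, hpc⟩ := H' (fun T => χ {t | ∃ s e, t = some s ∧ l.idxFun s = Sum.inr e ∧ e ∈ T})
    let q : Option τ₀ → Option (Fin (n + 1)) := fun t => t.elim (some 0) fun s =>
      Sum.elim (fun b => if b then some 0 else none) (fun e => (p e).map Fin.succ) (l.idxFun s)
    have hq0 : ∀ S : Set (Fin (n + 1)), 0 ∈ S → χ {t | ∃ e ∈ S, q t = some e} = col := by
      intro S hS
      rw [← hl (fun e => decide (∃ i ∈ S, (p e).map Fin.succ = some i))]
      congr 1
      ext t
      rcases t with _ | s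
      · simp [q, hS]
      · simp only [q, Set.mem_setOf_eq, Option.elim_some, Option.some.injEq, forall_eq',
          Combinatorics.Subspace.coe_apply]
        rcases l.idxFun s with b | e
        · rcases b <;> simp [hS]
        · simp
    have hq1 : ∀ S : Set (Fin (n + 1)), 0 ∉ S → {t | ∃ e ∈ S, q t = some e} =
        {t | ∃ s e, t = some s ∧ l.idxFun s = Sum.inr e ∧ e ∈ {u | ∃ i ∈ Fin.succ ⁻¹' S, p u = some i}} := by
      intro S hS
      ext t
      rcases t with _ | s
      · simp [q, hS]
      · simp only [q, Set.mem_setOf_eq, Option.elim_some, Option.some.injEq]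
        rcases hs : l.idxFun s with b | e
        · rcases b
          · simp [hs]
          · simp [hs]; exact hS
        · simp only [Sum.elim_inr, Option.map_eq_some_iff]
          constructor
          · rintro ⟨i, hi, j, hj, rfl⟩
            exact ⟨s, e, rfl, hs, j, hi, hj⟩
          · rintro ⟨s', e', rfl, hs', j, hi, hj⟩
            rw [hs] at hs'
            cases hs'
            exact ⟨_, hi, j, hj, rfl⟩
    refine ⟨q, fun e => ?_, fun i S S' hS hS' hm hm' => ?_⟩
    · refine Fin.cases ⟨none, rfl⟩ (fun j => ?_) e
      obtain ⟨u, hu⟩ := hp j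
      obtain ⟨s, hs⟩ := l.proper u
      exact ⟨some s, by simp [q, hs, hu]⟩
    · induction i using Fin.cases with
      | zero => rw [hq0 S hS, hq0 S' hS']
      | succ i =>
        rw [hq1 S (hm _ (Fin.succ_pos i)), hq1 S' (hm' _ (Fin.succ_pos i))]
        exact hpc i (Fin.succ ⁻¹' S) (Fin.succ ⁻¹' S') hS hS'
          (fun j hj => hm _ (Fin.succ_lt_succ_iff.2 hj)) (fun j hj => hm' _ (Fin.succ_lt_succ_iff.2 hj))

theorem fu (C κ : Type) [Finite C] [Finite κ] : ∃ (τ : Type) (_ : Finite τ), ∀ χ : Set τ → C,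
    ∃ p : τ → Option κ, (∀ e, ∃ t, p t = some e) ∧ ∃ c0, ∀ S : Set κ, S.Nonempty →
      χ {t | ∃ e ∈ S, p t = some e} = c0 := by
  have := Fintype.ofFinite C
  have := Fintype.ofFinite κ
  obtain ⟨τ, hτ, H⟩ := fu_min C (Fintype.card C * Fintype.card κ + 1)
  refine ⟨τ, hτ, fun χ => ?_⟩
  obtain ⟨p, hp, hc⟩ := H χ
  obtain ⟨c0, hc0⟩ := Fintype.exists_lt_card_fiber_of_mul_lt_card
    (f := fun i => χ {t | ∃ e ∈ ({i} : Set _), p t = some e})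
    (show Fintype.card C * Fintype.card κ < Fintype.card (Fin (Fintype.card C * Fintype.card κ + 1))
      by simp)
  obtain ⟨g, hg⟩ : ∃ g : κ ↪ Fin (Fintype.card C * Fintype.card κ + 1), ∀ e,
      χ {t | ∃ i ∈ ({g e} : Set _), p t = some i} = c0 := by
    have := Function.Embedding.nonempty_of_card_le (α := κ)
      (β := {i // i ∈ Finset.univ.filter fun i => χ {t | ∃ e ∈ ({i} : Set _), p t = some e} = c0})
      (by rw [Fintype.card_coe]; exact hc0.le)
    obtain ⟨g⟩ := this
    exact ⟨g.trans (Function.Embedding.subtype _), fun e => (Finset.mem_filter.1 (g e).2).2⟩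
  refine ⟨fun t => (p t).bind fun i => if h : ∃ e, g e = i then some h.choose else none,
    fun e => ?_, c0, fun S hS => ?_⟩
  · obtain ⟨t, ht⟩ := hp (g e)
    refine ⟨t, ?_⟩
    have h : ∃ e', g e' = g e := ⟨e, rfl⟩
    simp only [ht, Option.bind_some, dif_pos h]
    rw [g.injective h.choose_spec]
  · have hmem : ∀ t e, ((p t).bind fun i => if h : ∃ e, g e = i then some h.choose else none) = some e
        ↔ p t = some (g e) := by
      intro t e
      rcases p t with _ | i
      · simp
      · simp only [Option.bind_some, Option.some.injEq]
        by_cases h : ∃ e, g e = i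
        · rw [dif_pos h]
          constructor
          · intro h'; simp only [Option.some.injEq] at h'; rw [← h', h.choose_spec]
          · intro h'; simp only [Option.some.injEq]
            exact g.injective (h.choose_spec.trans h')
        · rw [dif_neg h]; simp; rintro rfl; exact h ⟨e, rfl⟩
    have hset : {t | ∃ e ∈ S, ((p t).bind fun i => if h : ∃ e, g e = i then some h.choose else none)
        = some e} = {t | ∃ i ∈ Set.image g S, p t = some i} := by
      ext t; simp [hmem]
    rw [hset]
    have hne : (Finset.univ.filter fun i => i ∈ Set.image g S).Nonempty := by
      obtain ⟨e, he⟩ := hS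
      exact ⟨g e, by simp [he]⟩
    let m := (Finset.univ.filter fun i => i ∈ Set.image g S).min' hne
    have hm : m ∈ Set.image g S := (Finset.mem_filter.1 (Finset.min'_mem _ hne)).2
    obtain ⟨e, he, hem⟩ := hm
    rw [← hg e]
    refine hc (g e) _ _ ⟨e, he, rfl⟩ rfl ?_ ?_
    · intro j hj hjS
      rw [hem] at hj
      exact absurd (Finset.min'_le _ j (by simpa using hjS)) (not_le.2 hj)
    · intro j hj hjS
      exact absurd hjS (ne_of_lt hj)

theorem gr (α : Type) [Finite α] [Nonempty α] (κ C : Type) [Finite κ] [Finite C] :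
    ∃ (ι : Type) (_ : Finite ι), ∀ c : (ι → Option α) → C,
      ∃ f : ι → α ⊕ κ, Proper f ∧ ∃ c0, ∀ a : κ → Option α, (∃ e, a e = none) →
        c (wd f a) = c0 := by
  obtain ⟨τ, _, Hτ⟩ := fu C κ
  obtain ⟨ι, hι, H⟩ := gr_none α τ C
  refine ⟨ι, hι, fun c => ?_⟩
  obtain ⟨f, hf, hfc⟩ := H c
  obtain ⟨a0⟩ := ‹Nonempty α›
  obtain ⟨p, hp, c0, hc0⟩ := Hτ fun T => c (wd f fun t => if t ∈ T then none else some a0)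
  refine ⟨tcomp f fun t => (p t).elim (Sum.inl a0) Sum.inr, ?_, c0, fun a ha => ?_⟩
  · apply proper_tcomp hf
    intro e
    obtain ⟨t, ht⟩ := hp e
    exact ⟨t, by simp [ht]⟩
  · rw [← hc0 {e | a e = none} ha]
    have : wd (tcomp f fun t => (p t).elim (Sum.inl a0) Sum.inr) a =
        wd f fun t => (p t).elim (some a0) a := by
      funext i
      simp only [wd, tcomp]
      rcases f i with x | t
      · simp
      · simp only [Sum.elim_inr]
        rcases p t with _ | e <;> simp
    rw [this]
    apply hfc
    intro t
    rcases h : p t with _ | e <;> simp [h]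

end GT
namespace GT

/-! ## Density Hales–Jewett: the induction step -/

def Good (B : Type) [Finite B] (δ : ℝ) : Prop :=
  ∃ (ι : Type) (_ : Finite ι), ∀ A : Set (ι → B), δ ≤ dens A → HasLine A

lemma slice_bounds {X : Type*} [Finite X] [Nonempty X] {s : X → ℝ} {δ ε : ℝ}
    (h1 : ∀ x, s x ≤ δ + ε) (h2 : δ - ε ≤ av s) (x : X) :
    δ + ε - Nat.card X * (2 * ε) ≤ s x := by
  have h := le_card_mul_av (f := fun x => δ + ε - s x) (fun x => by linarith [h1 x]) x
  rw [av_sub, av_const] at h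
  have : (Nat.card X : ℝ) * (δ + ε - av s) ≤ Nat.card X * (2 * ε) :=
    mul_le_mul_of_nonneg_left (by linarith) (by positivity)
  linarith

lemma exists_small_nonefree (α : Type) [Finite α] {q : ℝ} (hq : 0 < q) :
    ∃ m : ℕ, dens {x : Fin m → Option α | ∀ i, x i ≠ none} ≤ q := by
  let k : ℝ := Nat.card α
  have hk : 0 ≤ k := Nat.cast_nonneg _
  have hr : k / (k + 1) < 1 := by rw [div_lt_one (by linarith)]; linarith
  obtain ⟨m, hm⟩ := exists_pow_lt_of_lt_one hq hr
  refine ⟨m, ?_⟩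
  let emb : (Fin m → α) → (Fin m → Option α) := fun z i => some (z i)
  have hemb : Function.Injective emb := fun x y hxy => by
    funext i; have := congrFun hxy i; simpa [emb] using this
  have h := av_range emb hemb (fun _ => 1)
  have h2 : dens {x : Fin m → Option α | ∀ i, x i ≠ none} =
      av (fun x => 1 * ind (x ∈ Set.range emb)) := by
    unfold dens
    apply av_congr; intro x
    rw [one_mul]
    apply ind_congr
    constructor
    · intro hx
      have : ∀ i, ∃ b, x i = some b := fun i => Option.ne_none_iff_exists'.1 (hx i)
      choose z hz using this
      exact ⟨z, funext fun i => (hz i).symm⟩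
    · rintro ⟨z, rfl⟩ i; simp [emb]
  have h3 : (Nat.card (Fin m → α) / Nat.card (Fin m → Option α) : ℝ) = (k / (k + 1)) ^ m := by
    have := Fintype.ofFinite α
    simp [k, div_pow]
  rw [h2, h, h3]
  have : av (fun _ : Fin m → α => (1 : ℝ)) ≤ 1 := av_le_one_of_bdd fun _ => le_rfl
  have h4 : 0 ≤ (k / (k + 1)) ^ m := by positivity
  nlinarith

lemma HasLine.tl {B ι κ : Type} {A : Set (ι ⊕ κ → B)} (y : κ → B)
    (h : HasLine {x | Sum.elim x y ∈ A}) : HasLine A := by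
  obtain ⟨l, ⟨i, hi⟩, hl⟩ := h
  refine ⟨Sum.elim l (fun j => some (y j)), ⟨Sum.inl i, hi⟩, fun a => ?_⟩
  have h2 := hl a
  simp only [Set.mem_setOf_eq] at h2
  convert h2 using 1
  funext i; rcases i with i | i <;> simp [lev]

lemma HasLine.tr {B ι κ : Type} {A : Set (ι ⊕ κ → B)} (x : ι → B)
    (h : HasLine {y | Sum.elim x y ∈ A}) : HasLine A := by
  obtain ⟨l, ⟨i, hi⟩, hl⟩ := h
  refine ⟨Sum.elim (fun j => some (x j)) l, ⟨Sum.inr i, hi⟩, fun a => ?_⟩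
  have h2 := hl a
  simp only [Set.mem_setOf_eq] at h2
  convert h2 using 1
  funext i; rcases i with i | i <;> simp [lev]

lemma ind_pieces {α Y : Type*} [Finite α] [Fintype (Finset α)] (P : α → Prop) :
    ind (¬ ∀ b, P b) = ∑ S ∈ (Finset.univ : Finset (Finset α)).filter (fun S => S.Nonempty),
      ind (∀ b, (b ∈ S ↔ ¬ P b)) := by
  have := Fintype.ofFinite α
  let S0 : Finset α := Finset.univ.filter fun b => ¬ P b
  have hS0 : ∀ S : Finset α, (∀ b, (b ∈ S ↔ ¬ P b)) ↔ S = S0 := by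
    intro S; simp [S0, Finset.ext_iff]
  simp only [hS0]
  by_cases h : ∀ b, P b
  · rw [ind_false (by tauto), Finset.sum_eq_zero]
    intro S hS
    apply ind_false
    rintro rfl
    obtain ⟨b, hb⟩ := (Finset.mem_filter.1 hS).2
    exact (Finset.mem_filter.1 hb).2 (h b)
  · rw [ind_true h, Finset.sum_eq_single S0]
    · exact (ind_true rfl).symm
    · intro S _ hS; exact ind_false hS
    · intro hS
      exfalso; apply hS
      push Not at h
      obtain ⟨b, hb⟩ := h
      simp only [Finset.mem_filter, Finset.mem_univ, true_and]
      exact ⟨b, by simp [S0, hb]⟩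

theorem dhj_step {α : Type} [Finite α] [Nonempty α] (h : DHJ α) : DHJ (Option α) := by
  by_contra hcon
  have hcon' : ∃ δ : ℝ, 0 < δ ∧ ¬ Good (Option α) δ := by
    unfold DHJ at hcon; push Not at hcon
    obtain ⟨δ, hδ, hh⟩ := hcon
    refine ⟨δ, hδ, ?_⟩
    rintro ⟨ι, hι, H⟩
    obtain ⟨A, hA, hA'⟩ := hh ι hι
    exact hA' (H A hA)
  obtain ⟨δ₀, hδ₀, hbad⟩ := hcon'
  have gmono : ∀ δ δ', δ ≤ δ' → Good (Option α) δ → Good (Option α) δ' := by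
    rintro δ δ' hd ⟨ι, hι, H⟩
    exact ⟨ι, hι, fun A hA => H A (hd.trans hA)⟩
  have g2 : Good (Option α) 2 := ⟨Empty, inferInstance, fun A hA => by linarith [dens_le_one A]⟩
  let d : ℝ := sInf {δ | Good (Option α) δ}
  have hbdd : BddBelow {δ | Good (Option α) δ} :=
    ⟨δ₀, fun δ hδ => le_of_not_ge fun hlt => hbad (gmono _ _ hlt hδ)⟩
  have hd0 : 0 < d := hδ₀.trans_le
    (le_csInf ⟨2, g2⟩ fun δ hδ => le_of_not_ge fun hlt => hbad (gmono _ _ hlt hδ))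
  have hd2 : d ≤ 2 := csInf_le hbdd g2
  have hgood : ∀ ε : ℝ, 0 < ε → Good (Option α) (d + ε) := by
    intro ε hε
    obtain ⟨δ, hδ, hlt⟩ := exists_lt_of_csInf_lt ⟨2, g2⟩ (show d < d + ε by linarith)
    exact gmono _ _ hlt.le hδ
  have hnot : ∀ ε : ℝ, 0 < ε → ¬ Good (Option α) (d - ε) := by
    intro ε hε hg
    linarith [csInf_le hbdd hg]
  -- choice of parameters
  obtain ⟨ι₀, _, H0⟩ := h (d / 4) (by linarith)
  have hn : (1 : ℝ) ≤ Nat.card (ι₀ → Option α) := by exact_mod_cast Nat.card_pos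
  let θ : ℝ := d / 4 / Nat.card (ι₀ → Option α)
  have hθ0 : 0 < θ := by positivity
  have hθ1 : θ ≤ 1 / 2 := by
    apply (div_le_self (by linarith) hn).trans; linarith
  let γ : ℝ := d * θ / 8
  have hγ0 : 0 < γ := by positivity
  have hγ1 : γ ≤ 1 / 8 := by simp only [γ]; nlinarith
  obtain ⟨κf, _, Hf⟩ := hgood γ hγ0
  have := Fintype.ofFinite α
  let M : ℝ := Fintype.card (Finset α)
  have hM : 0 < M := by
    have : 0 < Fintype.card (Finset α) := Fintype.card_pos
    exact Nat.cast_pos.2 this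
  obtain ⟨κ₂, _, H2⟩ := pl h Finset.univ κf (d * θ / 16 / M) (by positivity)
  obtain ⟨m, hm⟩ := exists_small_nonefree α (show 0 < d * θ / 16 by positivity)
  let κ₁ : Type := κ₂ ⊕ (ι₀ ⊕ Fin m)
  obtain ⟨ι₁, _, H1⟩ := gr α κ₁ Prop
  let η : ℝ := d * θ / 8
  have hη0 : 0 < η := by positivity
  have hcX : (0 : ℝ) < Nat.card (ι₁ → Option α) := by exact_mod_cast Nat.card_pos
  let ε : ℝ := η / (2 * Nat.card (ι₁ → Option α))
  have hε0 : 0 < ε := by positivity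
  obtain ⟨κε, _, Hε⟩ := hgood ε hε0
  obtain ⟨A, hAd, hAl⟩ : ∃ A : Set (ι₁ ⊕ κε → Option α), d - ε ≤ dens A ∧ ¬ HasLine A := by
    by_contra! hc
    exact hnot ε hε0 ⟨ι₁ ⊕ κε, inferInstance, hc⟩
  let s : (ι₁ → Option α) → ℝ := fun x => dens {y | Sum.elim x y ∈ A}
  have hs1 : ∀ x, s x ≤ d + ε := by
    intro x
    by_contra! hx
    exact hAl ((Hε _ hx.le).tr x)
  have hs2 : ∀ x, d - η ≤ s x := by
    intro x
    rw [dens_sum'] at hAd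
    have := slice_bounds hs1 hAd x
    have e : Nat.card (ι₁ → Option α) * (2 * ε) = η := by simp only [ε]; field_simp
    rw [e] at this
    linarith
  -- colour
  obtain ⟨f, hf, c0, hc0⟩ := H1 fun w =>
    θ ≤ dens {y : κε → Option α | ∀ b : α, Sum.elim (nz b w) y ∈ A}
  let fB : ι₁ → Option α ⊕ κ₁ := fun i => (f i).map some id
  have hfB : Proper fB := fun e => by
    obtain ⟨i, hi⟩ := hf e
    exact ⟨i, by simp [fB, hi]⟩
  have hwd : ∀ x : κ₁ → Option α, wd f x = ev fB x := by
    intro x; funext i; simp only [wd, ev, fB]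
    rcases f i with a | e <;> simp
  have hnzw : ∀ (b : α) (x : κ₁ → Option α), nz b (ev fB x) = ev fB (nz b x) := by
    intro b x; funext i; simp only [nz, ev, fB]
    rcases f i with a | e <;> simp [nz]
  obtain ⟨a0⟩ := ‹Nonempty α›
  -- the colour is true
  have hcol : ∀ x : κ₁ → Option α, (∃ e, x e = none) →
      θ ≤ dens {y : κε → Option α | ∀ b : α, Sum.elim (ev fB (nz b x)) y ∈ A} := by
    let up : (ι₀ → Option α) → κ₁ → Option α := fun z =>
      Sum.elim (fun _ => some a0) (Sum.elim z (fun _ => some a0))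
    have h1 : d / 2 ≤ av (fun y : κε → Option α =>
        dens {z : ι₀ → α | Sum.elim (ev fB (up fun i => some (z i))) y ∈ A}) := by
      unfold dens
      rw [av_comm]
      apply le_av_of_le
      intro z
      refine le_trans ?_ (hs2 (ev fB (up fun i => some (z i))))
      simp only [η]; nlinarith
    have h2 := markov_dens (fun y => dens_le_one _) (by linarith) h1
    obtain ⟨l, hl⟩ := pigeon_av (fun (l : ι₀ → Option α) (y : κε → Option α) =>
        (∃ i, l i = none) ∧ ∀ b, Sum.elim (ev fB (up fun i => some (lev l b i))) y ∈ A)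
        h2 inferInstance (fun y => ind_mono fun hy => by
          obtain ⟨l, hl, hl'⟩ := H0 _ (le_trans (by linarith) hy)
          exact ⟨l, hl, hl'⟩)
    have hθl : θ ≤ av fun y : κε → Option α => ind ((∃ i, l i = none) ∧
        ∀ b, Sum.elim (ev fB (up fun i => some (lev l b i))) y ∈ A) := by
      refine le_trans (le_of_eq ?_) hl
      simp only [θ]; ring
    have hlp : ∃ i, l i = none := by
      obtain ⟨y, hy⟩ := dens_nonempty (A := {y : κε → Option α | (∃ i, l i = none) ∧
        ∀ b, Sum.elim (ev fB (up fun i => some (lev l b i))) y ∈ A}) (hθ0.trans_le hθl)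
      exact hy.1
    have hup : ∀ b, nz b (up l) = up fun i => some (lev l b i) := by
      intro b; funext i
      rcases i with i | i | i <;> simp [up, nz, lev]
    have hc : c0 := by
      rw [← hc0 (up l) (by obtain ⟨i, hi⟩ := hlp; exact ⟨Sum.inr (Sum.inl i), hi⟩)]
      refine hθl.trans (av_mono fun y => ind_mono fun hy b => ?_)
      rw [hwd, hnzw, hup]
      exact hy.2 b
    intro x hx
    have := hc0 x hx
    rw [eq_iff_iff] at this
    have h3 := this.2 hc
    simp only [hwd, hnzw] at h3
    exact h3
  -- no line
  have hnoline : ∀ (x : κ₁ → Option α) (y : κε → Option α), (∃ e, x e = none) →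
      Sum.elim (ev fB x) y ∈ A → ¬ ∀ b : α, Sum.elim (ev fB (nz b x)) y ∈ A := by
    intro x y ⟨e, he⟩ hx hb
    apply hAl
    refine HasLine.tl y (HasLine.of_ev hfB ⟨fun j => (x j).map some, ⟨e, by simp [he]⟩, ?_⟩)
    intro b
    rcases b with _ | b
    · change Sum.elim (ev fB (lev (fun j => (x j).map some) none)) y ∈ A
      convert hx using 3
      funext j; simp only [lev]
      rcases x j with _ | c <;> simp
    · change Sum.elim (ev fB (lev (fun j => (x j).map some) (some b))) y ∈ A
      convert hb b using 3
      funext j; simp only [lev, nz]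
      rcases x j with _ | c <;> simp
  let c : ℝ := d + 2 * γ
  have hc0' : 0 ≤ c := by positivity
  have hc3 : c ≤ 3 := by simp only [c]; linarith
  let D : (κ₁ → Option α) → (κε → Option α) → α → Prop :=
    fun x y b => Sum.elim (ev fB (nz b x)) y ∈ A
  let g : (κ₁ → Option α) → (κε → Option α) → ℝ := fun x y => ind (Sum.elim (ev fB x) y ∈ A) - c
  have hg1 : ∀ x y, g x y ≤ 1 := fun x y => by
    have := ind_le_one (Sum.elim (ev fB x) y ∈ A)
    simp only [g]; linarith
  have hg3 : ∀ x y, -3 ≤ g x y := fun x y => by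
    have := ind_nonneg (Sum.elim (ev fB x) y ∈ A)
    simp only [g]; linarith
  have hx1 : ∀ x : κ₁ → Option α, (∃ e, x e = none) →
      5 / 8 * (d * θ) ≤ av fun y => g x y * ind (¬ ∀ b, D x y b) := by
    intro x hx
    have e1 : ∀ y, g x y * ind (¬ ∀ b, D x y b) =
        ind (Sum.elim (ev fB x) y ∈ A) - c * (1 - ind (∀ b, D x y b)) := by
      intro y
      rw [ind_not]
      by_cases hy : Sum.elim (ev fB x) y ∈ A
      · have := ind_false (hnoline x y hx hy)
        simp only [g, D, this, ind_true hy]; ring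
      · simp only [g, ind_false hy]; ring
    simp only [e1]
    rw [av_sub, av_mul_left, av_sub, av_const]
    have h1 := hs2 (ev fB x)
    have h2 := hcol x hx
    simp only [s, dens, Set.mem_setOf_eq] at h1 h2
    change θ ≤ av (fun y => ind (∀ b, D x y b)) at h2
    simp only [c, γ, η] at *
    nlinarith
  have hx2 : ∀ x : κ₁ → Option α, -3 ≤ av fun y => g x y * ind (¬ ∀ b, D x y b) := by
    intro x
    apply le_av_of_le
    intro y
    have := ind_nonneg (¬ ∀ b, D x y b)
    have := ind_le_one (¬ ∀ b, D x y b)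
    nlinarith [hg3 x y]
  have hq : av (fun x : κ₁ → Option α => ind (∀ e, x e ≠ none)) ≤ d * θ / 16 := by
    simp only [κ₁]
    rw [av_sumArrow]
    apply av_le_of_le; intro u
    rw [av_sumArrow]
    apply av_le_of_le; intro v
    refine le_trans ?_ hm
    apply av_mono; intro z
    apply ind_mono
    intro hh i
    exact hh (Sum.inr (Sum.inr i))
  have htot : d * θ / 8 ≤ av fun x => av fun y => g x y * ind (¬ ∀ b, D x y b) := by
    have h1 : ∀ x : κ₁ → Option α, 5 / 8 * (d * θ) - 5 * ind (∀ e, x e ≠ none) ≤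
        av fun y => g x y * ind (¬ ∀ b, D x y b) := by
      intro x
      by_cases hx : ∃ e, x e = none
      · have := hx1 x hx
        have := ind_nonneg (∀ e, x e ≠ none)
        linarith
      · push Not at hx
        rw [ind_true hx]
        have := hx2 x
        nlinarith
    have h2 := av_mono h1
    rw [av_sub, av_const, av_mul_left] at h2
    nlinarith
  have hsum : (∑ S ∈ (Finset.univ : Finset (Finset α)).filter (fun S => S.Nonempty),
      av fun x => av fun y => g x y * ind (∀ b, (b ∈ S ↔ ¬ D x y b))) =
      av fun x => av fun y => g x y * ind (¬ ∀ b, D x y b) := by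
    rw [← av_sum]
    apply av_congr; intro x
    rw [← av_sum]
    apply av_congr; intro y
    rw [ind_pieces (Y := Unit), Finset.mul_sum]
  obtain ⟨S, hS⟩ : ∃ S : Finset α, d * θ / 8 / M ≤
      av fun x => av fun y => g x y * ind (∀ b, (b ∈ S ↔ ¬ D x y b)) := by
    by_contra! hcc
    have h1 : (∑ S ∈ (Finset.univ : Finset (Finset α)).filter (fun S => S.Nonempty),
      av fun x => av fun y => g x y * ind (∀ b, (b ∈ S ↔ ¬ D x y b))) <
      ∑ S ∈ (Finset.univ : Finset (Finset α)).filter (fun S => S.Nonempty), d * θ / 8 / M :=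
      Finset.sum_lt_sum_of_nonempty ⟨{a0}, by simp⟩ fun S _ => hcc S
    rw [Finset.sum_const, nsmul_eq_mul] at h1
    have h2 : ((((Finset.univ : Finset (Finset α)).filter (fun S => S.Nonempty)).card : ℕ) : ℝ) ≤ M := by
      have := Finset.card_filter_le (Finset.univ : Finset (Finset α)) (fun S => S.Nonempty)
      simp only [M]
      exact_mod_cast this
    have h3 : ((((Finset.univ : Finset (Finset α)).filter (fun S => S.Nonempty)).card : ℕ) : ℝ) *
        (d * θ / 8 / M) ≤ M * (d * θ / 8 / M) := mul_le_mul_of_nonneg_right h2 (by positivity)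
    have h4 : M * (d * θ / 8 / M) = d * θ / 8 := by field_simp
    linarith
  simp only [κ₁] at hS
  rw [av_sumArrow, av_comm] at hS
  obtain ⟨v, hv⟩ := exists_le_of_le_av hS
  rw [av_comm] at hv
  obtain ⟨y, hy⟩ := exists_le_of_le_av hv
  have key := H2 (fun b => {u | b ∈ S ↔ ¬ D (Sum.elim u v) y b}) ?_ (fun u => g (Sum.elim u v) y)
    (fun u => hg1 _ _)
  · have hnp : ¬ NoPos κf fun u => g (Sum.elim u v) y := by
      intro hnp
      have := key hnp
      simp only [Finset.mem_univ, true_imp_iff, Set.mem_setOf_eq] at this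
      have h5 : d * θ / 16 / M < d * θ / 8 / M := by
        apply div_lt_div_of_pos_right _ hM
        have : 0 < d * θ := by positivity
        linarith
      linarith
    unfold NoPos at hnp
    push Not at hnp
    obtain ⟨f', hf', hpos⟩ := hnp
    simp only [g] at hpos
    rw [av_sub, av_const] at hpos
    apply hAl
    refine HasLine.tl y (HasLine.of_ev hfB (HasLine.tl v (HasLine.of_ev hf' (Hf _ ?_))))
    refine le_trans ?_ (le_of_lt (sub_pos.1 hpos))
    simp only [c]
    linarith
  · intro b u
    have e1 : nz b (Sum.elim u v) = nz b (Sum.elim (nz b u) v) := by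
      rw [nz_elim, nz_elim, nz_nz]
    have e2 : D (Sum.elim u v) y b = D (Sum.elim (nz b u) v) y b :=
      congrArg (fun t => Sum.elim (ev fB t) y ∈ A) e1
    simp only [Set.mem_setOf_eq]
    rw [e2]

theorem dhj (α : Type) [Finite α] : DHJ α := by
  refine Finite.induction_empty_option (P := fun α => ∀ _ : Finite α, DHJ α) ?_ ?_ ?_ α inferInstance
  · intro α β e hα _ δ hδ
    have : Finite α := Finite.of_equiv β e.symm
    obtain ⟨ι, hι, H⟩ := hα inferInstance δ hδ
    refine ⟨ι, hι, fun A hA => ?_⟩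
    have h1 : δ ≤ dens {x : ι → α | (fun i => e (x i)) ∈ A} := by
      refine hA.trans (le_of_eq ?_)
      unfold dens
      exact (av_equiv (Equiv.arrowCongr (Equiv.refl ι) e) (fun x => ind (x ∈ A))).symm
    obtain ⟨l, ⟨i, hi⟩, hl⟩ := H _ h1
    refine ⟨fun i => (l i).map e, ⟨i, by simp [hi]⟩, fun a => ?_⟩
    have h2 := hl (e.symm a)
    simp only [Set.mem_setOf_eq] at h2
    convert h2 using 1
    funext i; simp only [lev]
    rcases l i with _ | b <;> simp
  · intro _ δ hδ
    refine ⟨Unit, inferInstance, fun A hA => ⟨fun _ => none, ⟨(), rfl⟩, fun a => a.elim⟩⟩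
  · intro α _ ih _
    rcases isEmpty_or_nonempty α with hα | hα
    · intro δ hδ
      refine ⟨Unit, inferInstance, fun A hA => ⟨fun _ => none, ⟨(), rfl⟩, fun a => ?_⟩⟩
      obtain ⟨x, hx⟩ := dens_nonempty (hδ.trans_le hA)
      have : Subsingleton (Unit → Option α) := inferInstance
      rwa [Subsingleton.elim (lev (fun _ => none) a) x]
    · convert dhj_step (ih inferInstance)

end GT
namespace GT

/-! ## Szemerédi's theorem with many progressions in `ZMod N` -/

theorem szem (k : ℕ) [NeZero k] (δ : ℝ) (hδ : 0 < δ) : ∃ c : ℝ, 0 < c ∧ ∃ N₀ : ℕ, ∀ (N : ℕ) [NeZero N],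
    N.Prime → N₀ ≤ N → ∀ f : ZMod N → ℝ, (∀ x, 0 ≤ f x) → (∀ x, f x ≤ 1) → δ ≤ av f →
      c ≤ av fun a : ZMod N => av fun d : ZMod N => ∏ j : Fin k, f (a + (j : ℕ) * d) := by
  obtain ⟨ι, _, H⟩ := dhj (Fin k) (δ / 2 / 2) (by linarith)
  have := Fintype.ofFinite ι
  have hn : (0 : ℝ) < Nat.card (ι → Option (Fin k)) := by exact_mod_cast Nat.card_pos
  let c1 : ℝ := δ / 2 / 2 / Nat.card (ι → Option (Fin k))
  have hc1 : 0 < c1 := by positivity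
  refine ⟨(δ / 2) ^ k * c1, by positivity, Fintype.card ι + 1, ?_⟩
  intro N _ hN hN0 f hf0 hf1 hfδ
  have : Fact N.Prime := ⟨hN⟩
  let S : Set (ZMod N) := {x | δ / 2 ≤ f x}
  have hS : δ / 2 ≤ dens S := markov_dens hf1 hδ.le hfδ
  have h1 : δ / 2 ≤ av fun p : ZMod N × ZMod N =>
      dens {x : ι → Fin k | p.1 + p.2 * ∑ i, ((x i : ℕ) : ZMod N) ∈ S} := by
    unfold dens
    rw [av_comm]
    apply le_av_of_le; intro x
    rw [av_prod, av_comm]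
    apply le_av_of_le; intro d
    refine hS.trans (le_of_eq ?_)
    exact (av_equiv (Equiv.addRight (d * ∑ i, ((x i : ℕ) : ZMod N))) (fun a => ind (a ∈ S))).symm
  have h2 := markov_dens (fun p => dens_le_one _) (by linarith) h1
  obtain ⟨l, hl⟩ := pigeon_av (fun (l : ι → Option (Fin k)) (p : ZMod N × ZMod N) =>
      (∃ i, l i = none) ∧ ∀ j : Fin k, p.1 + p.2 * ∑ i, (((lev l j i : Fin k) : ℕ) : ZMod N) ∈ S)
      h2 inferInstance (fun y => ind_mono fun hy => by
        obtain ⟨l, hl, hl'⟩ := H _ hy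
        exact ⟨l, hl, hl'⟩)
  change c1 ≤ _ at hl
  have hlp : ∃ i, l i = none := by
    obtain ⟨p, hp⟩ := dens_nonempty (A := {p : ZMod N × ZMod N | (∃ i, l i = none) ∧
      ∀ j : Fin k, p.1 + p.2 * ∑ i, (((lev l j i : Fin k) : ℕ) : ZMod N) ∈ S}) (hc1.trans_le hl)
    exact hp.1
  let r : ℕ := (Finset.univ.filter fun i => l i = none).card
  let c : ZMod N := ∑ i ∈ Finset.univ.filter (fun i => ¬ l i = none),
    (((l i).elim 0 fun j => (j : ℕ) : ℕ) : ZMod N)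
  have hsum : ∀ j : Fin k, ∑ i, (((lev l j i : Fin k) : ℕ) : ZMod N) = c + r * (j : ℕ) := by
    intro j
    rw [← Finset.sum_filter_add_sum_filter_not Finset.univ (fun i => l i = none), add_comm]
    congr 1
    · apply Finset.sum_congr rfl
      intro i hi
      have := (Finset.mem_filter.1 hi).2
      simp only [lev]
      rcases h : l i with _ | b
      · exact absurd h this
      · simp
    · rw [Finset.sum_congr rfl (g := fun _ => ((j : ℕ) : ZMod N))]
      · simp [r]
      · intro i hi
        have := (Finset.mem_filter.1 hi).2
        simp [lev, this]
  have hr0 : (r : ZMod N) ≠ 0 := by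
    intro h0
    rw [ZMod.natCast_eq_zero_iff] at h0
    have h3 : 0 < r := Finset.card_pos.2 ⟨hlp.choose, by simp [hlp.choose_spec]⟩
    have h4 : r ≤ Fintype.card ι := Finset.card_le_univ _
    have := Nat.le_of_dvd h3 h0
    omega
  have hbij : Function.Bijective fun p : ZMod N × ZMod N => (p.1 + p.2 * c, p.2 * r) := by
    rw [Finite.injective_iff_bijective.symm]
    rintro ⟨a, d⟩ ⟨a', d'⟩ hh
    simp only [Prod.mk.injEq] at hh
    have hd : d = d' := mul_right_cancel₀ hr0 hh.2
    subst hd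
    have := hh.1
    simp only [add_left_inj] at this
    rw [this]
  have h5 : c1 ≤ av fun p : ZMod N × ZMod N => ind (∀ j : Fin k, p.1 + (j : ℕ) * p.2 ∈ S) := by
    rw [← av_bij _ hbij]
    refine hl.trans (av_mono fun p => ind_mono fun hp j => ?_)
    have := hp.2 j
    rw [hsum] at this
    convert this using 1
    ring
  rw [← av_prod (fun p : ZMod N × ZMod N => ∏ j : Fin k, f (p.1 + (j : ℕ) * p.2))]
  calc _ ≤ (δ / 2) ^ k * av fun p : ZMod N × ZMod N => ind (∀ j : Fin k, p.1 + (j : ℕ) * p.2 ∈ S) :=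
        mul_le_mul_of_nonneg_left h5 (by positivity)
    _ = av fun p : ZMod N × ZMod N => (δ / 2) ^ k * ind (∀ j : Fin k, p.1 + (j : ℕ) * p.2 ∈ S) :=
        (av_mul_left _ _).symm
    _ ≤ _ := by
      apply av_mono; intro p
      by_cases hp : ∀ j : Fin k, p.1 + (j : ℕ) * p.2 ∈ S
      · rw [ind_true hp, mul_one]
        calc (δ / 2) ^ k = ∏ j : Fin k, (δ / 2) := by rw [Finset.prod_const, Finset.card_univ, Fintype.card_fin]
          _ ≤ _ := Finset.prod_le_prod (fun _ _ => by linarith) (fun j _ => hp j)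
      · rw [ind_false hp, mul_zero]
        exact Finset.prod_nonneg fun j _ => hf0 _

end GT
namespace GT

section C1
variable {ι G : Type} [Fintype ι] [DecidableEq ι] [Finite G] [Nonempty G]

/-- `u` does not depend on coordinate `j`. -/
def IndC (j : ι) (u : (ι → G) → ℝ) : Prop := ∀ x t, u (Function.update x j t) = u x

lemma av_update (i : ι) (Φ : (ι → G) → ℝ) :
    av Φ = av fun x => av fun t => Φ (Function.update x i t) := by
  rcases isEmpty_or_nonempty G with hG | hG
  · have : IsEmpty (ι → G) := ⟨fun x => hG.false (x i)⟩
    congr 1; funext x; exact (this.false x).elim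
  have h1 : av Φ = av fun p : (ι → G) × G => Φ p.1 := by
    rw [av_prod]; simp only [av_const]
  rw [h1, ← av_prod fun p : (ι → G) × G => Φ (Function.update p.1 i p.2)]
  symm
  let e : (ι → G) × G → (ι → G) × G := fun p => (Function.update p.1 i p.2, p.1 i)
  have he : Function.Involutive e := by
    intro p; simp [e]
  exact av_bij e he.bijective fun p => Φ p.1

/-- the linear forms condition, abstract version -/
def LF (ν : ι → (ι → G) → ℝ) (ε : ℝ) : Prop :=
  ∀ S : Finset (ι × Finset ι), (∀ p ∈ S, p.1 ∉ p.2) →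
    |(av fun x : ι → G => av fun y : ι → G => ∏ p ∈ S, ν p.1 (p.2.piecewise y x)) - 1| ≤ ε

lemma LF.nonneg {ν : ι → (ι → G) → ℝ} {ε : ℝ} (h : LF ν ε) : 0 ≤ ε :=
  (abs_nonneg _).trans (h ∅ (by simp))

lemma LF.mono {ν : ι → (ι → G) → ℝ} {ε ε' : ℝ} (h : LF ν ε) (h' : ε ≤ ε') : LF ν ε' :=
  fun S hS => (h S hS).trans h'

lemma LF.replace {ν : ι → (ι → G) → ℝ} {ε : ℝ} (h : LF ν ε) (J : Finset ι) :
    LF (fun j => if j ∈ J then ν j else fun _ => 1) ε := by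
  intro S hS
  have := h (S.filter fun p => p.1 ∈ J) (fun p hp => hS p (mem_filter.1 hp).1)
  refine le_of_eq_of_le ?_ this
  congr 3; funext x; congr 1; funext y
  rw [Finset.prod_filter]
  apply Finset.prod_congr rfl
  intro p _
  by_cases hp : p.1 ∈ J <;> simp [hp]

lemma lf_expand {ν : ι → (ι → G) → ℝ} {ε : ℝ} (h : LF ν ε) (S : Finset (ι × Finset ι))
    (hS : ∀ p ∈ S, p.1 ∉ p.2) (c : ι × Finset ι → ℝ) (hc : ∀ p, |c p| ≤ 1) :
    |(av fun x : ι → G => av fun y : ι → G =>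
      ∏ p ∈ S, (ν p.1 (p.2.piecewise y x) + c p)) - ∏ p ∈ S, (1 + c p)| ≤ 2 ^ S.card * ε := by
  have e1 : (av fun x : ι → G => av fun y : ι → G =>
      ∏ p ∈ S, (ν p.1 (p.2.piecewise y x) + c p)) = ∑ U ∈ S.powerset,
      (av fun x : ι → G => av fun y : ι → G => ∏ p ∈ U, ν p.1 (p.2.piecewise y x)) *
        ∏ p ∈ S \ U, c p := by
    simp only [Finset.prod_add, av_sum, av_mul_right]
  have e2 : ∏ p ∈ S, (1 + c p) = ∑ U ∈ S.powerset, ∏ p ∈ S \ U, c p := by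
    simp only [Finset.prod_add, Finset.prod_const_one, one_mul]
  rw [e1, e2, ← Finset.sum_sub_distrib]
  refine (Finset.abs_sum_le_sum_abs _ _).trans ?_
  have : (2 : ℝ) ^ S.card * ε = ∑ _U ∈ S.powerset, ε := by
    rw [Finset.sum_const, Finset.card_powerset, nsmul_eq_mul]; push_cast; rfl
  rw [this]
  apply Finset.sum_le_sum
  intro U hU
  rw [← sub_one_mul, abs_mul, Finset.abs_prod]
  have h1 := h U (fun p hp => hS p (Finset.mem_powerset.1 hU hp))
  have h2 : ∏ p ∈ S \ U, |c p| ≤ 1 := Finset.prod_le_one (fun _ _ => abs_nonneg _) fun p _ => hc p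
  have h3 : 0 ≤ ∏ p ∈ S \ U, |c p| := Finset.prod_nonneg fun _ _ => abs_nonneg _
  calc _ ≤ ε * 1 := by gcongr; exact h.nonneg
    _ = ε := mul_one _

/-- one Cauchy–Schwarz step -/
lemma cs_step {Q : Type} [Finite Q] (i : ι) (U W F : Q → (ι → G) → (ι → G) → ℝ)
    (hUW : ∀ p x y, |U p x y| ≤ W p x y)
    (hUx : ∀ p x y t, U p (Function.update x i t) y = U p x y)
    (hWx : ∀ p x y t, W p (Function.update x i t) y = W p x y)
    (hWy : ∀ p x y t, W p x (Function.update y i t) = W p x y)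
    (hFy : ∀ p x y t, F p x (Function.update y i t) = F p x y) :
    (av fun p => av fun x => av fun y => U p x y * F p x y) ^ 2 ≤
    (av fun p => av fun x => av fun y => W p x y) *
    (av fun p => av fun x => av fun y =>
      W p x y * (F p x y * F p (Function.update x i (y i)) y)) := by
  set E : Q → (ι → G) → (ι → G) → ℝ := fun p x y => av fun t => F p (Function.update x i t) y
  have e1 : (av fun p => av fun x => av fun y => U p x y * F p x y) =
      av fun z : Q × (ι → G) × (ι → G) => U z.1 z.2.1 z.2.2 * E z.1 z.2.1 z.2.2 := by
    rw [av_prod]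
    congr 1; funext p
    rw [av_prod, av_update i]
    congr 1; funext x
    rw [av_comm]
    congr 1; funext y
    simp only [hUx, av_mul_left, E]
  have e2 : (av fun p => av fun x => av fun y => W p x y) =
      av fun z : Q × (ι → G) × (ι → G) => W z.1 z.2.1 z.2.2 := by
    rw [av_prod]
    congr 1; funext p
    rw [av_prod]
  have e3 : (av fun p => av fun x => av fun y =>
      W p x y * (F p x y * F p (Function.update x i (y i)) y)) =
      av fun z : Q × (ι → G) × (ι → G) => W z.1 z.2.1 z.2.2 * |E z.1 z.2.1 z.2.2| ^ 2 := by
    rw [av_prod]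
    congr 1; funext p
    rw [av_prod, av_update i]
    congr 1; funext x
    have : ∀ t, (av fun y => W p (Function.update x i t) y * (F p (Function.update x i t) y *
        F p (Function.update (Function.update x i t) i (y i)) y)) =
        av fun y => W p x y * (F p (Function.update x i t) y * E p x y) := by
      intro t
      rw [av_update i]
      congr 1; funext y
      simp only [hWx, hWy, hFy, Function.update_idem, Function.update_self, E, av_mul_left]
    simp only [this]
    rw [av_comm]
    congr 1; funext y
    rw [av_mul_left, av_mul_right, sq_abs, sq]
  rw [e1, e2, e3]
  refine le_trans ?_ (av_cauchy_weight fun z => (abs_nonneg _).trans (hUW z.1 z.2.1 z.2.2))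
  rw [← sq_abs]
  gcongr
  refine (abs_av_le _).trans (av_mono fun z => ?_)
  rw [abs_mul]
  gcongr
  exact hUW _ _ _

lemma pw_upd_x {ω : Finset ι} {i : ι} (hi : i ∉ ω) (x y : ι → G) (t : G) :
    ω.piecewise y (Function.update x i t) = Function.update (ω.piecewise y x) i t := by
  exact (Finset.update_piecewise_of_notMem ω y x hi t).symm

lemma pw_upd_y {ω : Finset ι} {i : ι} (hi : i ∉ ω) (x y : ι → G) (t : G) :
    ω.piecewise (Function.update y i t) x = ω.piecewise y x := by
  funext k
  by_cases hk : k ∈ ω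
  · have : k ≠ i := fun h => hi (h ▸ hk)
    simp [hk, this]
  · simp [hk]

lemma pw_insert {ω : Finset ι} {i : ι} (hi : i ∉ ω) (x y : ι → G) :
    ω.piecewise y (Function.update x i (y i)) = (insert i ω).piecewise y x := by
  rw [Finset.piecewise_insert, pw_upd_x hi]

/-- the product appearing after applying Cauchy–Schwarz along `s`. -/
noncomputable def TP {Q : Type} (h : (ι → G) → ℝ) (u w : ι → Q → (ι → G) → ℝ) (I s : Finset ι)
    (p : Q) (x y : ι → G) : ℝ :=
  (∏ ω ∈ s.powerset, (h (ω.piecewise y x) * ∏ i ∈ I \ s, u i p (ω.piecewise y x))) *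
    ∏ i ∈ s, ∏ ω ∈ (s.erase i).powerset, w i p (ω.piecewise y x)

lemma TP_step {Q : Type} [Finite Q] (h : (ι → G) → ℝ) (u w : ι → Q → (ι → G) → ℝ)
    (I s : Finset ι) (i : ι) (hi : i ∈ I) (his : i ∉ s)
    (huw : ∀ p x, |u i p x| ≤ w i p x) (hu : ∀ p, IndC i (u i p)) (hw : ∀ p, IndC i (w i p)) :
    (av fun p => av fun x => av fun y => TP h u w I s p x y) ^ 2 ≤
    (av fun p => av fun x : ι → G => av fun y : ι → G =>
      ∏ ω ∈ s.powerset, w i p (ω.piecewise y x)) *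
    (av fun p => av fun x => av fun y => TP h u w I (insert i s) p x y) := by
  have hω : ∀ ω ∈ s.powerset, i ∉ ω := fun ω h1 h2 => his (Finset.mem_powerset.1 h1 h2)
  have hω' : ∀ i' ∈ s, ∀ ω ∈ (s.erase i').powerset, i ∉ ω := fun i' _ ω h1 h2 =>
    his (Finset.mem_of_mem_erase (Finset.mem_powerset.1 h1 h2))
  set F : Q → (ι → G) → (ι → G) → ℝ := fun p x y =>
    (∏ ω ∈ s.powerset, (h (ω.piecewise y x) * ∏ i ∈ I \ insert i s, u i p (ω.piecewise y x))) *
    ∏ i ∈ s, ∏ ω ∈ (s.erase i).powerset, w i p (ω.piecewise y x) with hF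
  have hI : I \ s = insert i (I \ insert i s) := by
    ext k; simp only [mem_sdiff, mem_insert]
    by_cases hk : k = i
    · subst hk; simp [hi, his]
    · simp [hk]
  have hI' : i ∉ I \ insert i s := by simp
  have key := cs_step (G := G) i (fun p x y => ∏ ω ∈ s.powerset, u i p (ω.piecewise y x))
    (fun p x y => ∏ ω ∈ s.powerset, w i p (ω.piecewise y x)) F ?_ ?_ ?_ ?_ ?_
  · refine le_of_eq_of_le ?_ (key.trans_eq ?_)
    · congr 2; funext p; congr 1; funext x; congr 1; funext y
      simp only [TP, hF]
      rw [hI, ← mul_assoc, ← Finset.prod_mul_distrib]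
      congr 1
      apply Finset.prod_congr rfl
      intro ω _
      rw [Finset.prod_insert hI']; ring
    · congr 2; funext p; congr 1; funext x; congr 1; funext y
      have hN : F p (Function.update x i (y i)) y =
        (∏ ω ∈ s.powerset, (h ((insert i ω).piecewise y x) *
          ∏ i' ∈ I \ insert i s, u i' p ((insert i ω).piecewise y x))) *
        ∏ i' ∈ s, ∏ ω ∈ (s.erase i').powerset, w i' p ((insert i ω).piecewise y x) := by
        simp only [hF]
        congr 1
        · apply Finset.prod_congr rfl
          intro ω h1
          rw [pw_insert (hω ω h1)]
        · apply Finset.prod_congr rfl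
          intro i' h2
          apply Finset.prod_congr rfl
          intro ω h1
          rw [pw_insert (hω' i' h2 ω h1)]
      rw [hN]
      simp only [TP, hF]
      rw [Finset.prod_powerset_insert his, Finset.prod_insert his, Finset.erase_insert his]
      have : ∏ i' ∈ s, ∏ ω ∈ ((insert i s).erase i').powerset, w i' p (ω.piecewise y x) =
        ∏ i' ∈ s, ((∏ ω ∈ (s.erase i').powerset, w i' p (ω.piecewise y x)) *
          ∏ ω ∈ (s.erase i').powerset, w i' p ((insert i ω).piecewise y x)) := by
        apply Finset.prod_congr rfl
        intro i' h2
        have h3 : i ≠ i' := fun h => his (h ▸ h2)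
        rw [Finset.erase_insert_of_ne h3, Finset.prod_powerset_insert]
        exact fun h => his (Finset.mem_of_mem_erase h)
      rw [this]
      simp only [Finset.prod_mul_distrib]
      ring
  · intro p x y
    rw [Finset.abs_prod]
    exact Finset.prod_le_prod (fun _ _ => abs_nonneg _) fun ω _ => huw p _
  · intro p x y t
    apply Finset.prod_congr rfl
    intro ω h1
    rw [pw_upd_x (hω ω h1), hu p]
  · intro p x y t
    apply Finset.prod_congr rfl
    intro ω h1
    rw [pw_upd_x (hω ω h1), hw p]
  · intro p x y t
    apply Finset.prod_congr rfl
    intro ω h1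
    rw [pw_upd_y (hω ω h1)]
  · intro p x y t
    simp only [hF]
    congr 1
    · apply Finset.prod_congr rfl
      intro ω h1
      rw [pw_upd_y (hω ω h1)]
    · apply Finset.prod_congr rfl
      intro i' h2
      apply Finset.prod_congr rfl
      intro ω h1
      rw [pw_upd_y (hω' i' h2 ω h1)]

/-- iterate the Cauchy–Schwarz step -/
lemma TP_iter {Q : Type} [Finite Q] (h : (ι → G) → ℝ) (u w : ι → Q → (ι → G) → ℝ)
    (I : Finset ι) (B : ℝ) (hB : 1 ≤ B)
    (huw : ∀ i ∈ I, ∀ p x, |u i p x| ≤ w i p x) (hu : ∀ i ∈ I, ∀ p, IndC i (u i p))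
    (hw : ∀ i ∈ I, ∀ p, IndC i (w i p))
    (hBw : ∀ i ∈ I, ∀ s ⊆ I, i ∉ s → (av fun p => av fun x : ι → G => av fun y : ι → G =>
      ∏ ω ∈ s.powerset, w i p (ω.piecewise y x)) ≤ B) (s : Finset ι) (hs : s ⊆ I) :
    |av fun p => av fun x => av fun y => TP h u w I ∅ p x y| ^ (2 ^ s.card) ≤
      B ^ (s.card * 2 ^ s.card) * |av fun p => av fun x => av fun y => TP h u w I s p x y| := by
  induction s using Finset.induction_on with
  | empty => simp
  | insert i s his ih =>
    have hiI := hs (mem_insert_self _ _)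
    have hsI : s ⊆ I := fun k hk => hs (mem_insert_of_mem hk)
    have h1 := TP_step h u w I s i hiI his (huw i hiI) (hu i hiI) (hw i hiI)
    specialize ih hsI
    rw [card_insert_of_notMem his, pow_succ, pow_mul]
    set T0 := |av fun p => av fun x => av fun y => TP h u w I ∅ p x y|
    set T1 := av fun p => av fun x => av fun y => TP h u w I s p x y
    set T2 := av fun p => av fun x => av fun y => TP h u w I (insert i s) p x y
    have h2 := hBw i hiI s hsI his
    have h0 : 0 ≤ (av fun p => av fun x : ι → G => av fun y : ι → G =>
      ∏ ω ∈ s.powerset, w i p (ω.piecewise y x)) := av_nonneg fun p => av_nonneg fun x =>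
        av_nonneg fun y => Finset.prod_nonneg fun ω _ => (abs_nonneg _).trans (huw i hiI p _)
    have h3 : T1 ^ 2 ≤ B * |T2| :=
      h1.trans (by
        refine (mul_le_mul_of_nonneg_left (le_abs_self _) h0).trans ?_
        exact mul_le_mul_of_nonneg_right h2 (abs_nonneg _))
    calc (T0 ^ 2 ^ s.card) ^ 2 ≤ (B ^ (s.card * 2 ^ s.card) * |T1|) ^ 2 := by gcongr
      _ = (B ^ (s.card * 2 ^ s.card)) ^ 2 * T1 ^ 2 := by rw [mul_pow, sq_abs]
      _ ≤ (B ^ (s.card * 2 ^ s.card)) ^ 2 * (B * |T2|) := by gcongr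
      _ = B ^ (s.card * 2 ^ s.card * 2 + 1) * |T2| := by ring
      _ ≤ B ^ ((s.card + 1) * (2 ^ s.card * 2)) * |T2| := by
        gcongr ?_ * _
        refine pow_le_pow_right₀ hB ?_
        · have : 1 ≤ 2 ^ s.card := Nat.one_le_two_pow
          nlinarith

end C1
end GT
namespace GT

section C2
variable {ι G : Type} [Fintype ι] [DecidableEq ι] [Finite G] [Nonempty G]

lemma av_param (j : ι) (Φ : G × G → (ι → G) → (ι → G) → ℝ)
    (hx : ∀ p x y t, Φ p (Function.update x j t) y = Φ p x y)
    (hy : ∀ p x y t, Φ p x (Function.update y j t) = Φ p x y) :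
    (av fun p => av fun x => av fun y => Φ p x y) = av fun x => av fun y => Φ (x j, y j) x y := by
  rw [av_update j (fun x => av fun y => Φ (x j, y j) x y), av_comm]
  congr 1; funext x
  rw [av_prod]
  congr 1; funext t
  rw [av_comm]
  rw [av_update j (fun y => Φ _ _ y)]
  simp only [Function.update_self, hx, hy]

/-- number of pairs -/
def KK (ι : Type) [Fintype ι] [DecidableEq ι] : ℕ := Fintype.card (ι × Finset ι)

/-- the weight -/
noncomputable def ww (ν : ι → (ι → G) → ℝ) (j : ι) (i : ι) (p : G × G) (x : ι → G) : ℝ :=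
  (ν i (Function.update x j p.1) + 1) * (ν i (Function.update x j p.2) + 1)

lemma ww_pw (ν : ι → (ι → G) → ℝ) {j : ι} (i : ι) (x y : ι → G) {ω : Finset ι} (h : j ∉ ω) :
    ww ν j i (x j, y j) (ω.piecewise y x) =
      (ν i (ω.piecewise y x) + 1) * (ν i ((insert j ω).piecewise y x) + 1) := by
  unfold ww
  congr 3
  · rw [Function.update_eq_self_iff]; simp [h]
  · rw [Finset.piecewise_insert]

lemma ww_x (ν : ι → (ι → G) → ℝ) {j : ι} (i : ι) (p) (x y : ι → G) {ω : Finset ι} (h : j ∉ ω) (t : G) :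
    ww ν j i p (ω.piecewise y (Function.update x j t)) = ww ν j i p (ω.piecewise y x) := by
  unfold ww
  rw [pw_upd_x h]; simp

lemma ww_y (ν : ι → (ι → G) → ℝ) {j : ι} (i : ι) (p) (x y : ι → G) {ω : Finset ι} (h : j ∉ ω) (t : G) :
    ww ν j i p (ω.piecewise (Function.update y j t) x) = ww ν j i p (ω.piecewise y x) := by
  rw [pw_upd_y h]

lemma ww_bound {ν : ι → (ι → G) → ℝ} {ε : ℝ} (h : LF ν ε) (hε : ε ≤ 1) {i j : ι} (hij : i ≠ j)
    (s : Finset ι) (hjs : j ∉ s) (his : i ∉ s) :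
    (av fun p => av fun x : ι → G => av fun y : ι → G =>
      ∏ ω ∈ s.powerset, ww ν j i p (ω.piecewise y x)) ≤ 2 ^ (KK ι + 1) := by
  have hj : ∀ ω ∈ s.powerset, j ∉ ω := fun ω h1 h2 => hjs (Finset.mem_powerset.1 h1 h2)
  rw [av_param j]
  · have h1 := lf_expand h ({i} ×ˢ (insert j s).powerset) (by
      rintro ⟨a, b⟩ hp
      simp only [mem_product, mem_singleton, mem_powerset] at hp
      rintro hab
      have := hp.2 hab
      rw [hp.1] at this
      simp [hij, his] at this) (fun _ => 1) (by simp)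
    simp only [Finset.prod_product, Finset.prod_singleton] at h1
    have e : ∀ x y : ι → G, ∏ ω ∈ s.powerset, ww ν j i (x j, y j) (ω.piecewise y x) =
        ∏ ω ∈ (insert j s).powerset, (ν i (ω.piecewise y x) + 1) := by
      intro x y
      rw [Finset.prod_powerset_insert hjs, ← Finset.prod_mul_distrib]
      exact Finset.prod_congr rfl fun ω h1 => ww_pw ν i x y (hj ω h1)
    simp only [e]
    have h2 := (abs_le.1 h1).2
    have h3 : ∏ ω ∈ (insert j s).powerset, ((1 : ℝ) + 1) ≤ 2 ^ KK ι := by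
      rw [Finset.prod_const, one_add_one_eq_two]
      apply pow_le_pow_right₀ (by norm_num)
      refine (Finset.card_le_univ _).trans ?_
      unfold KK
      rw [Fintype.card_prod]
      have : 0 < Fintype.card ι := Fintype.card_pos_iff.2 ⟨i⟩
      nlinarith
    have h4 : (2 : ℝ) ^ ({i} ×ˢ (insert j s).powerset).card * ε ≤ 2 ^ KK ι := by
      calc _ ≤ (2 : ℝ) ^ ({i} ×ˢ (insert j s).powerset).card * 1 := by gcongr
        _ ≤ _ := by
          rw [mul_one]
          exact pow_le_pow_right₀ (by norm_num) (Finset.card_le_univ _)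
    rw [pow_succ]
    linarith
  · intro p x y t
    exact Finset.prod_congr rfl fun ω h1 => ww_x ν i p x y (hj ω h1) t
  · intro p x y t
    exact Finset.prod_congr rfl fun ω h1 => ww_y ν i p x y (hj ω h1) t

lemma TP_last {ν : ι → (ι → G) → ℝ} {ε : ℝ} (h : LF ν ε) (j : ι) (hνj : IndC j (ν j))
    (u : ι → G × G → (ι → G) → ℝ) :
    |av fun p => av fun x => av fun y =>
      TP (fun x => ν j x - 1) u (ww ν j) (univ.erase j) (univ.erase j) p x y| ≤
      2 ^ KK ι * ε := by
  have hj : ∀ ω ∈ (univ.erase j).powerset, j ∉ ω := fun ω h1 h2 => by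
    simpa using Finset.mem_powerset.1 h1 h2
  have hj' : ∀ i, ∀ ω ∈ ((univ.erase j).erase i).powerset, j ∉ ω := fun i ω h1 h2 => by
    simpa using Finset.mem_powerset.1 h1 h2
  rw [av_param j]
  · set S : Finset (ι × Finset ι) := univ.filter fun p => p.1 ∉ p.2
    set c : ι × Finset ι → ℝ := fun p => if p.1 = j then -1 else 1
    have h1 := lf_expand h S (by simp [S]) c (by intro p; simp only [c]; split_ifs <;> simp)
    have h0 : ∏ p ∈ S, (1 + c p) = 0 := by
      apply Finset.prod_eq_zero (i := (j, ∅)) <;> simp [S, c]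
    rw [h0, sub_zero] at h1
    have e : ∀ x y : ι → G,
        TP (fun x => ν j x - 1) u (ww ν j) (univ.erase j) (univ.erase j) (x j, y j) x y =
        ∏ p ∈ S, (ν p.1 (p.2.piecewise y x) + c p) := by
      intro x y
      rw [Finset.prod_finset_product S univ (fun i => (univ.erase i).powerset)]
      · rw [← Finset.mul_prod_erase univ _ (mem_univ j)]
        unfold TP
        congr 1
        · apply Finset.prod_congr rfl
          intro ω _
          simp [c, sub_eq_add_neg]
        · apply Finset.prod_congr rfl
          intro i hi
          have hij : i ≠ j := by simpa using hi
          have : univ.erase i = insert j ((univ.erase j).erase i) := by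
            ext k; simp only [mem_erase, mem_univ, and_true, mem_insert]
            by_cases hk : k = j
            · subst hk; simp [hij.symm]
            · simp [hk]
          rw [this, Finset.prod_powerset_insert (by simp), ← Finset.prod_mul_distrib]
          apply Finset.prod_congr rfl
          intro ω h1
          rw [ww_pw ν i x y (hj' i ω h1)]
          simp [c, hij]
      · rintro ⟨a, b⟩
        simp only [S, mem_filter, mem_univ, true_and, mem_powerset]
        constructor
        · intro hab k hk
          rw [mem_erase]; exact ⟨fun h => hab (h ▸ hk), mem_univ _⟩
        · intro hab hk
          simpa using hab hk
    simp only [e]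
    refine h1.trans ?_
    have := h.nonneg
    gcongr
    · norm_num
    · exact Finset.card_le_univ _
  · intro p x y t
    unfold TP
    congr 1
    · apply Finset.prod_congr rfl
      intro ω h1
      simp only [sdiff_self, bot_eq_empty, prod_empty, mul_one]
      rw [pw_upd_x (hj ω h1), hνj]
    · apply Finset.prod_congr rfl
      intro i hi
      exact Finset.prod_congr rfl fun ω h1 => ww_x ν i p x y (hj' i ω h1) t
  · intro p x y t
    unfold TP
    congr 1
    · apply Finset.prod_congr rfl
      intro ω h1
      simp only [sdiff_self, bot_eq_empty, prod_empty, mul_one]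
      rw [pw_upd_y (hj ω h1)]
    · apply Finset.prod_congr rfl
      intro i hi
      exact Finset.prod_congr rfl fun ω h1 => ww_y ν i p x y (hj' i ω h1) t

/-- strong linear forms condition, quantitative -/
lemma slf_quant {ν : ι → (ι → G) → ℝ} {ε : ℝ} (h : LF ν ε) (hε : ε ≤ 1) (j : ι)
    (hν : ∀ i, IndC i (ν i))
    (a b : ι → (ι → G) → ℝ) (ha : ∀ i, i ≠ j → IndC i (a i)) (hb : ∀ i, i ≠ j → IndC i (b i))
    (ha' : ∀ i, i ≠ j → ∀ x, |a i x| ≤ ν i x + 1) (hb' : ∀ i, i ≠ j → ∀ x, |b i x| ≤ ν i x + 1) :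
    |av fun x => (ν j x - 1) * ((av fun t => ∏ i ∈ univ.erase j, a i (Function.update x j t)) *
      av fun t => ∏ i ∈ univ.erase j, b i (Function.update x j t))| ^
        (2 ^ (univ.erase j).card) ≤
      (2 ^ (KK ι + 1)) ^ ((univ.erase j).card * 2 ^ (univ.erase j).card) * (2 ^ KK ι * ε) := by
  set u : ι → G × G → (ι → G) → ℝ := fun i p x =>
    a i (Function.update x j p.1) * b i (Function.update x j p.2)
  have key := TP_iter (fun x => ν j x - 1) u (ww ν j) (univ.erase j) (2 ^ (KK ι + 1))
    (one_le_pow₀ (by norm_num)) ?_ ?_ ?_ ?_ (univ.erase j) subset_rfl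
  · refine le_of_eq_of_le ?_ (key.trans ?_)
    · congr 2
      simp only [TP, powerset_empty, prod_singleton, piecewise_empty, prod_empty, mul_one,
        sdiff_empty, av_const]
      rw [av_comm]
      congr 1; funext x
      rw [av_mul_left, av_prod, av_mul_av]
      simp only [u, Finset.prod_mul_distrib]
    · gcongr
      exact TP_last h j (hν j) u
  · intro i hi p x
    have hij : i ≠ j := by simpa using hi
    simp only [u, ww, abs_mul]
    have h1 := ha' i hij (Function.update x j p.1)
    have h2 := hb' i hij (Function.update x j p.2)
    have h3 := abs_nonneg (a i (Function.update x j p.1))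
    have h4 := abs_nonneg (b i (Function.update x j p.2))
    nlinarith
  · intro i hi p x t
    have hij : i ≠ j := by simpa using hi
    simp only [u]
    rw [Function.update_comm hij, ha i hij, Function.update_comm hij, hb i hij]
  · intro i hi p x t
    have hij : i ≠ j := by simpa using hi
    simp only [ww]
    rw [Function.update_comm hij, hν i, Function.update_comm hij, hν i]
  · intro i hi s hs his
    have hij : i ≠ j := by simpa using hi
    exact ww_bound h hε hij s (fun h => by simpa using hs h) his

/-- strong linear forms condition -/
lemma slf (ι : Type) [Fintype ι] [DecidableEq ι] (ε' : ℝ) (hε' : 0 < ε') :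
    ∃ ε : ℝ, 0 < ε ∧ ∀ (G : Type) [Finite G] [Nonempty G] (ν : ι → (ι → G) → ℝ), LF ν ε →
    (∀ i, IndC i (ν i)) → ∀ (j : ι) (a b : ι → (ι → G) → ℝ), (∀ i, i ≠ j → IndC i (a i)) →
    (∀ i, i ≠ j → IndC i (b i)) → (∀ i, i ≠ j → ∀ x, |a i x| ≤ ν i x + 1) →
    (∀ i, i ≠ j → ∀ x, |b i x| ≤ ν i x + 1) →
    |av fun x => (ν j x - 1) * ((av fun t => ∏ i ∈ univ.erase j, a i (Function.update x j t)) *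
      av fun t => ∏ i ∈ univ.erase j, b i (Function.update x j t))| ≤ ε' := by
  set n := Fintype.card ι - 1 with hn
  set D : ℝ := (2 ^ (KK ι + 1)) ^ (n * 2 ^ n) * 2 ^ KK ι with hD
  have hDpos : 0 < D := by positivity
  refine ⟨min 1 (ε' ^ (2 ^ n) / D), by positivity, ?_⟩
  intro G _ _ ν h hν j a b ha hb ha' hb'
  have hc : (univ.erase j).card = n := by
    rw [card_erase_of_mem (mem_univ _), card_univ]
  have := slf_quant h (min_le_left _ _) j hν a b ha hb ha' hb'
  rw [hc, ← mul_assoc, ← hD] at this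
  have h2 : D * min 1 (ε' ^ (2 ^ n) / D) ≤ ε' ^ (2 ^ n) := by
    calc _ ≤ D * (ε' ^ (2 ^ n) / D) := by gcongr; exact min_le_right _ _
      _ = _ := by field_simp
  exact le_of_pow_le_pow_left₀ (by positivity) hε'.le (this.trans h2)

end C2
end GT
namespace GT

section C3
variable {ι G : Type} [Fintype ι] [DecidableEq ι] [Finite G] [Nonempty G]

/-- integrate out coordinate `j` of `∏_{i≠j} u_i` -/
noncomputable def prm (j : ι) (u : ι → (ι → G) → ℝ) (x : ι → G) : ℝ :=
  av fun t => ∏ i ∈ univ.erase j, u i (Function.update x j t)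

lemma prm_ind (j : ι) (u : ι → (ι → G) → ℝ) : IndC j (prm j u) := by
  intro x t; simp [prm]

lemma av_split (j : ι) (v : (ι → G) → ℝ) (hv : IndC j v) (u : ι → (ι → G) → ℝ) :
    (av fun x => v x * ∏ i ∈ univ.erase j, u i x) = av fun x => v x * prm j u x := by
  rw [av_update j]
  congr 1; funext x
  simp only [hv x, av_mul_left, prm]

lemma prm_nonneg (j : ι) (u : ι → (ι → G) → ℝ) (hu : ∀ i x, 0 ≤ u i x) (x) : 0 ≤ prm j u x :=
  av_nonneg fun _ => prod_nonneg fun i _ => hu i _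

lemma prm_mono (j : ι) (u v : ι → (ι → G) → ℝ) (hu : ∀ i x, 0 ≤ u i x)
    (huv : ∀ i x, u i x ≤ v i x) (x) : prm j u x ≤ prm j v x :=
  av_mono fun _ => prod_le_prod (fun i _ => hu i _) fun i _ => huv i _

lemma prm_le_one (j : ι) (u : ι → (ι → G) → ℝ) (hu : ∀ i x, 0 ≤ u i x)
    (hu1 : ∀ i x, u i x ≤ 1) (x) : prm j u x ≤ 1 :=
  av_le_of_le fun _ => prod_le_one (fun i _ => hu i _) fun i _ => hu1 i _

/-- `ν'` is close to 1 in `L²` -/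
lemma prm_var {ν : ι → (ι → G) → ℝ} {ε : ℝ} (h : LF ν ε) (j : ι) :
    (av fun x => (prm j ν x - 1) ^ 2) ≤ 3 * ε := by
  have h1 := h ((univ.erase j) ×ˢ {∅}) (by rintro ⟨a, b⟩ hp; simp at hp; simp [← hp.2])
  have h2 := h ((univ.erase j) ×ˢ {∅, {j}}) (by
    rintro ⟨a, b⟩ hp; simp at hp
    rcases hp.2 with hb | hb <;> simp [hb, hp.1])
  simp only [prod_product, prod_singleton, piecewise_empty, av_const] at h1
  have hne : (∅ : Finset ι) ∉ ({{j}} : Finset (Finset ι)) := by simp [eq_comm]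
  simp only [prod_product, prod_insert hne, prod_singleton, piecewise_empty,
    prod_mul_distrib] at h2
  have e1 : (av fun x => ∏ i ∈ univ.erase j, ν i x) = av fun x => prm j ν x := by
    have := av_split j (fun _ => 1) (fun _ _ => rfl) ν
    simpa using this
  have e2 : (av fun x : ι → G => av fun y : ι → G => (∏ i ∈ univ.erase j, ν i x) *
      ∏ i ∈ univ.erase j, ν i (({j} : Finset ι).piecewise y x)) = av fun x => prm j ν x ^ 2 := by
    have : ∀ x : ι → G, (av fun y : ι → G =>
        ∏ i ∈ univ.erase j, ν i (({j} : Finset ι).piecewise y x)) = prm j ν x := by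
      intro x
      rw [av_update j]
      simp only [prm, Finset.piecewise_singleton, Function.update_self, av_const]
    simp only [av_mul_left, this]
    rw [av_update j]
    congr 1; funext x
    simp only [prm_ind j ν x, av_mul_right]
    rw [sq]; rfl
  rw [e1] at h1
  rw [e2] at h2
  have e3 : (av fun x => (prm j ν x - 1) ^ 2) =
      (av fun x => prm j ν x ^ 2) - 2 * (av fun x => prm j ν x) + 1 := by
    rw [← av_mul_left, ← av_sub, ← av_const (X := ι → G) 1, ← av_add]
    congr 1; funext x; rw [av_const]; ring
  rw [e3]
  have := abs_le.1 h1
  have := abs_le.1 h2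
  linarith

/-- hypotheses of the counting lemma -/
structure CH (ν g g' : ι → (ι → G) → ℝ) (ε : ℝ) : Prop where
  lf : LF ν ε
  ν0 : ∀ i x, 0 ≤ ν i x
  νi : ∀ i, IndC i (ν i)
  gi : ∀ i, IndC i (g i)
  gi' : ∀ i, IndC i (g' i)
  g0 : ∀ i x, 0 ≤ g i x
  g1 : ∀ i x, g i x ≤ ν i x
  g0' : ∀ i x, 0 ≤ g' i x
  g1' : ∀ i x, g' i x ≤ 1
  cut : ∀ j, ∀ u : ι → (ι → G) → ℝ, (∀ i, IndC i (u i)) → (∀ i x, 0 ≤ u i x) →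
    (∀ i x, u i x ≤ 1) → |av fun x => (g j x - g' j x) * ∏ i ∈ univ.erase j, u i x| ≤ ε

lemma counting_base {ν g g' : ι → (ι → G) → ℝ} {ε : ℝ} (h : CH ν g g' ε)
    (hν : ∀ i x, ν i x = 1) (s : Finset ι) :
    |(av fun x => ∏ i, (if i ∈ s then g i x else g' i x)) - av fun x => ∏ i, g' i x| ≤
      s.card * ε := by
  induction s using Finset.induction_on with
  | empty => simp
  | insert j s hj ih =>
    have hc := h.cut j (fun i x => if i ∈ s then g i x else g' i x) ?_ ?_ ?_
    · have e : (av fun x => ∏ i, (if i ∈ insert j s then g i x else g' i x)) =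
          (av fun x => ∏ i, (if i ∈ s then g i x else g' i x)) +
          av fun x => (g j x - g' j x) * ∏ i ∈ univ.erase j, (if i ∈ s then g i x else g' i x) := by
        rw [← av_add]
        congr 1; funext x
        rw [← mul_prod_erase univ _ (mem_univ j),
          ← mul_prod_erase univ (fun i => if i ∈ s then g i x else g' i x) (mem_univ j)]
        have : ∏ i ∈ univ.erase j, (if i ∈ insert j s then g i x else g' i x) =
            ∏ i ∈ univ.erase j, (if i ∈ s then g i x else g' i x) := by
          apply prod_congr rfl
          intro i hi
          have : i ≠ j := by simpa using hi
          simp [mem_insert, this]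
        rw [this]
        simp [hj]; ring
      rw [e, card_insert_of_notMem hj]
      push_cast
      have := abs_le.1 hc
      have := abs_le.1 ih
      rw [abs_le]; constructor <;> linarith
    · intro i x t
      by_cases hi : i ∈ s
      · simp only [hi, if_true]; exact h.gi i x t
      · simp only [hi, if_false]; exact h.gi' i x t
    · intro i x
      by_cases hi : i ∈ s
      · simp only [hi, if_true]; exact h.g0 i x
      · simp only [hi, if_false]; exact h.g0' i x
    · intro i x
      by_cases hi : i ∈ s
      · simp only [hi, if_true]; exact (h.g1 i x).trans_eq (hν i x)
      · simp only [hi, if_false]; exact h.g1' i x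

lemma CH.replace {ν g g' : ι → (ι → G) → ℝ} {ε : ℝ} (h : CH ν g g' ε) (j : ι)
    (m : (ι → G) → ℝ) (hm : IndC j m) (m0 : ∀ x, 0 ≤ m x) (m1 : ∀ x, m x ≤ 1) :
    CH (fun i => if i ∈ univ.erase j then ν i else fun _ => 1) (Function.update g j m)
      (Function.update g' j m) ε where
  lf := h.lf.replace _
  ν0 i x := by
    by_cases hi : i = j
    · simp [hi]
    · simpa [hi] using h.ν0 i x
  νi i := by
    by_cases hi : i = j
    · simp only [hi]; intro x t; simp
    · simpa [hi] using h.νi i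
  gi i := by
    by_cases hi : i = j
    · subst hi; simpa using hm
    · simpa [hi] using h.gi i
  gi' i := by
    by_cases hi : i = j
    · subst hi; simpa using hm
    · simpa [hi] using h.gi' i
  g0 i x := by
    by_cases hi : i = j
    · subst hi; simpa using m0 x
    · simpa [hi] using h.g0 i x
  g1 i x := by
    by_cases hi : i = j
    · subst hi; simpa using m1 x
    · simpa [hi] using h.g1 i x
  g0' i x := by
    by_cases hi : i = j
    · subst hi; simpa using m0 x
    · simpa [hi] using h.g0' i x
  g1' i x := by
    by_cases hi : i = j
    · subst hi; simpa using m1 x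
    · simpa [hi] using h.g1' i x
  cut i u hu u0 u1 := by
    by_cases hi : i = j
    · subst hi; simpa [av_const] using h.lf.nonneg
    · simpa [hi] using h.cut i u hu u0 u1

lemma prod_upd (j : ι) (g : ι → (ι → G) → ℝ) (m : (ι → G) → ℝ) (x : ι → G) :
    ∏ i, Function.update g j m i x = m x * ∏ i ∈ univ.erase j, g i x := by
  rw [← mul_prod_erase univ _ (mem_univ j)]
  congr 1
  · simp
  · apply prod_congr rfl
    intro i hi
    have : i ≠ j := by simpa using hi
    simp [this]

lemma counting_step {ν g g' : ι → (ι → G) → ℝ} {ε η : ℝ} (h : CH ν g g' ε) (j : ι)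
    (hη : 0 < η) (hη1 : η ≤ 1) (hε : ε ≤ η ^ 2)
    (hslf : ∀ (a b : ι → (ι → G) → ℝ), (∀ i, i ≠ j → IndC i (a i)) →
      (∀ i, i ≠ j → IndC i (b i)) → (∀ i, i ≠ j → ∀ x, |a i x| ≤ ν i x + 1) →
      (∀ i, i ≠ j → ∀ x, |b i x| ≤ ν i x + 1) →
      |av fun x => (ν j x - 1) * (prm j a x * prm j b x)| ≤ η)
    (ih : ∀ m : (ι → G) → ℝ, IndC j m → (∀ x, 0 ≤ m x) → (∀ x, m x ≤ 1) →
      |(av fun x => m x * prm j g x) - av fun x => m x * prm j g' x| ≤ η) :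
    |(av fun x => ∏ i, g i x) - av fun x => ∏ i, g' i x| ≤ Real.sqrt (26 * η) + η := by
  have hε0 := h.lf.nonneg
  have hεη : ε ≤ η := by nlinarith
  set P := prm j g with hP
  set P' := prm j g' with hP'
  set V := prm j ν with hV
  have P0 : ∀ x, 0 ≤ P x := prm_nonneg j g h.g0
  have P1 : ∀ x, P x ≤ V x := prm_mono j g ν h.g0 h.g1
  have P0' : ∀ x, 0 ≤ P' x := prm_nonneg j g' h.g0'
  have P1' : ∀ x, P' x ≤ 1 := prm_le_one j g' h.g0' h.g1'
  -- split
  have e1 : (av fun x => ∏ i, g i x) = av fun x => g j x * P x := by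
    rw [hP, ← av_split j (g j) (h.gi j) g]
    congr 1; funext x; exact (mul_prod_erase univ (fun i => g i x) (mem_univ j)).symm
  have e2 : (av fun x => ∏ i, g' i x) = av fun x => g' j x * P' x := by
    rw [hP', ← av_split j (g' j) (h.gi' j) g']
    congr 1; funext x; exact (mul_prod_erase univ (fun i => g' i x) (mem_univ j)).symm
  have c2 : |av fun x => (g j x - g' j x) * P' x| ≤ ε := by
    rw [hP', ← av_split j (fun x => g j x - g' j x) (fun x t => by simp only [h.gi j x t, h.gi' j x t]) g']
    exact h.cut j g' h.gi' h.g0' h.g1'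
  have e3 : (av fun x => ∏ i, g i x) - (av fun x => ∏ i, g' i x) =
      (av fun x => g j x * (P x - P' x)) + av fun x => (g j x - g' j x) * P' x := by
    rw [e1, e2, ← av_sub, ← av_add]; congr 1; funext x; ring
  -- variance
  have hvar : (av fun x => (V x - 1) ^ 2) ≤ 3 * ε := prm_var h.lf j
  have hvar1 : (av fun x => |V x - 1|) ≤ 2 * η := by
    have := av_sq_le (fun x => |V x - 1|)
    simp only [sq_abs] at this
    have h2 : (av fun x => |V x - 1|) ^ 2 ≤ (2 * η) ^ 2 := by nlinarith
    exact le_of_pow_le_pow_left₀ (by norm_num) (by positivity) h2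
  have h2' : (av fun x => (P x - P' x) ^ 2) ≤ 9 * η := by
    have i1 := ih (fun x => min (P x) 1) (fun x t => by
      show min (P _) 1 = min (P x) 1
      rw [hP, prm_ind j g x t]) (fun x => le_min (P0 x) zero_le_one) fun x => min_le_right _ _
    have i2 := ih P' (prm_ind j g') P0' P1'
    rw [← av_sub] at i1 i2
    have hpt : ∀ x, (P x - P' x) ^ 2 ≤ (min (P x) 1 * P x - min (P x) 1 * P' x)
        - (P' x * P x - P' x * P' x) + ((V x - 1) ^ 2 + 2 * |V x - 1|) := by
      intro x
      have p0 := P0 x; have p1 := P1 x; have p0' := P0' x; have p1' := P1' x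
      rcases le_total (P x) 1 with hx | hx
      · rw [min_eq_left hx]
        nlinarith [sq_nonneg (V x - 1), abs_nonneg (V x - 1)]
      · rw [min_eq_right hx]
        rw [abs_of_nonneg (by linarith)]
        nlinarith
    have := av_mono hpt
    rw [av_add, av_sub, av_add, av_mul_left] at this
    have := abs_le.1 i1
    have := abs_le.1 i2
    nlinarith
  have h3 : (av fun x => (ν j x - 1) * (P x - P' x) ^ 2) ≤ 4 * η := by
    have hg : ∀ i, i ≠ j → ∀ x, |g i x| ≤ ν i x + 1 := fun i _ x => by
      rw [abs_of_nonneg (h.g0 i x)]; linarith [h.g1 i x]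
    have hg' : ∀ i, i ≠ j → ∀ x, |g' i x| ≤ ν i x + 1 := fun i _ x => by
      rw [abs_of_nonneg (h.g0' i x)]; linarith [h.g1' i x, h.ν0 i x]
    have s1 := abs_le.1 (hslf g g (fun i _ => h.gi i) (fun i _ => h.gi i) hg hg)
    have s2 := abs_le.1 (hslf g g' (fun i _ => h.gi i) (fun i _ => h.gi' i) hg hg')
    have s3 := abs_le.1 (hslf g' g' (fun i _ => h.gi' i) (fun i _ => h.gi' i) hg' hg')
    have : (av fun x => (ν j x - 1) * (P x - P' x) ^ 2) =
      (av fun x => (ν j x - 1) * (P x * P x)) - 2 * (av fun x => (ν j x - 1) * (P x * P' x)) +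
      av fun x => (ν j x - 1) * (P' x * P' x) := by
      rw [← av_mul_left, ← av_sub, ← av_add]; congr 1; funext x; ring
    rw [this]; linarith
  have h4 : (av fun x => ν j x * |P x - P' x| ^ 2) ≤ 13 * η := by
    have : (av fun x => ν j x * |P x - P' x| ^ 2) =
      (av fun x => (ν j x - 1) * (P x - P' x) ^ 2) + av fun x => (P x - P' x) ^ 2 := by
      rw [← av_add]; congr 1; funext x; rw [sq_abs]; ring
    rw [this]; linarith
  have h5 : (av fun x => ν j x) ≤ 2 := by
    have := h.lf {(j, ∅)} (by simp)
    simp only [prod_singleton, piecewise_empty, av_const] at this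
    have := (abs_le.1 this).2
    linarith
  have h6 : |av fun x => g j x * (P x - P' x)| ≤ av fun x => ν j x * |P x - P' x| := by
    refine (abs_av_le _).trans (av_mono fun x => ?_)
    rw [abs_mul, abs_of_nonneg (h.g0 j x)]
    gcongr
    exact h.g1 j x
  have h7 : (av fun x => ν j x * |P x - P' x|) ^ 2 ≤ 26 * η := by
    refine (av_cauchy_weight (h.ν0 j)).trans ?_
    have : 0 ≤ (av fun x => ν j x * |P x - P' x| ^ 2) :=
      av_nonneg fun x => mul_nonneg (h.ν0 j x) (by positivity)
    have : 0 ≤ av (ν j) := av_nonneg (h.ν0 j)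
    have h5' : av (ν j) ≤ 2 := h5
    nlinarith
  have h8 := h6.trans (Real.le_sqrt_of_sq_le h7)
  rw [e3]
  refine (abs_add_le _ _).trans ?_
  linarith

/-- the counting lemma -/
theorem counting (ι : Type) [Fintype ι] [DecidableEq ι] (J : Finset ι) :
    ∀ ε' : ℝ, 0 < ε' → ∃ ε : ℝ, 0 < ε ∧ ∀ (G : Type) [Finite G] [Nonempty G]
      (ν g g' : ι → (ι → G) → ℝ), CH ν g g' ε → (∀ i ∉ J, ∀ x, ν i x = 1) →
      |(av fun x => ∏ i, g i x) - av fun x => ∏ i, g' i x| ≤ ε' := by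
  induction J using Finset.induction_on with
  | empty =>
    intro ε' hε'
    refine ⟨ε' / (Fintype.card ι + 1), by positivity, ?_⟩
    intro G _ _ ν g g' h hν
    have := counting_base h (fun i x => hν i (by simp) x) univ
    simp only [mem_univ, if_true] at this
    refine this.trans ?_
    rw [card_univ, mul_div_assoc', div_le_iff₀ (by positivity)]
    nlinarith
  | insert j J hj ih =>
    intro ε' hε'
    set η := min 1 (min (ε' ^ 2 / 104) (ε' / 2)) with hη
    have hη0 : 0 < η := by positivity
    obtain ⟨ε1, hε1, H1⟩ := ih η hη0
    obtain ⟨ε2, hε2, H2⟩ := slf ι η hη0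
    refine ⟨min (min ε1 ε2) (η ^ 2), by positivity, ?_⟩
    intro G _ _ ν g g' h hν
    have hm1 : min (min ε1 ε2) (η ^ 2) ≤ ε1 := (min_le_left _ _).trans (min_le_left _ _)
    have hm2 : min (min ε1 ε2) (η ^ 2) ≤ ε2 := (min_le_left _ _).trans (min_le_right _ _)
    have key := counting_step h j hη0 (min_le_left _ _) (min_le_right _ _)
      (fun a b ha hb ha' hb' => H2 G ν (h.lf.mono hm2) h.νi j a b ha hb ha' hb') ?_
    · refine key.trans ?_
      have h1 : η ≤ ε' / 2 := (min_le_right _ _).trans (min_le_right _ _)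
      have h2 : η ≤ ε' ^ 2 / 104 := (min_le_right _ _).trans (min_le_left _ _)
      have : Real.sqrt (26 * η) ≤ ε' / 2 := by
        apply Real.sqrt_le_iff.2 ⟨by positivity, by nlinarith⟩
      linarith
    · intro m hm m0 m1
      have hr := h.replace j m hm m0 m1
      have hr' : CH (fun i => if i ∈ univ.erase j then ν i else fun _ => 1) (Function.update g j m)
        (Function.update g' j m) ε1 := { hr with
          lf := hr.lf.mono hm1
          cut := fun i u a b c => (hr.cut i u a b c).trans hm1 }
      have := H1 G _ _ _ hr' (by
        intro i hi x
        by_cases hij : i = j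
        · simp [hij]
        · simpa [hij] using hν i (by simp [hij, hi]) x)
      simp only [prod_upd] at this
      rwa [av_split j m hm, av_split j m hm] at this

end C3
end GT
namespace GT

section C4

lemma av_mem_convex {Z Y : Type} [Finite Z] [Nonempty Z] {C : Set (Y → ℝ)} (hC : Convex ℝ C)
    (φ : Z → Y → ℝ) (h : ∀ z, φ z ∈ C) : (fun y => av fun z => φ z y) ∈ C := by
  have := Fintype.ofFinite Z
  have hc : (0 : ℝ) < Fintype.card Z := by exact_mod_cast Fintype.card_pos
  have e : (fun y => av fun z => φ z y) = ∑ z, (1 / Fintype.card Z : ℝ) • φ z := by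
    funext y
    rw [av_eq, Finset.sum_apply, Finset.sum_div]
    apply Finset.sum_congr rfl
    intro z _
    simp [div_eq_inv_mul]
  rw [e]
  apply hC.sum_mem
  · intro z _; positivity
  · simp [hc.ne']
  · intro z _; exact h z

lemma hull_mul {Y : Type} {A : Set (Y → ℝ)}
    (h : ∀ a ∈ A, ∀ b ∈ A, a * b ∈ convexHull ℝ A) :
    ∀ a ∈ convexHull ℝ A, ∀ b ∈ convexHull ℝ A, a * b ∈ convexHull ℝ A := by
  have h1 : ∀ a ∈ A, ∀ b ∈ convexHull ℝ A, a * b ∈ convexHull ℝ A := by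
    intro a ha
    have hc : Convex ℝ {b : Y → ℝ | a * b ∈ convexHull ℝ A} :=
      (convex_convexHull ℝ A).linear_preimage (LinearMap.mulLeft ℝ a)
    exact fun b hb => convexHull_min (fun b hb => h a ha b hb) hc hb
  intro a ha b hb
  have hc : Convex ℝ {a : Y → ℝ | a * b ∈ convexHull ℝ A} :=
    (convex_convexHull ℝ A).linear_preimage (LinearMap.mulRight ℝ b)
  exact convexHull_min (fun a ha => h1 a ha b hb) hc ha

lemma hull_pow {Y : Type} {A : Set (Y → ℝ)} (h1 : (1 : Y → ℝ) ∈ A)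
    (h : ∀ a ∈ A, ∀ b ∈ A, a * b ∈ convexHull ℝ A) (a) (ha : a ∈ convexHull ℝ A) (n : ℕ) :
    a ^ n ∈ convexHull ℝ A := by
  induction n with
  | zero => rw [pow_zero]; exact subset_convexHull ℝ A h1
  | succ n ih => rw [pow_succ]; exact hull_mul h _ ih _ ha

/-- linear functional `ψ ↦ av (w ψ)` -/
noncomputable def avL {Y : Type} [Finite Y] (w : Y → ℝ) : (Y → ℝ) →ₗ[ℝ] ℝ where
  toFun ψ := av fun y => w y * ψ y
  map_add' a b := by simp only [Pi.add_apply, mul_add, av_add]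
  map_smul' c a := by
    simp only [Pi.smul_apply, smul_eq_mul, RingHom.id_apply, ← av_mul_left]
    congr 1; funext y; ring

lemma hull_abs {Y : Type} [Finite Y] {A : Set (Y → ℝ)} (w : Y → ℝ) (ε : ℝ)
    (h : ∀ a ∈ A, |av fun y => w y * a y| ≤ ε) :
    ∀ a ∈ convexHull ℝ A, |av fun y => w y * a y| ≤ ε := by
  intro a ha
  have hc : Convex ℝ ((avL w) ⁻¹' (Set.Icc (-ε) ε)) := (convex_Icc _ _).linear_preimage (avL w)
  have := convexHull_min (fun b hb => ?_) hc ha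
  · exact abs_le.2 this
  · exact abs_le.1 (h b hb)

lemma hull_bdd {Y : Type} {A : Set (Y → ℝ)} (h : ∀ a ∈ A, ∀ y, |a y| ≤ 1) :
    ∀ a ∈ convexHull ℝ A, ∀ y, |a y| ≤ 1 := by
  intro a ha y
  have hc : Convex ℝ ((LinearMap.proj y : (Y → ℝ) →ₗ[ℝ] ℝ) ⁻¹' (Set.Icc (-1) 1)) :=
    (convex_Icc _ _).linear_preimage _
  have := convexHull_min (fun b hb => ?_) hc ha
  · exact abs_le.2 this
  · exact abs_le.1 (h b hb y)

/-- minimax step -/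
lemma dm_minimax {Y : Type} [Finite Y] [Nonempty Y] (C : Set (Y → ℝ)) (hC : Convex ℝ C)
    (f : Y → ℝ) (ε : ℝ)
    (H : ∀ ψ ∈ C, ∃ x : Y → ℝ, (∀ y, x y ∈ Set.Icc (0 : ℝ) 1) ∧ (av fun y => (f y - x y) * ψ y) ≤ ε) :
    ∃ x : Y → ℝ, (∀ y, x y ∈ Set.Icc (0 : ℝ) 1) ∧ ∀ ψ ∈ C, (av fun y => (f y - x y) * ψ y) ≤ ε := by
  by_contra! hcon
  set X : Set (Y → ℝ) := Set.univ.pi fun _ => Set.Icc (0 : ℝ) 1 with hX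
  have kX : IsCompact X := isCompact_univ_pi fun _ => isCompact_Icc
  have cX : Convex ℝ X := convex_pi fun _ _ => convex_Icc _ _
  have ne_X : X.Nonempty := ⟨fun _ => 0, fun _ _ => by simp⟩
  have memX : ∀ x : Y → ℝ, x ∈ X ↔ ∀ y, x y ∈ Set.Icc (0 : ℝ) 1 := by
    intro x; simp only [hX, Set.mem_univ_pi]
  set F : (Y → ℝ) → (Y → ℝ) → ℝ := fun x ψ => av fun y => (f y - x y) * ψ y with hF
  have hcx : ∀ ψ, Continuous fun x => F x ψ := by
    intro ψ
    have := Fintype.ofFinite Y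
    simp only [hF, av_eq]
    fun_prop
  have hcy : ∀ x, Continuous fun ψ => F x ψ := by
    intro x
    have := Fintype.ofFinite Y
    simp only [hF, av_eq]
    fun_prop
  obtain ⟨s, hs⟩ := kX.elim_finite_subcover (fun ψ : C => {x | ε < F x ψ})
    (fun ψ => isOpen_lt continuous_const (hcx ψ)) (by
      intro x hx
      obtain ⟨ψ, hψ, h⟩ := hcon x ((memX x).1 hx)
      exact Set.mem_iUnion.2 ⟨⟨ψ, hψ⟩, h⟩)
  have affx : ∀ ψ x x' : Y → ℝ, ∀ a b : ℝ, a + b = 1 → F (a • x + b • x') ψ = a * F x ψ + b * F x' ψ := by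
    intro ψ x x' a b hab
    simp only [hF, ← av_mul_left, ← av_add]
    congr 1; funext y
    simp only [Pi.add_apply, Pi.smul_apply, smul_eq_mul]
    have : b = 1 - a := by linarith
    subst this; ring
  have affy : ∀ x ψ ψ' : Y → ℝ, ∀ a b : ℝ, F x (a • ψ + b • ψ') = a * F x ψ + b * F x ψ' := by
    intro x ψ ψ' a b
    simp only [hF, ← av_mul_left, ← av_add]
    congr 1; funext y
    simp only [Pi.add_apply, Pi.smul_apply, smul_eq_mul]
    ring
  obtain ⟨ψ0, hψ0, h0⟩ := Sion.exists_lt_iInf_of_lt_iInf_of_finite (f := F) (X := X) (Y := C)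
    ne_X kX (fun ψ _ => (hcx ψ).lowerSemicontinuous.lowerSemicontinuousOn _)
    (fun ψ _ => ConvexOn.quasiconvexOn ⟨cX, fun x _ x' _ a b _ _ hab => by
      exact (affx ψ x x' a b hab).le⟩)
    hC (fun x _ => (hcy x).upperSemicontinuous.upperSemicontinuousOn _)
    (fun x _ => ConcaveOn.quasiconcaveOn ⟨hC, fun ψ _ ψ' _ a b _ _ hab => by
      exact (affy x ψ ψ' a b).ge⟩)
    cX (s := Set.image Subtype.val (s : Set C)) (Set.toFinite _) (by rintro _ ⟨a, _, rfl⟩; exact a.2)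
    (t := ε) (by
      intro x hx
      obtain ⟨ψ, hψ⟩ := Set.mem_iUnion.1 (hs hx)
      obtain ⟨h1, h2⟩ := Set.mem_iUnion.1 hψ
      exact ⟨ψ, ⟨ψ, h1, rfl⟩, h2⟩)
  obtain ⟨x, hx, h⟩ := H ψ0 hψ0
  exact absurd (h0 x ((memX x).2 hx)) (not_lt.2 h)

/-- dense model theorem, abstract form -/
theorem dense_model (ε : ℝ) (hε : 0 < ε) : ∃ ε1 : ℝ, 0 < ε1 ∧ ∀ (Y : Type) [Finite Y] [Nonempty Y]
    (A : Set (Y → ℝ)) (ν f : Y → ℝ), (1 : Y → ℝ) ∈ A → (∀ a ∈ A, ∀ y, |a y| ≤ 1) →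
    (∀ a ∈ A, ∀ b ∈ A, a * b ∈ convexHull ℝ A) →
    (∀ a ∈ A, |av fun y => (ν y - 1) * a y| ≤ ε1) → (∀ y, 0 ≤ f y) → (∀ y, f y ≤ ν y) →
    ∃ f' : Y → ℝ, (∀ y, 0 ≤ f' y) ∧ (∀ y, f' y ≤ 1) ∧
      ∀ a ∈ A, (av fun y => (f y - f' y) * a y) ≤ ε := by
  obtain ⟨p, hp⟩ := exists_polynomial_near_of_continuousOn (-1) 1 (fun t : ℝ => max t 0)
    (by fun_prop) (ε / 8) (by positivity)
  set D : ℝ := ∑ d ∈ p.support, |p.coeff d| with hD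
  have hD0 : 0 ≤ D := sum_nonneg fun _ _ => abs_nonneg _
  refine ⟨min 1 (ε / (4 * (D + 1))), by positivity, ?_⟩
  set ε1 := min 1 (ε / (4 * (D + 1))) with hε1
  intro Y _ _ A ν f h1 hb hmul hν f0 f1
  have hν1 : |av fun y => (ν y - 1) * 1| ≤ ε1 := hν 1 h1
  have hν2 : av ν ≤ 2 := by
    simp only [mul_one] at hν1
    rw [av_sub, av_const] at hν1
    have := (abs_le.1 hν1).2
    have : ε1 ≤ 1 := min_le_left _ _
    have e : (av fun y => ν y) = av ν := rfl
    linarith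
  obtain ⟨x, hx, h⟩ := dm_minimax (convexHull ℝ A) (convex_convexHull ℝ A) f ε (by
    intro ψ hψ
    refine ⟨fun y => if 0 ≤ ψ y then 1 else 0, fun y => by beta_reduce; split_ifs <;> simp, ?_⟩
    have hψ1 := hull_bdd hb ψ hψ
    have hpow : |av fun y => (ν y - 1) * p.eval (ψ y)| ≤ D * ε1 := by
      have e : (av fun y => (ν y - 1) * p.eval (ψ y)) =
          ∑ d ∈ p.support, p.coeff d * av fun y => (ν y - 1) * (ψ ^ d) y := by
        simp only [← av_mul_left, ← av_sum]
        congr 1; funext y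
        rw [Polynomial.eval_eq_sum, Polynomial.sum, mul_sum]
        apply sum_congr rfl
        intro d _
        simp only [Pi.pow_apply]; ring
      rw [e, hD, sum_mul]
      refine (abs_sum_le_sum_abs _ _).trans (sum_le_sum fun d _ => ?_)
      rw [abs_mul]
      gcongr
      exact hull_abs (fun y => ν y - 1) ε1 hν _ (hull_pow h1 hmul ψ hψ d)
    have hpt : ∀ y, (f y - if 0 ≤ ψ y then 1 else 0) * ψ y ≤
        (ν y - 1) * p.eval (ψ y) + (ν y + 1) * (ε / 8) := by
      intro y
      have hy := hp (ψ y) (abs_le.1 (hψ1 y))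
      have a1 := (abs_lt.1 hy).1
      have a2 := (abs_lt.1 hy).2
      have n0 : 0 ≤ ν y := (f0 y).trans (f1 y)
      have := f0 y; have := f1 y
      split_ifs with hs
      · rw [max_eq_left hs] at a1 a2
        nlinarith
      · rw [max_eq_right (not_le.1 hs).le] at a1 a2
        push Not at hs
        nlinarith
    refine (av_mono hpt).trans ?_
    rw [av_add, av_mul_right, av_add, av_const]
    have e : (av fun y => ν y) = av ν := rfl
    have h5 := (abs_le.1 hpow).2
    have h6 : D * ε1 ≤ ε / 4 := by
      calc D * ε1 ≤ (D + 1) * (ε / (4 * (D + 1))) := by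
            gcongr
            · linarith
            · exact min_le_right _ _
        _ = ε / 4 := by field_simp
    rw [e]
    nlinarith)
  exact ⟨x, fun y => (hx y).1, fun y => (hx y).2, fun a ha => h a (subset_convexHull ℝ A ha)⟩

end C4
end GT
namespace GT

section C5
variable {K : Type} [Field K] [Finite K]

/-- test functions -/
structure GoodT {ι G : Type} [DecidableEq ι] (u : ι → (ι → G) → ℝ) : Prop where
  ind : ∀ i, IndC i (u i)
  nonneg : ∀ i x, 0 ≤ u i x
  le : ∀ i x, u i x ≤ 1

/-- section of the sum map -/
noncomputable def sec {r : ℕ} (x : Fin (r + 1) → K) (y : K) : Fin (r + 1) → K :=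
  Function.update x 0 (y - ∑ i ∈ univ.erase 0, x i)

lemma sum_upd {r : ℕ} (x : Fin (r + 1) → K) (t : K) :
    ∑ i, Function.update x 0 t i = t + ∑ i ∈ univ.erase 0, x i := by
  rw [← add_sum_erase univ _ (mem_univ 0), Function.update_self]
  congr 1
  apply sum_congr rfl
  intro i hi
  rw [Function.update_of_ne (by simpa using hi)]

lemma sec_add {r : ℕ} (x z : Fin (r + 1) → K) (y : K) : sec (x + z) y = sec x y + sec z 0 := by
  funext i
  by_cases hi : i = 0
  · subst hi
    simp only [sec, Function.update_self, Pi.add_apply, sum_add_distrib]; ring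
  · simp [sec, hi]

/-- dual functions -/
noncomputable def phi {r : ℕ} (u : Fin (r + 1) → (Fin (r + 1) → K) → ℝ) (y : K) : ℝ :=
  av fun x => ∏ i, u i (sec x y)

lemma phi_pair {r : ℕ} (u : Fin (r + 1) → (Fin (r + 1) → K) → ℝ) (h : K → ℝ) :
    (av fun y => h y * phi u y) = av fun x : Fin (r + 1) → K => h (∑ i, x i) * ∏ i, u i x := by
  rw [av_update 0 fun x : Fin (r + 1) → K => h (∑ i, x i) * ∏ i, u i x]
  simp only [phi, ← av_mul_left]
  rw [av_comm]
  congr 1; funext x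
  have hb : Function.Bijective fun y : K => y - ∑ i ∈ univ.erase 0, x i :=
    (Equiv.subRight _).bijective
  rw [← av_bij _ hb fun t => h (∑ i, Function.update x 0 t i) * ∏ i, u i (Function.update x 0 t)]
  congr 1; funext y
  rw [sum_upd, sub_add_cancel, sec]

lemma good_mul {r : ℕ} {u v : Fin (r + 1) → (Fin (r + 1) → K) → ℝ} (hu : GoodT u) (hv : GoodT v)
    (c : Fin (r + 1) → K) : GoodT fun i x => u i x * v i (x + c) where
  ind i x t := by
    beta_reduce
    rw [hu.ind i]
    have : Function.update x i t + c = Function.update (x + c) i (t + c i) := by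
      funext k
      by_cases hk : k = i
      · subst hk; simp
      · simp [hk]
    rw [this, hv.ind i]
  nonneg i x := mul_nonneg (hu.nonneg _ _) (hv.nonneg _ _)
  le i x := mul_le_one₀ (hu.le _ _) (hv.nonneg _ _) (hv.le _ _)

lemma phi_mul {r : ℕ} (u v : Fin (r + 1) → (Fin (r + 1) → K) → ℝ) (y : K) :
    phi u y * phi v y = av fun z => phi (fun i x => u i x * v i (x + sec z 0)) y := by
  simp only [phi]
  rw [av_comm, av_mul_av]
  congr 1; funext x
  have hb : Function.Bijective fun z : Fin (r + 1) → K => x + z := (Equiv.addLeft x).bijective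
  rw [← av_bij _ hb]
  congr 1; funext z
  rw [sec_add, ← prod_mul_distrib]

lemma phi_bdd {r : ℕ} {u : Fin (r + 1) → (Fin (r + 1) → K) → ℝ} (hu : GoodT u) (y : K) :
    |phi u y| ≤ 1 := by
  unfold phi
  rw [abs_of_nonneg (av_nonneg fun x => prod_nonneg fun i _ => hu.nonneg _ _)]
  exact av_le_of_le fun x => prod_le_one (fun i _ => hu.nonneg _ _) fun i _ => hu.le _ _

/-- symmetric set of dual functions -/
def dualSet (K : Type) [Field K] [Finite K] (r : ℕ) : Set (K → ℝ) :=
  {φ | ∃ u : Fin (r + 1) → (Fin (r + 1) → K) → ℝ, GoodT u ∧ (φ = phi u ∨ φ = - phi u)}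

lemma dualSet_mul (r : ℕ) : ∀ a ∈ dualSet K r, ∀ b ∈ dualSet K r,
    a * b ∈ convexHull ℝ (dualSet K r) := by
  have main : ∀ u v : Fin (r + 1) → (Fin (r + 1) → K) → ℝ, GoodT u → GoodT v →
      (phi u * phi v ∈ convexHull ℝ (dualSet K r) ∧
      - (phi u * phi v) ∈ convexHull ℝ (dualSet K r)) := by
    intro u v hu hv
    constructor
    · have : phi u * phi v = fun y => av fun z => phi (fun i x => u i x * v i (x + sec z 0)) y := by
        funext y; exact phi_mul u v y
      rw [this]
      refine av_mem_convex (convex_convexHull ℝ _) _ fun z => subset_convexHull ℝ _ ?_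
      exact ⟨_, good_mul hu hv (sec z 0), Or.inl rfl⟩
    · have : - (phi u * phi v) =
          fun y => av fun z => - phi (fun i x => u i x * v i (x + sec z 0)) y := by
        funext y; simp only [av_neg]; rw [← phi_mul u v y]; rfl
      rw [this]
      refine av_mem_convex (convex_convexHull ℝ _)
        (fun z => - phi (fun i x => u i x * v i (x + sec z 0))) fun z => subset_convexHull ℝ _ ?_
      exact ⟨_, good_mul hu hv (sec z 0), Or.inr rfl⟩
  rintro _ ⟨u, hu, rfl | rfl⟩ _ ⟨v, hv, rfl | rfl⟩
  · exact (main u v hu hv).1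
  · rw [mul_neg]; exact (main u v hu hv).2
  · rw [neg_mul]; exact (main u v hu hv).2
  · rw [neg_mul_neg]; exact (main u v hu hv).1

/-- the linear forms -/
def LL {r : ℕ} (c : Fin (r + 2) → Fin (r + 2) → K) (j : Fin (r + 2)) (x : Fin (r + 2) → K) : K :=
  ∑ i, c j i * x i

/-- rescaled coordinates -/
def tau {r : ℕ} (c : Fin (r + 2) → Fin (r + 2) → K) (j : Fin (r + 2)) (x : Fin (r + 2) → K) :
    Fin (r + 1) → K := fun i => c j (j.succAbove i) * x (j.succAbove i)

lemma LL_tau {r : ℕ} (c : Fin (r + 2) → Fin (r + 2) → K) (j : Fin (r + 2)) (hc : c j j = 0)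
    (x : Fin (r + 2) → K) : LL c j x = ∑ i, tau c j x i := by
  unfold LL tau
  rw [Fin.sum_univ_succAbove _ j, hc, zero_mul, zero_add]

lemma LL_ind {r : ℕ} (c : Fin (r + 2) → Fin (r + 2) → K) (j : Fin (r + 2)) (hc : c j j = 0)
    (F : K → ℝ) : IndC j fun x : Fin (r + 2) → K => F (LL c j x) := by
  intro x t
  beta_reduce
  congr 1
  unfold LL
  apply sum_congr rfl
  intro i _
  by_cases hi : i = j
  · subst hi; simp [hc]
  · simp [hi]

lemma prod_erase_succAbove {r : ℕ} (j : Fin (r + 1)) (F : Fin (r + 1) → ℝ) :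
    ∏ i ∈ univ.erase j, F i = ∏ i, F (j.succAbove i) := by
  have : univ.erase j = univ.image j.succAbove := by
    rw [Fin.image_succAbove_univ]; ext k; simp
  rw [this, prod_image]
  intro a _ b _ h
  exact Fin.succAbove_right_injective h

lemma av_insertNth {G : Type} [Finite G] {r : ℕ} (j : Fin (r + 2)) (Φ : (Fin (r + 2) → G) → ℝ) :
    av Φ = av fun t : G => av fun x : Fin (r + 1) → G => Φ (j.insertNth t x) := by
  rw [← av_prod fun p : G × (Fin (r + 1) → G) => Φ (j.insertNth p.1 p.2)]
  exact (av_equiv (Fin.insertNthEquiv (fun _ => G) j) Φ).symm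

lemma av_scale {r : ℕ} (d : Fin (r + 1) → K) (hd : ∀ i, d i ≠ 0) (Ψ : (Fin (r + 1) → K) → ℝ) :
    (av fun x : Fin (r + 1) → K => Ψ fun i => d i * x i) = av Ψ :=
  av_equiv (Equiv.piCongrRight fun i => Equiv.mulLeft₀ (d i) (hd i)) Ψ

lemma av_tau {r : ℕ} (c : Fin (r + 2) → Fin (r + 2) → K) (j : Fin (r + 2))
    (hc : ∀ i, i ≠ j → c j i ≠ 0) (Φ : (Fin (r + 1) → K) → ℝ) :
    (av fun x => Φ (tau c j x)) = av Φ := by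
  rw [av_insertNth j]
  have : ∀ t, (av fun x : Fin (r + 1) → K => Φ (tau c j (j.insertNth t x))) = av Φ := by
    intro t
    rw [← av_scale (fun i => c j (j.succAbove i)) (fun i => hc _ (Fin.succAbove_ne j i)) Φ]
    congr 1; funext x; congr 1; funext i
    simp [tau]
  simp only [this, av_const]

lemma tau_upd {r : ℕ} (c : Fin (r + 2) → Fin (r + 2) → K) (j : Fin (r + 2)) (i : Fin (r + 1))
    (x : Fin (r + 2) → K) (t : K) : tau c j (Function.update x (j.succAbove i) t) =
      Function.update (tau c j x) i (c j (j.succAbove i) * t) := by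
  funext k
  by_cases hk : k = i
  · subst hk; simp [tau]
  · have : j.succAbove k ≠ j.succAbove i := fun h => hk (Fin.succAbove_right_injective h)
    simp [tau, hk, this]

lemma insertNth_upd {G : Type} {r : ℕ} (j : Fin (r + 2)) (t : G) (i : Fin (r + 1))
    (x : Fin (r + 1) → G) (s : G) : j.insertNth (α := fun _ => G) t (Function.update x i s) =
      Function.update (j.insertNth (α := fun _ => G) t x) (j.succAbove i) s := by
  funext k
  refine Fin.succAboveCases j ?_ ?_ k
  · simp [(Fin.succAbove_ne j i).symm]
  · intro l
    by_cases hl : l = i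
    · subst hl; simp
    · have : j.succAbove l ≠ j.succAbove i := fun h => hl (Fin.succAbove_right_injective h)
      simp [hl, this]

/-- from test functions in `r+1` variables to `r+2` variables -/
lemma lift_test {r : ℕ} (c : Fin (r + 2) → Fin (r + 2) → K) (j : Fin (r + 2)) (hj : c j j = 0)
    (hc : ∀ i, i ≠ j → c j i ≠ 0) (h : K → ℝ) (u : Fin (r + 1) → (Fin (r + 1) → K) → ℝ)
    (hu : GoodT u) : ∃ a : Fin (r + 2) → (Fin (r + 2) → K) → ℝ, GoodT a ∧
      (av fun x : Fin (r + 1) → K => h (∑ i, x i) * ∏ i, u i x) =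
        av fun x => h (LL c j x) * ∏ i ∈ univ.erase j, a i x := by
  refine ⟨j.insertNth (α := fun _ => (Fin (r + 2) → K) → ℝ) (fun _ => 1)
    (fun i x => u i (tau c j x)), ⟨?_, ?_, ?_⟩, ?_⟩
  · intro i
    refine Fin.succAboveCases j ?_ ?_ i
    · intro x t; simp
    · intro i x t
      simp only [Fin.insertNth_apply_succAbove]
      rw [tau_upd, hu.ind i]
  · intro i
    refine Fin.succAboveCases j ?_ ?_ i
    · intro x; simp
    · intro i x
      simp only [Fin.insertNth_apply_succAbove]
      exact hu.nonneg _ _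
  · intro i
    refine Fin.succAboveCases j ?_ ?_ i
    · intro x; simp
    · intro i x
      simp only [Fin.insertNth_apply_succAbove]
      exact hu.le _ _
  · rw [← av_tau c j hc]
    congr 1; funext x
    rw [prod_erase_succAbove, LL_tau c j hj]
    simp only [Fin.insertNth_apply_succAbove]

lemma lower_test {r : ℕ} (c : Fin (r + 2) → Fin (r + 2) → K) (j : Fin (r + 2)) (hj : c j j = 0)
    (hc : ∀ i, i ≠ j → c j i ≠ 0) (h : K → ℝ) (u : Fin (r + 2) → (Fin (r + 2) → K) → ℝ)
    (hu : GoodT u) (ε : ℝ) (hε : ∀ u' : Fin (r + 1) → (Fin (r + 1) → K) → ℝ, GoodT u' →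
      |av fun x : Fin (r + 1) → K => h (∑ i, x i) * ∏ i, u' i x| ≤ ε) :
    |av fun x => h (LL c j x) * ∏ i ∈ univ.erase j, u i x| ≤ ε := by
  rw [av_insertNth j]
  refine (abs_av_le _).trans (av_le_of_le fun t => ?_)
  set d : Fin (r + 1) → K := fun i => c j (j.succAbove i)
  have hd : ∀ i, d i ≠ 0 := fun i => hc _ (Fin.succAbove_ne j i)
  refine le_of_eq_of_le ?_ (hε (fun i x => u (j.succAbove i)
    (j.insertNth (α := fun _ => K) t fun i => (d i)⁻¹ * x i)) ⟨?_, ?_, ?_⟩)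
  · conv_rhs => rw [← av_scale d hd]
    congr 2; funext x
    rw [prod_erase_succAbove, LL_tau c j hj]
    congr 2
    · apply sum_congr rfl
      intro i _
      simp [tau, d]
    · funext i
      congr 2; funext k
      rw [inv_mul_cancel_left₀ (hd k)]
  · intro i x s
    have : (fun k => (d k)⁻¹ * Function.update x i s k) =
        Function.update (fun k => (d k)⁻¹ * x k) i ((d i)⁻¹ * s) := by
      funext k
      by_cases hk : k = i
      · subst hk; simp
      · simp [hk]
    beta_reduce
    rw [this, insertNth_upd, hu.ind]
  · intro i x; exact hu.nonneg _ _
  · intro i x; exact hu.le _ _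

theorem rel_count (r : ℕ) (ε' : ℝ) (hε' : 0 < ε') : ∃ ε : ℝ, 0 < ε ∧
    ∀ (K : Type) [Field K] [Finite K] (c : Fin (r + 2) → Fin (r + 2) → K), (∀ j, c j j = 0) →
    (∀ j i, i ≠ j → c j i ≠ 0) → ∀ (ν f : K → ℝ), LF (fun j x => ν (LL c j x)) ε →
    (∀ x, 0 ≤ f x) → (∀ x, f x ≤ ν x) →
    ∃ f' : K → ℝ, (∀ x, 0 ≤ f' x) ∧ (∀ x, f' x ≤ 1) ∧ |av f - av f'| ≤ ε' ∧
      |(av fun x => ∏ j, f (LL c j x)) - av fun x => ∏ j, f' (LL c j x)| ≤ ε' := by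
  obtain ⟨ε1, hε1, H1⟩ := counting (Fin (r + 2)) univ ε' hε'
  obtain ⟨ε2, hε2, H2⟩ := dense_model (min ε' ε1) (by positivity)
  obtain ⟨ε3, hε3, H3⟩ := slf (Fin (r + 2)) ε2 hε2
  refine ⟨min ε1 ε3, by positivity, ?_⟩
  intro K _ _ c hc0 hc1 ν f hLF f0 f1
  have ν0 : ∀ x, 0 ≤ ν x := fun x => (f0 x).trans (f1 x)
  have hslf : ∀ u : Fin (r + 1) → (Fin (r + 1) → K) → ℝ, GoodT u →
      |av fun y => (ν y - 1) * phi u y| ≤ ε2 := by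
    intro u hu
    rw [phi_pair u fun y => ν y - 1]
    obtain ⟨a, ha, e⟩ := lift_test c 0 (hc0 0) (hc1 0) (fun y => ν y - 1) u hu
    rw [e]
    have := H3 K _ (hLF.mono (min_le_right _ _)) (fun i => LL_ind c i (hc0 i) ν) 0 a
      (fun _ _ => 1) (fun i _ => ha.ind i) (fun i _ x t => rfl)
      (fun i _ x => by
        rw [abs_of_nonneg (ha.nonneg i x)]; linarith [ha.le i x, ν0 (LL c i x)])
      (fun i _ x => by rw [abs_one]; linarith [ν0 (LL c i x)])
    simp only [prod_const_one, av_const, mul_one] at this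
    rw [av_split 0 (fun x => ν (LL c 0 x) - 1) (LL_ind c 0 (hc0 0) fun y => ν y - 1)]
    exact this
  have good1 : GoodT (fun (_ : Fin (r + 1)) (_ : Fin (r + 1) → K) => (1 : ℝ)) :=
    ⟨fun _ _ _ => rfl, fun _ _ => zero_le_one, fun _ _ => le_rfl⟩
  have phi1 : phi (fun (_ : Fin (r + 1)) (_ : Fin (r + 1) → K) => (1 : ℝ)) = 1 := by
    funext y; simp [phi, av_const]
  obtain ⟨f', f0', f1', hf'⟩ := H2 K (dualSet K r) ν f ⟨_, good1, Or.inl phi1.symm⟩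
    (by
      rintro _ ⟨u, hu, rfl | rfl⟩ y
      · exact phi_bdd hu y
      · rw [Pi.neg_apply, abs_neg]; exact phi_bdd hu y)
    (dualSet_mul r)
    (by
      rintro _ ⟨u, hu, rfl | rfl⟩
      · exact hslf u hu
      · simp only [Pi.neg_apply, mul_neg, av_neg, abs_neg]; exact hslf u hu) f0 f1
  have hcut : ∀ u : Fin (r + 1) → (Fin (r + 1) → K) → ℝ, GoodT u →
      |av fun y => (f y - f' y) * phi u y| ≤ min ε' ε1 := by
    intro u hu
    have h1 := hf' (phi u) ⟨u, hu, Or.inl rfl⟩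
    have h2 := hf' (- phi u) ⟨u, hu, Or.inr rfl⟩
    simp only [Pi.neg_apply, mul_neg, av_neg] at h2
    rw [abs_le]; constructor <;> linarith
  refine ⟨f', f0', f1', ?_, ?_⟩
  · have := hcut _ good1
    rw [phi1] at this
    simp only [Pi.one_apply, mul_one, av_sub] at this
    exact this.trans (min_le_left _ _)
  · refine H1 K (fun j x => ν (LL c j x)) (fun j x => f (LL c j x)) (fun j x => f' (LL c j x)) ?_
      (by simp)
    refine ⟨hLF.mono (min_le_left _ _), fun i x => ν0 _, fun i => LL_ind c i (hc0 i) ν,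
      fun i => LL_ind c i (hc0 i) f, fun i => LL_ind c i (hc0 i) f', fun i x => f0 _,
      fun i x => f1 _, fun i x => f0' _, fun i x => f1' _, ?_⟩
    intro j u hu u0 u1
    refine lower_test c j (hc0 j) (hc1 j) (fun y => f y - f' y) u ⟨hu, u0, u1⟩ ε1 ?_
    intro u' hu'
    rw [← phi_pair u' fun y => f y - f' y]
    exact (hcut u' hu').trans (min_le_right _ _)

end C5
end GT
namespace GT

section C6

/-- coefficients of the forms giving arithmetic progressions -/
def cc (r N : ℕ) (j i : Fin (r + 2)) : ZMod N := ((i : ℕ) : ZMod N) - ((j : ℕ) : ZMod N)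

/-- the linear forms for progressions -/
def LA (r N : ℕ) (j : Fin (r + 2)) (x : Fin (r + 2) → ZMod N) : ZMod N := ∑ i, cc r N j i * x i

lemma av_cons {G : Type} [Finite G] {r : ℕ} (Φ : (Fin (r + 1) → G) → ℝ) :
    av Φ = av fun x : Fin r → G => av fun t : G => Φ (Fin.cons t x) := by
  rw [av_comm, ← av_prod fun p : G × (Fin r → G) => Φ (Fin.cons p.1 p.2)]
  exact (av_equiv (Fin.consEquiv (fun _ => G)) Φ).symm

lemma av_ad (r N : ℕ) [NeZero N] (F : ZMod N → ZMod N → ℝ) :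
    (av fun x : Fin (r + 2) → ZMod N => F (∑ i : Fin (r + 2), ((i : ℕ) : ZMod N) * x i) (- ∑ i, x i)) =
      av fun a => av fun d => F a d := by
  rw [av_cons, av_cons]
  have : ∀ y : Fin r → ZMod N, (av fun t : ZMod N => av fun s : ZMod N =>
      F (∑ i : Fin (r + 2), ((i : ℕ) : ZMod N) * (Fin.cons s (Fin.cons t y : Fin (r + 1) → ZMod N) :
        Fin (r + 2) → ZMod N) i)
        (- ∑ i : Fin (r + 2), (Fin.cons s (Fin.cons t y : Fin (r + 1) → ZMod N) :
          Fin (r + 2) → ZMod N) i)) =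
      av fun a => av fun d => F a d := by
    intro y
    simp only [Fin.sum_univ_succ, Fin.cons_zero, Fin.cons_succ]
    set A := ∑ i : Fin r, (((i.succ.succ : Fin (r + 2)) : ℕ) : ZMod N) * y i
    set B := ∑ i : Fin r, y i
    have h1 : ∀ t : ZMod N, (av fun s : ZMod N =>
        F (((0 : Fin (r + 2)) : ℕ) * s + ((((0 : Fin (r + 1)).succ : Fin (r + 2)) : ℕ) * t + A))
          (-(s + (t + B)))) = av fun d => F (t + A) d := by
      intro t
      have hb : Function.Bijective fun s : ZMod N => -(s + (t + B)) :=
        ((Equiv.addRight (t + B)).trans (Equiv.neg _)).bijective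
      rw [← av_bij _ hb fun d => F (t + A) d]
      simp
    simp only [h1]
    exact av_bij (fun t : ZMod N => t + A) (Equiv.addRight A).bijective
      fun a => av fun d => F a d
  simp only [this, av_const]

lemma LA_eq (r N : ℕ) (j : Fin (r + 2)) (x : Fin (r + 2) → ZMod N) :
    LA r N j x = (∑ i : Fin (r + 2), ((i : ℕ) : ZMod N) * x i) + ((j : ℕ) : ZMod N) * (- ∑ i, x i) := by
  simp only [LA, cc, sub_mul, sum_sub_distrib, mul_neg, mul_sum]; ring

theorem rel_szem (r : ℕ) (δ : ℝ) (hδ : 0 < δ) : ∃ c : ℝ, 0 < c ∧ ∃ ε : ℝ, 0 < ε ∧ ∃ N₀ : ℕ,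
    ∀ (N : ℕ) [NeZero N], N.Prime → N₀ ≤ N → ∀ ν f : ZMod N → ℝ,
    LF (fun j x => ν (LA r N j x)) ε → (∀ x, 0 ≤ f x) → (∀ x, f x ≤ ν x) → δ ≤ av f →
    c ≤ av fun a : ZMod N => av fun d : ZMod N => ∏ j : Fin (r + 2), f (a + (j : ℕ) * d) := by
  obtain ⟨c, hc, N₀, H⟩ := szem (r + 2) (δ / 2) (by positivity)
  obtain ⟨ε, hε, H2⟩ := rel_count r (min (δ / 2) (c / 2)) (by positivity)
  refine ⟨c / 2, by positivity, ε, hε, max N₀ (r + 2), ?_⟩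
  intro N _ hN hN0 ν f hLF f0 f1 hf
  have : Fact N.Prime := ⟨hN⟩
  have hNr : r + 2 ≤ N := (le_max_right _ _).trans hN0
  obtain ⟨f', f0', f1', h1, h2⟩ := H2 (ZMod N) (cc r N) (fun j => by simp [cc]) (by
    intro j i hij
    simp only [cc]
    intro h
    rw [sub_eq_zero, ZMod.natCast_eq_natCast_iff', Nat.mod_eq_of_lt (by omega),
      Nat.mod_eq_of_lt (by omega)] at h
    exact hij (Fin.ext h)) ν f hLF f0 f1
  have h3 := H N hN ((le_max_left _ _).trans hN0) f' f0' f1' (by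
    have := (abs_le.1 h1).2
    have : min (δ / 2) (c / 2) ≤ δ / 2 := min_le_left _ _
    linarith)
  have e : ∀ g : ZMod N → ℝ, (av fun x => ∏ j, g (LL (cc r N) j x)) =
      av fun a : ZMod N => av fun d : ZMod N => ∏ j : Fin (r + 2), g (a + (j : ℕ) * d) := by
    intro g
    rw [← av_ad r N fun a d => ∏ j : Fin (r + 2), g (a + (j : ℕ) * d)]
    congr 1; funext x
    apply prod_congr rfl
    intro j _
    congr 1
    exact LA_eq r N j x
  rw [e f, e f'] at h2
  have := (abs_le.1 h2).1
  have : min (δ / 2) (c / 2) ≤ c / 2 := min_le_right _ _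
  linarith

end C6
end GT
namespace GT

section D1

lemma av_pi {ι : Type*} [Fintype ι] {X : ι → Type*} [∀ i, Finite (X i)] (f : ∀ i, X i → ℝ) :
    av (fun x : ∀ i, X i => ∏ i, f i (x i)) = ∏ i, av (f i) := by
  have := fun i => Fintype.ofFinite (X i)
  simp only [av_eq]
  rw [Finset.prod_div_distrib, Fintype.card_pi, Finset.prod_univ_sum, Fintype.piFinset_univ]
  push_cast; rfl

lemma per_sum (q : ℕ) [NeZero q] (g : ZMod q → ℝ) (hg : ∀ x, |g x| ≤ 1) (H : ℕ) :
    |q * (∑ t ∈ range H, g (t : ℕ)) - H * ∑ t ∈ range q, g (t : ℕ)| ≤ 2 * q * q := by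
  have hb : ∀ m : ℕ, |∑ t ∈ range m, g (t : ℕ)| ≤ m := by
    intro m
    refine (abs_sum_le_sum_abs _ _).trans ?_
    refine (sum_le_sum fun i _ => hg _).trans ?_
    simp
  induction H using Nat.strong_induction_on with
  | _ H ih =>
    by_cases h : H < q
    · refine (abs_sub _ _).trans ?_
      rw [abs_mul, abs_mul, Nat.abs_cast, Nat.abs_cast]
      have h1 : (H : ℝ) ≤ q := by exact_mod_cast h.le
      have h2 := (hb H).trans h1
      have h3 := hb q
      have : (0 : ℝ) ≤ q := by positivity
      have : (0 : ℝ) ≤ H := by positivity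
      nlinarith [mul_le_mul h1 h3 (abs_nonneg _) (by positivity), mul_le_mul_of_nonneg_left h2 (Nat.cast_nonneg (α := ℝ) q)]
    · push Not at h
      have hq : 0 < q := Nat.pos_of_ne_zero (NeZero.ne q)
      have := ih (H - q) (by omega)
      obtain ⟨K, rfl⟩ := Nat.exists_eq_add_of_le h
      rw [Nat.add_sub_cancel_left] at this
      rw [sum_range_add]
      have e : ∀ x : ℕ, g ((q + x : ℕ) : ZMod q) = g (x : ℕ) := by
        intro x; simp
      simp only [e]
      convert this using 2
      push_cast; ring

lemma box1 (q : ℕ) [NeZero q] (g : ZMod q → ℝ) (hg : ∀ x, |g x| ≤ 1) (H : ℕ) (hH : 0 < H) :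
    |(av fun t : Fin H => g ((t : ℕ) : ZMod q)) - av g| ≤ 2 * q / H := by
  have h := per_sum q g hg H
  have hq : 0 < (q : ℝ) := by exact_mod_cast Nat.pos_of_ne_zero (NeZero.ne q)
  have hH' : 0 < (H : ℝ) := by exact_mod_cast hH
  have e1 : (∑ t ∈ range q, g (t : ℕ)) = ∑ x, g x := by
    obtain ⟨q, rfl⟩ := Nat.exists_eq_succ_of_ne_zero (NeZero.ne q)
    rw [← Fin.sum_univ_eq_sum_range (fun t => g ((t : ℕ) : ZMod (q + 1)))]
    apply Fintype.sum_congr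
    intro x
    congr 1
    exact Fin.cast_val_eq_self x
  rw [av_eq, av_eq, Fintype.card_fin, ZMod.card, Fin.sum_univ_eq_sum_range (fun t => g ((t : ℕ) : ZMod q)),
    ← e1, div_sub_div _ _ hH'.ne' hq.ne', abs_div, abs_of_pos (mul_pos hH' hq), div_le_div_iff₀ (by positivity) hH']
  rw [mul_comm _ (q : ℝ)]
  nlinarith

lemma boxn (q : ℕ) [NeZero q] (H : ℕ) (hH : 0 < H) (n : ℕ) : ∀ (g : (Fin n → ZMod q) → ℝ)
    (_ : ∀ x, |g x| ≤ 1),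
    |(av fun h : Fin n → Fin H => g (fun i => ((h i : ℕ) : ZMod q))) - av g| ≤ n * (2 * q / H) := by
  have : NeZero H := ⟨hH.ne'⟩
  induction n with
  | zero =>
    intro g hg
    obtain ⟨c, rfl⟩ : ∃ c, g = fun _ => c :=
      ⟨g 0, funext fun x => congrArg g (Subsingleton.elim _ _)⟩
    simp [av_const]
  | succ n ih =>
    intro g hg
    rw [av_cons, av_cons]
    have h1 : ∀ h : Fin n → Fin H, |(av fun t : Fin H => g (fun i => (((Fin.cons t h : Fin (n + 1) → Fin H) i : ℕ) : ZMod q)))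
        - (av fun t : ZMod q => g (Fin.cons t fun i => ((h i : ℕ) : ZMod q)))| ≤ 2 * q / H := by
      intro h
      have := box1 q (fun t => g (Fin.cons t fun i => ((h i : ℕ) : ZMod q))) (fun _ => hg _) H hH
      convert this using 4
      congr 1; funext t; congr 1; funext i
      refine Fin.cases ?_ (fun i => ?_) i <;> simp
    have h2 := ih (fun x => av fun t : ZMod q => g (Fin.cons t x)) (fun x => by
      refine (abs_av_le _).trans (av_le_of_le fun _ => hg _))
    have h3 : |(av fun h : Fin n → Fin H => av fun t : Fin H => g (fun i => (((Fin.cons t h : Fin (n + 1) → Fin H) i : ℕ) : ZMod q))) - av fun h : Fin n → Fin H => av fun t : ZMod q => g (Fin.cons t fun i => ((h i : ℕ) : ZMod q))| ≤ 2 * q / H := by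
      rw [← av_sub]
      exact (abs_av_le _).trans (av_le_of_le h1)
    have := (abs_sub_le _ _ _).trans (add_le_add h3 h2)
    push_cast
    linarith

lemma transfer {π : Type*} [Fintype π] (a : π → ℕ) [∀ i, NeZero (a i)]
    (cop : Pairwise (Function.onFun Nat.Coprime a)) (n : ℕ) (f : ∀ i, (Fin n → ZMod (a i)) → ℝ)
    (hf : ∀ i x, |f i x| ≤ 1) (H : ℕ) (hH : 0 < H) :
    |(av fun h : Fin n → Fin H => ∏ i, f i (fun j => ((h j : ℕ) : ZMod (a i)))) - ∏ i, av (f i)|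
      ≤ n * (2 * ((∏ i, a i : ℕ) : ℝ) / H) := by
  have : NeZero (∏ i, a i) := ⟨Finset.prod_ne_zero_iff.2 fun i _ => NeZero.ne _⟩
  let e := ZMod.prodEquivPi a cop
  have h := boxn (∏ i, a i) H hH n (fun x => ∏ i, f i (fun j => e (x j) i)) (fun x => by
    rw [Finset.abs_prod]
    exact Finset.prod_le_one (fun _ _ => abs_nonneg _) (fun i _ => hf i _))
  simp only [map_natCast, Pi.natCast_apply] at h
  have h2 : av (fun x : Fin n → ZMod (∏ i, a i) => ∏ i, f i (fun j => e (x j) i)) = ∏ i, av (f i) := by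
    rw [← av_pi]
    exact av_equiv ((Equiv.arrowCongr (Equiv.refl (Fin n)) e.toEquiv).trans
      (Equiv.piComm fun _ i => ZMod (a i))) (fun y : ∀ i, Fin n → ZMod (a i) => ∏ i, f i (y i))
  rwa [h2] at h

/-- transfer for a subset of the moduli -/
lemma transfer_sub {π : Type*} [Fintype π] (a : π → ℕ) [∀ i, NeZero (a i)]
    (cop : Pairwise (Function.onFun Nat.Coprime a)) (n : ℕ) (f : ∀ i, (Fin n → ZMod (a i)) → ℝ)
    (hf : ∀ i x, |f i x| ≤ 1) (U : Finset π) (hU : ∀ i, i ∉ U → ∀ x, f i x = 1) (H : ℕ) (hH : 0 < H) :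
    |(av fun h : Fin n → Fin H => ∏ i, f i (fun j => ((h j : ℕ) : ZMod (a i)))) - ∏ i, av (f i)|
      ≤ n * (2 * ((∏ i ∈ U, a i : ℕ) : ℝ) / H) := by
  have h := transfer (fun i : U => a i) (fun i j hij => cop fun h => hij (Subtype.ext h)) n
    (fun i => f i) (fun i => hf i) H hH
  have e1 : ∀ F : π → ℝ, (∀ i, i ∉ U → F i = 1) → ∏ i, F i = ∏ i : U, F i := by
    intro F hF
    rw [Finset.prod_coe_sort U F]
    exact (Finset.prod_subset (subset_univ U) fun i _ hi => hF i hi).symm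
  rw [e1 (fun i => av (f i)) (fun i hi => by
    rw [show f i = fun _ => 1 from funext (hU i hi)]; exact av_const 1)]
  have e2 : ∀ h : Fin n → Fin H, ∏ i, f i (fun j => ((h j : ℕ) : ZMod (a i))) =
    ∏ i : U, f i (fun j => ((h j : ℕ) : ZMod (a i))) := fun h => e1 (fun i => f i (fun j => ((h j : ℕ) : ZMod (a i)))) fun i hi => hU i hi _
  simp only [e2]
  rwa [Finset.prod_coe_sort U a] at h

end D1
end GT
namespace GT

section D2

variable {α : Type} [Fintype α]

/-- indicator of a Boolean -/
noncomputable def bi (b : Bool) : ℝ := if b then 1 else 0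

lemma bi_nonneg (b : Bool) : 0 ≤ bi b := by cases b <;> simp [bi]
lemma bi_le_one (b : Bool) : bi b ≤ 1 := by cases b <;> simp [bi]
lemma bi_sq (b : Bool) : bi b * bi b = bi b := by cases b <;> simp [bi]

/-- laws on patterns with marginals `q` which are pairwise independent -/
structure PL (q : ℝ) (μ : (α → Bool) → ℝ) : Prop where
  nonneg : ∀ J, 0 ≤ μ J
  one : ∑ J, μ J = 1
  marg : ∀ a, ∑ J, μ J * bi (J a) = q
  pair : ∀ a b, a ≠ b → ∑ J, μ J * (bi (J a) * bi (J b)) = q * q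

/-- the independent law -/
noncomputable def ber (q : ℝ) (J : α → Bool) : ℝ := ∏ a, if J a then q else 1 - q

lemma sum_prod_bool (F : α → Bool → ℝ) : ∑ J : α → Bool, ∏ a, F a (J a) = ∏ a, (F a true + F a false) := by
  have := (Finset.prod_univ_sum (fun _ : α => (univ : Finset Bool)) F).symm
  rw [Fintype.piFinset_univ] at this
  rw [this]
  simp

lemma ber_PL (q : ℝ) (h0 : 0 ≤ q) (h1 : q ≤ 1) : PL q (ber (α := α) q) where
  nonneg J := by
    apply prod_nonneg; intro a _; split_ifs <;> linarith
  one := by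
    unfold ber
    rw [sum_prod_bool (fun _ b => if b then q else 1 - q)]
    simp
  marg a := by
    have : ∀ J : α → Bool, ber q J * bi (J a) =
        ∏ x, (if x = a then (if J x then q else 0) else (if J x then q else 1 - q)) := by
      intro J
      unfold ber
      rw [← Finset.mul_prod_erase _ _ (mem_univ a), ← Finset.mul_prod_erase univ (fun x => if x = a then _ else _) (mem_univ a)]
      rw [prod_congr (g := fun x => if x = a then (if J x then q else 0) else (if J x then q else 1 - q)) (s₂ := univ.erase a) rfl fun x hx => by rw [if_neg (ne_of_mem_erase hx)]]
      cases h : J a <;> simp [bi]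
    simp only [this]
    rw [sum_prod_bool (fun x b => if x = a then (if b then q else 0) else (if b then q else 1 - q))]
    rw [← Finset.mul_prod_erase _ _ (mem_univ a), prod_eq_one]
    · simp
    · intro x hx; rw [if_neg (ne_of_mem_erase hx), if_neg (ne_of_mem_erase hx)]; simp
  pair a b hab := by
    have : ∀ J : α → Bool, ber q J * (bi (J a) * bi (J b)) =
        ∏ x, (if x = a ∨ x = b then (if J x then q else 0) else (if J x then q else 1 - q)) := by
      intro J
      unfold ber
      by_cases h : J a = true ∧ J b = true
      · rw [h.1, h.2]
        simp only [bi, if_true, mul_one]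
        apply prod_congr rfl
        intro x _
        split_ifs with h1 h2 h2 <;> try rfl
        rcases h2 with rfl | rfl <;> simp_all
      · have : bi (J a) * bi (J b) = 0 := by
          cases h1 : J a <;> cases h2 : J b <;> simp_all [bi]
        rw [this, mul_zero]
        symm
        rw [prod_eq_zero_iff]
        by_cases h1 : J a = true
        · exact ⟨b, mem_univ _, by simp_all⟩
        · exact ⟨a, mem_univ _, by simp_all⟩
    simp only [this]
    rw [sum_prod_bool (fun x c => if x = a ∨ x = b then (if c then q else 0) else (if c then q else 1 - q))]
    rw [← Finset.mul_prod_erase _ _ (mem_univ a), ← Finset.mul_prod_erase _ _ (mem_erase.2 ⟨hab.symm, mem_univ b⟩), prod_eq_one]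
    · simp
    · intro x hx
      simp only [mem_erase, ne_eq, mem_univ, and_true] at hx
      simp [hx.1, hx.2]

lemma PL.single_le {q : ℝ} {μ : (α → Bool) → ℝ} (h : PL q μ) (F : (α → Bool) → ℝ) (hF : ∀ J, 0 ≤ F J)
    (J : α → Bool) (h1 : 1 ≤ F J) : μ J ≤ ∑ J, μ J * F J := by
  refine le_trans ?_ (single_le_sum (f := fun J => μ J * F J) (fun J _ => mul_nonneg (h.nonneg J) (hF J)) (mem_univ J))
  exact le_mul_of_one_le_right (h.nonneg J) h1

lemma PL.empty_bounds {q : ℝ} {μ : (α → Bool) → ℝ} (h : PL q μ) :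
    1 - Fintype.card α * q ≤ μ (fun _ => false) ∧
    μ (fun _ => false) ≤ 1 - Fintype.card α * q + (Fintype.card α : ℝ) ^ 2 * (q * q) := by
  have key : ∑ J, μ J * (1 - ∑ a, bi (J a)) = 1 - Fintype.card α * q := by
    simp only [mul_sub, mul_one, sum_sub_distrib, h.one, mul_sum]
    rw [sum_comm]
    simp [h.marg]
  have key2 : ∑ J, μ J * (∑ a, ∑ b ∈ univ.erase a, bi (J a) * bi (J b)) ≤
      (Fintype.card α : ℝ) ^ 2 * (q * q) := by
    simp only [mul_sum]
    rw [sum_comm]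
    have : ∀ a : α, ∑ J, ∑ b ∈ univ.erase a, μ J * (bi (J a) * bi (J b)) ≤ Fintype.card α * (q * q) := by
      intro a
      rw [sum_comm, sum_congr rfl fun b hb => h.pair a b (ne_of_mem_erase hb).symm]
      rw [sum_const, nsmul_eq_mul]
      apply mul_le_mul_of_nonneg_right _ (mul_self_nonneg q)
      exact_mod_cast card_le_univ _
    refine (sum_le_sum fun a _ => this a).trans ?_
    simp only [sum_const, nsmul_eq_mul, card_univ]
    nlinarith
  constructor
  · rw [← key, ← Finset.add_sum_erase _ _ (mem_univ (fun _ : α => false))]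
    have : ∑ J ∈ univ.erase (fun _ : α => false), μ J * (1 - ∑ a, bi (J a)) ≤ 0 := by
      apply sum_nonpos
      intro J hJ
      apply mul_nonpos_of_nonneg_of_nonpos (h.nonneg J)
      obtain ⟨a, ha⟩ : ∃ a, J a = true := by
        by_contra! hc
        exact ne_of_mem_erase hJ (funext fun a => by simpa using hc a)
      have := single_le_sum (f := fun a => bi (J a)) (fun a _ => bi_nonneg _) (mem_univ a)
      simp only [ha, bi, if_true] at this
      simp only [bi]
      linarith
    simp only [bi, Bool.false_eq_true, if_false, sum_const_zero, sub_zero, mul_one] at this ⊢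
    linarith
  · have : μ (fun _ => false) ≤ ∑ J, μ J * (1 - ∑ a, bi (J a) + ∑ a, ∑ b ∈ univ.erase a, bi (J a) * bi (J b)) := by
      apply h.single_le
      · intro J
        have e : ∑ a, ∑ b ∈ univ.erase a, bi (J a) * bi (J b) = (∑ a, bi (J a)) ^ 2 - ∑ a, bi (J a) := by
          have : ∀ a, ∑ b ∈ univ.erase a, bi (J a) * bi (J b) = (bi (J a) * ∑ b, bi (J b)) - bi (J a) := by
            intro a
            rw [← Finset.add_sum_erase _ _ (mem_univ a), ← mul_sum, mul_add, bi_sq]; ring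
          simp only [this, sum_sub_distrib, ← sum_mul]; ring
        rw [e]; nlinarith [sq_nonneg (∑ a, bi (J a) - 1)]
      · simp [bi]
    simp only [mul_add, sum_add_distrib] at this
    linarith

lemma PL.single_bounds {q : ℝ} {μ : (α → Bool) → ℝ} (h : PL q μ) (a : α) (J : α → Bool)
    (hJ : ∀ b, J b = true ↔ b = a) :
    q - Fintype.card α * (q * q) ≤ μ J ∧ μ J ≤ q := by
  constructor
  · have k2 : ∑ J, μ J * ∑ b ∈ univ.erase a, bi (J a) * bi (J b) ≤ Fintype.card α * (q * q) := by
      simp only [mul_sum]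
      rw [sum_comm, sum_congr rfl fun b hb => h.pair a b (ne_of_mem_erase hb).symm]
      rw [sum_const, nsmul_eq_mul]
      apply mul_le_mul_of_nonneg_right _ (mul_self_nonneg q)
      exact_mod_cast card_le_univ _
    have : ∑ J, μ J * (bi (J a) - ∑ b ∈ univ.erase a, bi (J a) * bi (J b)) ≤ μ J := by
      rw [← Finset.add_sum_erase _ _ (mem_univ J)]
      have h1 : ∑ J ∈ univ.erase J, μ J * (bi (J a) - ∑ b ∈ univ.erase a, bi (J a) * bi (J b)) ≤ 0 := by
        apply sum_nonpos
        intro J' hJ'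
        apply mul_nonpos_of_nonneg_of_nonpos (h.nonneg J')
        cases ha : J' a
        · simp [bi]
        · obtain ⟨b, hb, hba⟩ : ∃ b, J' b = true ∧ b ≠ a := by
            by_contra! hc
            apply ne_of_mem_erase hJ'
            funext b
            by_cases hb : b = a
            · rw [hb, ha, (hJ a).2 rfl]
            · have h1 : J' b = false := by
                by_contra h2; exact hb (hc b (by simpa using h2))
              have h2 : J b = false := by
                by_contra h2; exact hb ((hJ b).1 (by simpa using h2))
              rw [h1, h2]
          have := single_le_sum (f := fun b => bi true * bi (J' b)) (fun b _ => mul_nonneg (bi_nonneg _) (bi_nonneg _)) (mem_erase.2 ⟨hba, mem_univ b⟩)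
          simp only [hb, bi, if_true] at this
          simp only [bi, if_true]
          linarith
      have h2 : ∑ b ∈ univ.erase a, bi (J a) * bi (J b) = 0 := by
        apply sum_eq_zero
        intro b hb
        have : J b = false := by
          by_contra h2; exact ne_of_mem_erase hb ((hJ b).1 (by simpa using h2))
        simp [this, bi]
      rw [h2, (hJ a).2 rfl]
      simp only [bi, if_true] at h1 ⊢
      linarith
    simp only [mul_sub, sum_sub_distrib, h.marg] at this
    linarith
  · rw [← h.marg a]
    exact h.single_le (fun J => bi (J a)) (fun J => bi_nonneg _) J (by simp [bi, (hJ a).2 rfl])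

lemma PL.close {q : ℝ} {μ μ' : (α → Bool) → ℝ} (h : PL q μ) (h' : PL q μ') (J : α → Bool) :
    |μ J - μ' J| ≤ (Fintype.card α : ℝ) ^ 2 * (q * q) := by
  have hqq := mul_self_nonneg q
  by_cases h0 : ∃ a, J a = true
  · obtain ⟨a, ha⟩ := h0
    have : Nonempty α := ⟨a⟩
    have hc : (1 : ℝ) ≤ Fintype.card α := by exact_mod_cast Fintype.card_pos
    by_cases h1 : ∃ b, b ≠ a ∧ J b = true
    · obtain ⟨b, hba, hb⟩ := h1
      have k : ∀ {ν}, PL q ν → ν J ≤ q * q := by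
        intro ν hν
        rw [← hν.pair a b hba.symm]
        exact hν.single_le (fun J => bi (J a) * bi (J b)) (fun J => mul_nonneg (bi_nonneg _) (bi_nonneg _)) J
          (by simp [bi, ha, hb])
      rw [abs_le]
      have := k h; have := k h'; have := h.nonneg J; have := h'.nonneg J
      have : q * q ≤ (Fintype.card α : ℝ) ^ 2 * (q * q) := le_mul_of_one_le_left hqq (one_le_pow₀ hc)
      constructor <;> linarith
    · push Not at h1
      have hJ : ∀ b, J b = true ↔ b = a := fun b => ⟨fun hb => by
        by_contra hc; exact h1 b hc hb, fun hb => hb ▸ ha⟩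
      have := h.single_bounds a J hJ
      have := h'.single_bounds a J hJ
      rw [abs_le]
      have : Fintype.card α * (q * q) ≤ (Fintype.card α : ℝ) ^ 2 * (q * q) := by nlinarith
      constructor <;> linarith
  · have : J = fun _ => false := by
      funext a; simpa using fun hc => h0 ⟨a, hc⟩
    rw [this, abs_le]
    have := h.empty_bounds; have := h'.empty_bounds
    constructor <;> linarith

/-- expectation of a product -/
lemma sum_pi_prod {π T : Type*} [Fintype π] [Fintype T] (F : π → T → ℝ) :
    ∑ J : π → T, ∏ p, F p (J p) = ∏ p, ∑ j, F p j := by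
  have := (Finset.prod_univ_sum (fun _ : π => (univ : Finset T)) F).symm
  rwa [Fintype.piFinset_univ] at this

lemma prod_sub_prod_le {π : Type*} (s : Finset π) (x d : π → ℝ) (hx : ∀ p, 0 ≤ x p) (hd : ∀ p, 0 ≤ d p)
    (h1 : ∀ p, 1 ≤ x p + d p) :
    ∏ p ∈ s, (x p + d p) - ∏ p ∈ s, x p ≤ (∏ p ∈ s, (x p + d p)) * ∑ p ∈ s, d p := by
  induction s using Finset.induction_on with
  | empty => simp
  | insert a s ha ih =>
    rw [prod_insert ha, prod_insert ha, sum_insert ha]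
    have hP : ∏ p ∈ s, x p ≤ ∏ p ∈ s, (x p + d p) :=
      prod_le_prod (fun p _ => hx p) fun p _ => by linarith [hd p]
    have hP0 : 0 ≤ ∏ p ∈ s, x p := prod_nonneg fun p _ => hx p
    have hS : 0 ≤ ∑ p ∈ s, d p := sum_nonneg fun p _ => hd p
    set A := ∏ p ∈ s, (x p + d p)
    set B := ∏ p ∈ s, x p
    set S := ∑ p ∈ s, d p
    have := hx a; have := hd a; have := h1 a
    have e1 : d a * A ≤ (x a + d a) * A * d a := by
      nlinarith [mul_nonneg (hd a) (hP0.trans hP)]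
    have e2 : x a * (A - B) ≤ (x a + d a) * (A * S) := by
      have : (A - B) * x a ≤ (A * S) * x a := mul_le_mul_of_nonneg_right ih (hx a)
      nlinarith [mul_nonneg (hd a) (mul_nonneg (hP0.trans hP) hS)]
    nlinarith

/-- comparison of two product laws -/
lemma compare_laws {π T : Type*} [Fintype π] [Fintype T] (μ μ' : π → T → ℝ) (h0 : ∀ p j, 0 ≤ μ p j)
    (h0' : ∀ p j, 0 ≤ μ' p j) (h1 : ∀ p, ∑ j, μ p j = 1) (w : T → ℝ) (hw : ∀ j, 1 ≤ w j)
    (F : (π → T) → ℝ) (hF : ∀ J, |F J| ≤ ∏ p, w (J p)) :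
    |∑ J, F J * ∏ p, μ p (J p) - ∑ J, F J * ∏ p, μ' p (J p)| ≤
      (∏ p, ∑ j, w j * max (μ p j) (μ' p j)) * ∑ p, ∑ j, w j * |μ p j - μ' p j| := by
  have hw0 : ∀ j, 0 ≤ w j := fun j => zero_le_one.trans (hw j)
  have step : |∑ J, F J * ∏ p, μ p (J p) - ∑ J, F J * ∏ p, μ' p (J p)| ≤
      ∑ J : π → T, (∏ p, w (J p) * max (μ p (J p)) (μ' p (J p)) - ∏ p, w (J p) * min (μ p (J p)) (μ' p (J p))) := by
    rw [← sum_sub_distrib]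
    refine (abs_sum_le_sum_abs _ _).trans (sum_le_sum fun J _ => ?_)
    rw [← mul_sub, abs_mul, prod_mul_distrib, prod_mul_distrib, ← mul_sub]
    apply mul_le_mul (hF J) _ (abs_nonneg _) (prod_nonneg fun p _ => hw0 _)
    have a1 : ∏ p, μ p (J p) ≤ ∏ p, max (μ p (J p)) (μ' p (J p)) :=
      prod_le_prod (fun p _ => h0 _ _) fun p _ => le_max_left _ _
    have a2 : ∏ p, μ' p (J p) ≤ ∏ p, max (μ p (J p)) (μ' p (J p)) :=
      prod_le_prod (fun p _ => h0' _ _) fun p _ => le_max_right _ _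
    have a3 : ∏ p, min (μ p (J p)) (μ' p (J p)) ≤ ∏ p, μ p (J p) :=
      prod_le_prod (fun p _ => le_min (h0 _ _) (h0' _ _)) fun p _ => min_le_left _ _
    have a4 : ∏ p, min (μ p (J p)) (μ' p (J p)) ≤ ∏ p, μ' p (J p) :=
      prod_le_prod (fun p _ => le_min (h0 _ _) (h0' _ _)) fun p _ => min_le_right _ _
    rw [abs_le]; constructor <;> linarith
  refine step.trans ?_
  rw [sum_sub_distrib, sum_pi_prod (fun p j => w j * max (μ p j) (μ' p j)),
    sum_pi_prod (fun p j => w j * min (μ p j) (μ' p j))]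
  have e : ∀ p, ∑ j, w j * max (μ p j) (μ' p j) = ∑ j, w j * min (μ p j) (μ' p j) + ∑ j, w j * |μ p j - μ' p j| := by
    intro p
    rw [← sum_add_distrib]
    apply sum_congr rfl
    intro j _
    rw [← mul_add, ← max_sub_min_eq_abs']; ring
  simp only [e]
  apply prod_sub_prod_le
  · intro p; exact sum_nonneg fun j _ => mul_nonneg (hw0 j) (le_min (h0 _ _) (h0' _ _))
  · intro p; exact sum_nonneg fun j _ => mul_nonneg (hw0 j) (abs_nonneg _)
  · intro p
    rw [← e, ← h1 p]
    refine sum_le_sum fun j _ => ?_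
    have := le_max_left (μ p j) (μ' p j)
    nlinarith [hw j, h0 p j]

end D2
end GT
namespace GT

section D3

variable {π : Type} [Fintype π]

/-- the weight `c ^ #{p | e p}` -/
noncomputable def pw {π : Type} [Fintype π] (c : ℝ) (e : π → Bool) : ℝ := ∏ p, if e p then c else 1

lemma one_le_pw {c : ℝ} (hc : 1 ≤ c) (e : π → Bool) : 1 ≤ pw c e := by
  unfold pw
  have : ∏ p : π, (1 : ℝ) ≤ ∏ p, if e p then c else 1 :=
    prod_le_prod (fun _ _ => zero_le_one) fun p _ => by split_ifs <;> linarith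
  simpa using this

lemma pw_eq (c : ℝ) (e : π → Bool) : pw c e = c ^ (univ.filter fun p => e p = true).card := by
  unfold pw; rw [prod_ite]; simp

lemma pw_comm {α : Type} [Fintype α] (c : ℝ) (J : π → α → Bool) :
    ∏ a, pw c (fun p => J p a) = ∏ p, pw c (J p) := by
  unfold pw; exact prod_comm

/-- truncated inclusion-exclusion -/
noncomputable def Bf (r : ℕ) (e : π → Bool) : ℝ :=
  ∑ s ∈ univ.filter (fun s : Finset π => s.card ≤ 2 * r), (-1) ^ s.card * ∏ p ∈ s, bi (e p)

lemma prod_bi (e : π → Bool) (s : Finset π) :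
    ∏ p ∈ s, bi (e p) = if s ⊆ univ.filter (fun p => e p = true) then 1 else 0 := by
  split_ifs with h
  · apply prod_eq_one; intro p hp
    have := h hp; simp at this; simp [bi, this]
  · rw [Finset.not_subset] at h
    obtain ⟨p, hp, h⟩ := h
    apply prod_eq_zero hp; simp at h; simp [bi, h]

lemma Bf_eq (r : ℕ) (e : π → Bool) : Bf r e = ((∑ m ∈ range ((univ.filter fun p => e p = true).card + 1),
    if m ≤ 2 * r then (-1) ^ m * ((univ.filter fun p => e p = true).card.choose m : ℤ) else 0 : ℤ) : ℝ) := by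
  set D := univ.filter fun p => e p = true
  have h := Finset.sum_powerset_apply_card (fun m => if m ≤ 2 * r then ((-1 : ℝ)) ^ m else 0) (x := D)
  have e1 : Bf r e = ∑ s ∈ D.powerset, if s.card ≤ 2 * r then ((-1 : ℝ)) ^ s.card else 0 := by
    unfold Bf
    simp only [prod_bi, mul_ite, mul_one, mul_zero]
    rw [← sum_filter, ← sum_filter, filter_filter]
    apply sum_congr _ fun _ _ => rfl
    ext s; simp [D, and_comm]
  rw [e1, h]
  push_cast
  apply sum_congr rfl
  intro m _
  split_ifs <;> simp [mul_comm]

lemma Bf_small (r : ℕ) (e : π → Bool) (h : (univ.filter fun p => e p = true).card ≤ 2 * r) :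
    Bf r e = if (univ.filter fun p => e p = true).card = 0 then 1 else 0 := by
  rw [Bf_eq]
  rw [sum_congr rfl fun m hm => if_pos (by have := mem_range.1 hm; omega)]
  rw [Int.alternating_sum_range_choose]; push_cast; rfl

lemma Bf_large (r : ℕ) (e : π → Bool) (h : 2 * r < (univ.filter fun p => e p = true).card) :
    Bf r e = (((univ.filter fun p => e p = true).card - 1).choose (2 * r) : ℝ) := by
  rw [Bf_eq]
  obtain ⟨n, hn⟩ : ∃ n, (univ.filter fun p => e p = true).card = n + 1 := ⟨_, (Nat.succ_pred (by omega)).symm⟩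
  rw [hn] at h ⊢
  have := Int.alternating_sum_range_choose_eq_choose (n := n) (m := 2 * r)
  rw [← sum_filter]
  rw [show (range (n + 1 + 1)).filter (fun m => m ≤ 2 * r) = range (2 * r + 1) by ext; simp; omega, this]
  simp

lemma Bf_nonneg (r : ℕ) (e : π → Bool) : 0 ≤ Bf r e := by
  by_cases h : (univ.filter fun p => e p = true).card ≤ 2 * r
  · rw [Bf_small r e h]; split_ifs <;> norm_num
  · rw [Bf_large r e (by omega)]; positivity

lemma Bf_zero (r : ℕ) (e : π → Bool) (h : ∀ p, e p = false) : Bf r e = 1 := by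
  have : (univ.filter fun p => e p = true).card = 0 := by simp [h]
  rw [Bf_small r e (by omega), if_pos this]

/-- indicator that nothing happens -/
noncomputable def zi {π : Type} [Fintype π] (e : π → Bool) : ℝ := ∏ p, if e p then 0 else 1

lemma zi_eq (e : π → Bool) : zi e = if (univ.filter fun p => e p = true).card = 0 then 1 else 0 := by
  unfold zi
  split_ifs with h
  · apply prod_eq_one; intro p _
    have : e p = false := by
      rw [card_eq_zero, filter_eq_empty_iff] at h
      simpa using h (mem_univ p)
    simp [this]
  · obtain ⟨p, hp⟩ := card_pos.1 (Nat.pos_of_ne_zero h)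
    apply prod_eq_zero (mem_univ p)
    simp at hp; simp [hp]

lemma zi_bounds (e : π → Bool) : 0 ≤ zi e ∧ zi e ≤ 1 := by
  rw [zi_eq]; split_ifs <;> norm_num

lemma Bf_le (r : ℕ) (e : π → Bool) : Bf r e ≤ pw 2 e := by
  by_cases h : (univ.filter fun p => e p = true).card ≤ 2 * r
  · have := one_le_pw (c := 2) (by norm_num) e
    rw [Bf_small r e h]; split_ifs <;> linarith
  · rw [Bf_large r e (by omega), pw_eq]
    have h1 := Nat.choose_le_two_pow ((univ.filter fun p => e p = true).card - 1) (2 * r)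
    have h2 : 2 ^ ((univ.filter fun p => e p = true).card - 1) ≤ 2 ^ ((univ.filter fun p => e p = true).card) :=
      Nat.pow_le_pow_right (by norm_num) (by omega)
    exact_mod_cast h1.trans h2

lemma pw_mono {c d : ℝ} (hc : 0 ≤ c) (h : c ≤ d) (e : π → Bool) : pw c e ≤ pw d e := by
  rw [pw_eq, pw_eq]; gcongr

lemma Bf_sub (r : ℕ) (e : π → Bool) : |Bf r e - zi e| ≤ Real.exp (-(2 * r : ℝ)) * pw 6 e := by
  by_cases h : (univ.filter fun p => e p = true).card ≤ 2 * r
  · rw [Bf_small r e h, zi_eq, sub_self, abs_zero]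
    have := one_le_pw (c := 6) (by norm_num) e
    positivity
  · have h0 : zi e = 0 := by rw [zi_eq, if_neg (by omega)]
    rw [h0, sub_zero, abs_of_nonneg (Bf_nonneg r e)]
    refine (Bf_le r e).trans ?_
    rw [pw_eq, pw_eq]
    set m := (univ.filter fun p => e p = true).card
    have hm : (2 * r : ℝ) ≤ m := by exact_mod_cast (not_le.1 h).le
    have h2e : (2 : ℝ) * Real.exp 1 ≤ 6 := by
      have := Real.exp_one_lt_d9; norm_num at this ⊢; linarith
    have h3 : (2 * Real.exp 1) ^ m ≤ 6 ^ m := by gcongr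
    rw [mul_pow, ← Real.exp_nat_mul, mul_one] at h3
    have h4 : 1 ≤ Real.exp (-(2 * r : ℝ)) * Real.exp m := by
      rw [← Real.exp_add]; apply Real.one_le_exp; linarith
    have : 0 < Real.exp (-(2 * r : ℝ)) := Real.exp_pos _
    have p2 : (0 : ℝ) < 2 ^ m := by positivity
    nlinarith [mul_le_mul_of_nonneg_left h3 this.le, mul_le_mul_of_nonneg_left h4 p2.le]

lemma prod_close {α : Type} (s : Finset α) (x y m : α → ℝ) (ε : ℝ)
    (hx : ∀ a, |x a| ≤ m a) (hy : ∀ a, |y a| ≤ m a) (hxy : ∀ a, |x a - y a| ≤ ε * m a) :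
    |∏ a ∈ s, x a - ∏ a ∈ s, y a| ≤ s.card * ε * ∏ a ∈ s, m a := by
  induction s using Finset.induction_on with
  | empty => simp
  | insert a s ha ih =>
    rw [prod_insert ha, prod_insert ha, prod_insert ha, card_insert_of_notMem ha]
    have e : x a * ∏ a ∈ s, x a - y a * ∏ a ∈ s, y a =
        x a * (∏ a ∈ s, x a - ∏ a ∈ s, y a) + (x a - y a) * ∏ a ∈ s, y a := by ring
    rw [e]
    refine (abs_add_le _ _).trans ?_
    rw [abs_mul, abs_mul, abs_prod]
    have h1 := mul_le_mul (hx a) ih (abs_nonneg _) ((abs_nonneg _).trans (hx a))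
    have h2 := mul_le_mul (hxy a) (prod_le_prod (s := s) (fun a _ => abs_nonneg (y a)) fun a _ => hy a)
      (prod_nonneg fun a _ => abs_nonneg _) ((abs_nonneg _).trans (hxy a))
    push_cast
    linarith

/-- Selberg normalisation -/
noncomputable def Lc (S : Finset (Finset π)) (h : π → ℝ) : ℝ := ∑ l ∈ S, ∏ p ∈ l, h p

/-- the local factor -/
noncomputable def ph (h : π → ℝ) (p : π) (b : Bool) : ℝ := if b then -1 else h p

/-- Selberg's function -/
noncomputable def Xf (S : Finset (Finset π)) (h : π → ℝ) (e : π → Bool) : ℝ :=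
  (∑ l ∈ S, ∏ p ∈ l, ph h p (e p)) / Lc S h

lemma one_le_Lc (S : Finset (Finset π)) (h : π → ℝ) (h0 : ∀ p, 0 ≤ h p) (hS : ∅ ∈ S) : 1 ≤ Lc S h := by
  have := single_le_sum (f := fun l => ∏ p ∈ l, h p) (fun l _ => prod_nonneg fun p _ => h0 p) hS
  rw [prod_empty] at this
  exact this

lemma Xf_zero (S : Finset (Finset π)) (h : π → ℝ) (h0 : ∀ p, 0 ≤ h p) (hS : ∅ ∈ S) (e : π → Bool)
    (he : ∀ p, e p = false) : Xf S h e = 1 := by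
  have := one_le_Lc S h h0 hS
  unfold Xf
  rw [div_eq_one_iff_eq (by linarith)]
  simp [ph, he, Lc]

lemma Xf_le (S : Finset (Finset π)) (h : π → ℝ) (h0 : ∀ p, 0 ≤ h p) (hS : ∅ ∈ S)
    (hd : ∀ l ∈ S, ∀ l' ⊆ l, l' ∈ S) (e : π → Bool) : |Xf S h e| ≤ pw 2 e := by
  have hL := one_le_Lc S h h0 hS
  have hL0 : 0 < Lc S h := by linarith
  unfold Xf
  rw [abs_div, abs_of_pos hL0, div_le_iff₀ hL0, pw_eq]
  set D := univ.filter fun p => e p = true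
  refine (abs_sum_le_sum_abs _ _).trans ?_
  have e1 : ∀ l : Finset π, |∏ p ∈ l, ph h p (e p)| = ∏ p ∈ l \ D, h p := by
    intro l
    rw [abs_prod, ← prod_sdiff (s₁ := l ∩ D) (s₂ := l) inter_subset_left, sdiff_inter_self_left]
    have : ∏ p ∈ l ∩ D, |ph h p (e p)| = 1 := by
      apply prod_eq_one; intro p hp
      have : e p = true := by simpa [D] using (mem_inter.1 hp).2
      simp [ph, this]
    rw [this, mul_one]
    apply prod_congr rfl
    intro p hp
    have : e p = false := by simpa [D] using (mem_sdiff.1 hp).2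
    simp [ph, this, abs_of_nonneg (h0 p)]
  simp only [e1]
  let i : Finset π → Finset π × Finset π := fun l => (l ∩ D, l \ D)
  have hi : Set.InjOn i S := by
    intro l _ l' _ hll
    simp only [i, Prod.mk.injEq] at hll
    rw [← sdiff_union_inter l D, ← sdiff_union_inter l' D, hll.1, hll.2]
  calc ∑ l ∈ S, ∏ p ∈ l \ D, h p = ∑ x ∈ S.image i, ∏ p ∈ x.2, h p := by
        rw [sum_image hi]
    _ ≤ ∑ x ∈ D.powerset ×ˢ S, ∏ p ∈ x.2, h p := by
        apply sum_le_sum_of_subset_of_nonneg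
        · intro x hx
          obtain ⟨l, hl, rfl⟩ := mem_image.1 hx
          simp only [i, mem_product, mem_powerset]
          exact ⟨inter_subset_right, hd l hl _ sdiff_subset⟩
        · intro _ _ _; exact prod_nonneg fun p _ => h0 p
    _ = 2 ^ D.card * Lc S h := by
        rw [sum_product]; simp [Lc]

lemma Xf_sq (S : Finset (Finset π)) (q : π → ℝ) (hq0 : ∀ p, 0 ≤ q p) (hq : ∀ p, q p < 1) (hS : ∅ ∈ S) :
    ∑ e : π → Bool, Xf S (fun p => q p / (1 - q p)) e ^ 2 * ∏ p, (if e p then q p else 1 - q p) =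
      1 / Lc S (fun p => q p / (1 - q p)) := by
  set h : π → ℝ := fun p => q p / (1 - q p)
  have h0 : ∀ p, 0 ≤ h p := fun p => div_nonneg (hq0 p) (by linarith [hq p])
  have hL := one_le_Lc S h h0 hS
  have hpi : ∀ (l : Finset π) (F : π → ℝ), ∏ p ∈ l, F p = ∏ p, if p ∈ l then F p else 1 := by
    intro l F; rw [prod_ite_mem]; simp
  have key : ∀ l l' : Finset π, ∑ e : π → Bool, (∏ p ∈ l, ph h p (e p)) * (∏ p ∈ l', ph h p (e p)) *
      ∏ p, (if e p then q p else 1 - q p) = if l = l' then ∏ p ∈ l, h p else 0 := by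
    intro l l'
    have : ∀ e : π → Bool, (∏ p ∈ l, ph h p (e p)) * (∏ p ∈ l', ph h p (e p)) *
      ∏ p, (if e p then q p else 1 - q p) = ∏ p, ((if p ∈ l then ph h p (e p) else 1) *
        (if p ∈ l' then ph h p (e p) else 1) * (if e p then q p else 1 - q p)) := by
      intro e; rw [hpi l, hpi l', prod_mul_distrib, prod_mul_distrib]
    simp only [this]
    rw [sum_prod_bool (fun p b => (if p ∈ l then ph h p b else 1) *
        (if p ∈ l' then ph h p b else 1) * (if b then q p else 1 - q p))]
    have hone : ∀ p, (1 - q p) ≠ 0 := fun p => by linarith [hq p]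
    by_cases hll : l = l'
    · rw [if_pos hll]
      subst hll
      rw [hpi l h]
      apply prod_congr rfl
      intro p _
      have := hone p
      by_cases hp : p ∈ l
      · simp only [hp, ph, h, if_true, Bool.false_eq_true, if_false]; field_simp; ring
      · simp [hp]
    · rw [if_neg hll]
      obtain ⟨p, hp⟩ : ∃ p, ¬ (p ∈ l ↔ p ∈ l') := by
        by_contra! hc; exact hll (Finset.ext hc)
      apply prod_eq_zero (mem_univ p)
      have := hone p
      by_cases h1 : p ∈ l <;> by_cases h2 : p ∈ l' <;> simp_all [ph, h] <;> field_simp <;> ring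
  have e1 : ∀ e : π → Bool, Xf S h e ^ 2 * ∏ p, (if e p then q p else 1 - q p) =
      (∑ l ∈ S, ∑ l' ∈ S, (∏ p ∈ l, ph h p (e p)) * (∏ p ∈ l', ph h p (e p)) *
      ∏ p, (if e p then q p else 1 - q p)) / Lc S h ^ 2 := by
    intro e
    unfold Xf
    rw [div_pow, sq (∑ l ∈ S, _), sum_mul_sum, div_mul_eq_mul_div, sum_mul]
    simp only [sum_mul]
  simp only [e1]
  rw [← sum_div, sum_comm]
  have e2 : ∑ l ∈ S, ∑ e : π → Bool, ∑ l' ∈ S, (∏ p ∈ l, ph h p (e p)) * (∏ p ∈ l', ph h p (e p)) *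
      ∏ p, (if e p then q p else 1 - q p) = Lc S h := by
    unfold Lc
    apply sum_congr rfl
    intro l hl
    rw [sum_comm]
    simp [key, hl]
  rw [e2]
  have : Lc S h ≠ 0 := by linarith
  field_simp

end D3
end GT
namespace GT

section D4

variable {π : Type} [Fintype π] {α : Type} [Fintype α]

lemma pw_le_add {c : ℝ} (hc : 1 ≤ c) (j : α → Bool) :
    pw c j ≤ 1 + c ^ Fintype.card α * ∑ a, bi (j a) := by
  by_cases h : ∃ a, j a = true
  · obtain ⟨a, ha⟩ := h
    have h1 : (1 : ℝ) ≤ ∑ a, bi (j a) := by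
      have := single_le_sum (f := fun a => bi (j a)) (fun a _ => bi_nonneg _) (mem_univ a)
      simp only [ha] at this
      simpa [bi] using this
    have h2 : pw c j ≤ c ^ Fintype.card α := by
      rw [pw_eq]
      exact pow_le_pow_right₀ hc (card_le_univ _)
    have : (0 : ℝ) < c ^ Fintype.card α := by positivity
    nlinarith
  · have : pw c j = 1 := by
      unfold pw; apply prod_eq_one; intro a _
      rw [if_neg fun hc => h ⟨a, hc⟩]
    rw [this]
    have : 0 ≤ ∑ a, bi (j a) := sum_nonneg fun a _ => bi_nonneg _
    have : (0 : ℝ) < c ^ Fintype.card α := by positivity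
    nlinarith

lemma PL.pw_sum {q : ℝ} {μ : (α → Bool) → ℝ} (h : PL q μ) {c : ℝ} (hc : 1 ≤ c) :
    ∑ j, μ j * pw c j ≤ 1 + c ^ Fintype.card α * Fintype.card α * q := by
  refine (sum_le_sum fun j _ => mul_le_mul_of_nonneg_left (pw_le_add hc j) (h.nonneg j)).trans ?_
  simp only [mul_add, mul_one, sum_add_distrib, h.one]
  have : ∀ j, μ j * (c ^ Fintype.card α * ∑ a, bi (j a)) = c ^ Fintype.card α * ∑ a, μ j * bi (j a) := by
    intro j; rw [← mul_sum]; ring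
  simp only [this]
  rw [← mul_sum, sum_comm]
  simp only [h.marg, sum_const, card_univ, nsmul_eq_mul]
  rw [mul_assoc]

lemma prod_le_exp (x : π → ℝ) (y : π → ℝ) (h0 : ∀ p, 0 ≤ x p) (h : ∀ p, x p ≤ 1 + y p) :
    ∏ p, x p ≤ Real.exp (∑ p, y p) := by
  rw [Real.exp_sum]
  apply prod_le_prod (fun p _ => h0 p)
  intro p _
  have := Real.add_one_le_exp (y p)
  linarith [h p]

/-- the truncated sieve on small primes -/
noncomputable def E1 (r : ℕ) (μ : π → (α → Bool) → ℝ) : ℝ :=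
  ∑ J : π → α → Bool, (∏ a, Bf r (fun p => J p a)) * ∏ p, μ p (J p)

lemma E1_close (r : ℕ) (q : π → ℝ) (μ : π → (α → Bool) → ℝ) (h : ∀ p, PL (q p) (μ p)) :
    |E1 r μ - ∏ p, μ p (fun _ => false)| ≤ Fintype.card α * Real.exp (-(2 * r : ℝ)) *
      Real.exp (6 ^ Fintype.card α * Fintype.card α * ∑ p, q p) := by
  have e1 : ∏ p, μ p (fun _ => false) = ∑ J : π → α → Bool, (∏ a, zi (fun p => J p a)) * ∏ p, μ p (J p) := by
    have : ∀ J : π → α → Bool, (∏ a, zi (fun p => J p a)) * ∏ p, μ p (J p) = ∏ p, (zi (J p) * μ p (J p)) := by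
      intro J
      rw [prod_mul_distrib]; congr 1
      unfold zi; exact prod_comm
    simp only [this]
    rw [sum_pi_prod (fun p j => zi j * μ p j)]
    apply prod_congr rfl
    intro p _
    rw [Fintype.sum_eq_single (fun _ => false)]
    · simp [zi]
    · intro j hj
      have : zi j = 0 := by
        obtain ⟨a, ha⟩ : ∃ a, j a = true := by
          by_contra! hc
          exact hj (funext fun a => by simpa using hc a)
        exact prod_eq_zero (mem_univ a) (by simp [ha])
      rw [this, zero_mul]
  rw [e1, E1, ← sum_sub_distrib]
  refine (abs_sum_le_sum_abs _ _).trans ?_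
  have h2 : ∀ J : π → α → Bool, |(∏ a, Bf r (fun p => J p a)) * ∏ p, μ p (J p) -
      (∏ a, zi (fun p => J p a)) * ∏ p, μ p (J p)| ≤
      Fintype.card α * Real.exp (-(2 * r : ℝ)) * ∏ p, (μ p (J p) * pw 6 (J p)) := by
    intro J
    rw [← sub_mul, abs_mul, abs_of_nonneg (prod_nonneg fun p _ => (h p).nonneg _)]
    have := prod_close univ (fun a => Bf r (fun p => J p a)) (fun a => zi (fun p => J p a))
      (fun a => pw 6 (fun p => J p a)) (Real.exp (-(2 * r : ℝ)))
      (fun a => by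
        rw [abs_of_nonneg (Bf_nonneg _ _)]
        exact (Bf_le _ _).trans (pw_mono (by norm_num) (by norm_num) _))
      (fun a => by
        rw [abs_of_nonneg (zi_bounds _).1]
        exact (zi_bounds _).2.trans (one_le_pw (by norm_num) _))
      (fun a => Bf_sub _ _)
    rw [pw_comm, card_univ] at this
    refine (mul_le_mul_of_nonneg_right this (prod_nonneg fun p _ => (h p).nonneg _)).trans ?_
    rw [prod_mul_distrib]
    apply le_of_eq; ring
  refine (sum_le_sum fun J _ => h2 J).trans ?_
  rw [← mul_sum, sum_pi_prod (fun p j => μ p j * pw 6 j)]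
  apply mul_le_mul_of_nonneg_left _ (by positivity)
  rw [mul_sum]
  apply prod_le_exp
  · intro p; exact sum_nonneg fun j _ => mul_nonneg ((h p).nonneg j) (zero_le_one.trans (one_le_pw (by norm_num) _))
  · intro p; exact (h p).pw_sum (by norm_num)

lemma ber_false (q : ℝ) : ber (α := α) q (fun _ => false) = (1 - q) ^ Fintype.card α := by
  simp [ber]

lemma E1_rel (r : ℕ) (q : π → ℝ) (μ : π → (α → Bool) → ℝ) (h : ∀ p, PL (q p) (μ p))
    (hq0 : ∀ p, 0 ≤ q p) (hq : ∀ p, q p ≤ 1 / 2) (hqt : ∀ p, Fintype.card α * q p ≤ 1 / 2) :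
    |E1 r μ / (∏ p, (1 - q p)) ^ Fintype.card α - 1| ≤
      (Real.exp (2 * Fintype.card α ^ 2 * ∑ p, q p * q p) - 1) + Fintype.card α *
      Real.exp (-(2 * r : ℝ) + (6 ^ Fintype.card α * Fintype.card α + 2 * Fintype.card α) * ∑ p, q p) := by
  set t := Fintype.card α
  set V := ∏ p, (1 - q p)
  have hV : 0 < V := prod_pos fun p _ => by linarith [hq p]
  have hv : V ^ t = ∏ p, (1 - q p) ^ t := by rw [← prod_pow]
  set x : π → ℝ := fun p => μ p (fun _ => false) / (1 - q p) ^ t - 1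
  have hx : ∀ p, |x p| ≤ 2 * t ^ 2 * (q p * q p) := by
    intro p
    have hb := ber_PL (α := α) (q p) (hq0 p) (by linarith [hq p])
    have h1 := (h p).close hb (fun _ => false)
    have h2 := hb.empty_bounds.1
    rw [ber_false] at h1 h2
    change _ ≤ (1 - q p) ^ t at h2
    have h3 : 1 / 2 ≤ (1 - q p) ^ t := by linarith [hqt p]
    have h4 : x p = (μ p (fun _ => false) - (1 - q p) ^ t) / (1 - q p) ^ t := by
      simp only [x]; field_simp
    rw [h4, abs_div, abs_of_pos (by linarith : 0 < (1 - q p) ^ t), div_le_iff₀ (by linarith)]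
    have : 0 ≤ (t : ℝ) ^ 2 * (q p * q p) := mul_nonneg (by positivity) (mul_self_nonneg _)
    refine h1.trans ?_
    change (t : ℝ) ^ 2 * (q p * q p) ≤ _
    nlinarith
  have h1 : (∏ p, μ p (fun _ => false)) / V ^ t = ∏ p, (1 + x p) := by
    rw [hv, ← prod_div_distrib]
    apply prod_congr rfl; intro p _; simp [x]
  have h2 : |(∏ p, μ p (fun _ => false)) / V ^ t - 1| ≤ Real.exp (2 * t ^ 2 * ∑ p, q p * q p) - 1 := by
    rw [h1]
    have := Finset.norm_prod_one_add_sub_one_le univ x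
    simp only [Real.norm_eq_abs] at this
    refine this.trans ?_
    gcongr
    rw [mul_sum]
    exact sum_le_sum fun p _ => hx p
  have h3 := E1_close r q μ h
  have h4 : (1 / V) ^ t ≤ Real.exp (2 * t * ∑ p, q p) := by
    have : 1 / V ≤ Real.exp (∑ p, 2 * q p) := by
      rw [one_div, ← prod_inv_distrib]
      apply prod_le_exp
      · intro p; apply inv_nonneg.2; linarith [hq p]
      · intro p
        have := hq p
        rw [inv_le_comm₀ (by linarith) (by linarith [hq0 p]), inv_le_iff_one_le_mul₀ (by linarith [hq0 p])]
        nlinarith [hq0 p]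
    refine (pow_le_pow_left₀ (by positivity) this t).trans ?_
    rw [← Real.exp_nat_mul, ← mul_sum]
    apply le_of_eq; ring_nf
  have e : E1 r μ / V ^ t - 1 = ((∏ p, μ p (fun _ => false)) / V ^ t - 1) +
      (E1 r μ - ∏ p, μ p (fun _ => false)) * (1 / V) ^ t := by
    rw [one_div, inv_pow]; ring
  rw [e]
  refine (abs_add_le _ _).trans (add_le_add h2 ?_)
  rw [abs_mul, abs_of_pos (by positivity : 0 < (1 / V) ^ t)]
  refine (mul_le_mul h3 h4 (by positivity) (by positivity)).trans ?_
  rw [mul_assoc, mul_assoc, ← Real.exp_add, ← Real.exp_add]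
  apply le_of_eq; congr 2; change _ + (6 ^ t * (t : ℝ) * _ + _) = _; ring

/-- the Selberg part on large primes -/
noncomputable def E2 (S : Finset (Finset π)) (h : π → ℝ) (μ : π → (α → Bool) → ℝ) : ℝ :=
  ∑ J : π → α → Bool, (∏ a, Xf S h (fun p => J p a) ^ 2) * ∏ p, μ p (J p)

lemma E2_ber (S : Finset (Finset π)) (q : π → ℝ) (hq0 : ∀ p, 0 ≤ q p) (hq : ∀ p, q p < 1) (hS : ∅ ∈ S) :
    E2 (α := α) S (fun p => q p / (1 - q p)) (fun p => ber (q p)) =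
      (1 / Lc S (fun p => q p / (1 - q p))) ^ Fintype.card α := by
  rw [← Xf_sq S q hq0 hq hS]
  unfold E2 ber
  have := (sum_pi_prod (fun (_ : α) (e : π → Bool) => Xf S (fun p => q p / (1 - q p)) e ^ 2 *
    ∏ p, (if e p then q p else 1 - q p)))
  rw [prod_const, card_univ] at this
  rw [← this]
  apply Fintype.sum_equiv (Equiv.piComm fun _ _ => Bool)
  intro J
  rw [prod_mul_distrib]
  congr 1
  exact prod_comm

lemma Lc_le (S : Finset (Finset π)) (q : π → ℝ) (hq0 : ∀ p, 0 ≤ q p) (hq : ∀ p, q p ≤ 1 / 2) :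
    Lc S (fun p => q p / (1 - q p)) ≤ Real.exp (2 * ∑ p, q p) := by
  have h0 : ∀ p, 0 ≤ q p / (1 - q p) := fun p => div_nonneg (hq0 p) (by linarith [hq p])
  calc Lc S (fun p => q p / (1 - q p)) ≤ ∑ l ∈ (univ : Finset π).powerset, ∏ p ∈ l, (q p / (1 - q p)) := by
        apply sum_le_sum_of_subset_of_nonneg
        · intro l _; simp
        · intro _ _ _; exact prod_nonneg fun p _ => h0 p
    _ = ∏ p, (1 + q p / (1 - q p)) := by rw [Finset.prod_one_add]
    _ ≤ _ := by
        rw [mul_sum]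
        apply prod_le_exp
        · intro p; linarith [h0 p]
        · intro p
          have := hq p
          have : q p / (1 - q p) ≤ 2 * q p := by
            rw [div_le_iff₀ (by linarith)]; nlinarith [hq0 p]
          linarith

/-- constant -/
noncomputable def c4 (t : ℕ) : ℝ := 4 ^ t * t + 8 ^ t * t ^ 2

lemma c4_nonneg (t : ℕ) : 0 ≤ c4 t := by unfold c4; positivity

lemma E2_rel (S : Finset (Finset π)) (hS : ∅ ∈ S) (hd : ∀ l ∈ S, ∀ l' ⊆ l, l' ∈ S)
    (q : π → ℝ) (μ : π → (α → Bool) → ℝ) (h : ∀ p, PL (q p) (μ p))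
    (hq0 : ∀ p, 0 ≤ q p) (hq : ∀ p, q p ≤ 1 / 2) :
    |E2 S (fun p => q p / (1 - q p)) μ * Lc S (fun p => q p / (1 - q p)) ^ Fintype.card α - 1| ≤
      c4 (Fintype.card α) * Real.exp ((2 * Fintype.card α + c4 (Fintype.card α)) * ∑ p, q p) * ∑ p, q p * q p := by
  set t := Fintype.card α
  set hh : π → ℝ := fun p => q p / (1 - q p)
  have h0 : ∀ p, 0 ≤ hh p := fun p => div_nonneg (hq0 p) (by linarith [hq p])
  have hL := one_le_Lc S hh h0 hS
  have hb : ∀ p, PL (q p) (ber (α := α) (q p)) := fun p => ber_PL (q p) (hq0 p) (by linarith [hq p])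
  have key := compare_laws μ (fun p => ber (q p)) (fun p => (h p).nonneg) (fun p => (hb p).nonneg)
    (fun p => (h p).one) (pw 4) (fun j => one_le_pw (by norm_num) j)
    (fun J => ∏ a, Xf S hh (fun p => J p a) ^ 2) (by
      intro J
      rw [← pw_comm, abs_prod]
      apply prod_le_prod (fun _ _ => abs_nonneg _)
      intro a _
      have := Xf_le S hh h0 hS hd (fun p => J p a)
      rw [abs_pow]
      refine (pow_le_pow_left₀ (abs_nonneg _) this 2).trans (le_of_eq ?_)
      rw [pw_eq, pw_eq, ← pow_mul, mul_comm, pow_mul]; norm_num)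
  change |E2 S hh μ - E2 S hh (fun p => ber (q p))| ≤ _ at key
  rw [E2_ber S q hq0 (fun p => by linarith [hq p]) hS] at key
  have hd1 : ∀ p, ∑ j, pw 4 j * |μ p j - ber (q p) j| ≤ 8 ^ t * t ^ 2 * (q p * q p) := by
    intro p
    have : ∀ j : α → Bool, pw 4 j * |μ p j - ber (q p) j| ≤ 4 ^ t * (t ^ 2 * (q p * q p)) := by
      intro j
      apply mul_le_mul _ ((h p).close (hb p) j) (abs_nonneg _) (by positivity)
      rw [pw_eq]; exact pow_le_pow_right₀ (by norm_num) (card_le_univ _)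
    refine (sum_le_sum fun j _ => this j).trans ?_
    rw [sum_const, nsmul_eq_mul, card_univ, Fintype.card_fun, Fintype.card_bool]
    change ((2 ^ t : ℕ) : ℝ) * _ ≤ _
    rw [show (8 : ℝ) ^ t = 2 ^ t * 4 ^ t by rw [← mul_pow]; norm_num]
    push_cast; apply le_of_eq; ring
  have hd2 : ∀ p, ∑ j, pw 4 j * max (μ p j) (ber (q p) j) ≤ 1 + c4 t * q p := by
    intro p
    have : ∀ j : α → Bool, pw 4 j * max (μ p j) (ber (q p) j) ≤ μ p j * pw 4 j + pw 4 j * |μ p j - ber (q p) j| := by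
      intro j
      have h1 : max (μ p j) (ber (q p) j) ≤ μ p j + |μ p j - ber (q p) j| := by
        apply max_le
        · linarith [abs_nonneg (μ p j - ber (q p) j)]
        · linarith [neg_abs_le (μ p j - ber (q p) j)]
      have := one_le_pw (c := 4) (by norm_num) j
      nlinarith
    refine (sum_le_sum fun j _ => this j).trans ?_
    rw [sum_add_distrib]
    have h1 := (h p).pw_sum (c := 4) (by norm_num)
    change _ ≤ 1 + 4 ^ t * (t : ℝ) * q p at h1
    have h2 := hd1 p
    have h3 : 8 ^ t * (t : ℝ) ^ 2 * (q p * q p) ≤ 8 ^ t * (t : ℝ) ^ 2 * q p := by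
      apply mul_le_mul_of_nonneg_left _ (by positivity)
      nlinarith [hq0 p, hq p]
    unfold c4
    linarith
  have k1 : ∏ p, ∑ j, pw 4 j * max (μ p j) (ber (q p) j) ≤ Real.exp (c4 t * ∑ p, q p) := by
    rw [mul_sum]
    exact prod_le_exp _ _ (fun p => sum_nonneg fun j _ => mul_nonneg (zero_le_one.trans (one_le_pw (by norm_num) _))
      (le_max_of_le_left ((h p).nonneg j))) hd2
  have k2 : ∑ p, ∑ j, pw 4 j * |μ p j - ber (q p) j| ≤ c4 t * ∑ p, q p * q p := by
    rw [mul_sum]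
    apply sum_le_sum
    intro p _
    refine (hd1 p).trans ?_
    apply mul_le_mul_of_nonneg_right _ (mul_self_nonneg _)
    unfold c4
    have : (0 : ℝ) ≤ 4 ^ t * t := by positivity
    linarith
  have k3 : Lc S hh ^ t ≤ Real.exp (2 * t * ∑ p, q p) := by
    refine (pow_le_pow_left₀ (by linarith) (Lc_le S q hq0 hq) t).trans ?_
    rw [← Real.exp_nat_mul]; apply le_of_eq; ring_nf
  have e : E2 S hh μ * Lc S hh ^ t - 1 = (E2 S hh μ - (1 / Lc S hh) ^ t) * Lc S hh ^ t := by
    have : Lc S hh ≠ 0 := by linarith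
    rw [sub_mul, ← mul_pow, one_div, inv_mul_cancel₀ this, one_pow]
  rw [e, abs_mul, abs_of_nonneg (by positivity : 0 ≤ Lc S hh ^ t)]
  have hs : 0 ≤ ∑ p, ∑ j, pw 4 j * |μ p j - ber (q p) j| := sum_nonneg fun p _ => sum_nonneg fun j _ =>
    mul_nonneg (zero_le_one.trans (one_le_pw (by norm_num) _)) (abs_nonneg _)
  have key2 := key.trans (mul_le_mul k1 k2 hs (Real.exp_pos _).le)
  refine (mul_le_mul key2 k3 (by positivity) ?_).trans (le_of_eq ?_)
  · have := c4_nonneg t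
    have : 0 ≤ ∑ p, q p * q p := sum_nonneg fun p _ => mul_self_nonneg _
    positivity
  · rw [add_mul, Real.exp_add]; ring

end D4
end GT
namespace GT

section forms
variable {α : Type} [Fintype α] {n : ℕ}

/-- zero pattern mod p of the affine forms with coefficients c and constants u -/
noncomputable def pat (c : α → Fin n → ℤ) (u : α → ℤ) (p : ℕ) (x : Fin n → ZMod p) (a : α) : Bool :=
  decide ((∑ i, (c a i : ZMod p) * x i) + (u a : ZMod p) = 0)

noncomputable def mu (c : α → Fin n → ℤ) (u : α → ℤ) (p : ℕ) [NeZero p] (J : α → Bool) : ℝ :=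
  av fun x : Fin n → ZMod p => ind (pat c u p x = J)

lemma sum_mu (c : α → Fin n → ℤ) (u : α → ℤ) (p : ℕ) [NeZero p] (F : (α → Bool) → ℝ) :
    ∑ J, mu c u p J * F J = av fun x : Fin n → ZMod p => F (pat c u p x) := by
  unfold mu
  simp_rw [← av_mul_right]
  rw [← av_sum]
  apply av_congr; intro x
  rw [sum_eq_single (pat c u p x)]
  · rw [ind_true rfl, one_mul]
  · intro b _ hb; rw [ind_false (Ne.symm hb), zero_mul]
  · simp

lemma av_affine (p : ℕ) [Fact p.Prime] (c d : ZMod p) (hc : c ≠ 0) :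
    (av fun t : ZMod p => bi (decide (c * t + d = 0))) = 1 / p := by
  rw [av_eq, ZMod.card]
  congr 1
  rw [sum_eq_single (-d / c)]
  · have : c * (-d / c) + d = 0 := by field_simp; ring
    simp [bi, this]
  · intro b _ hb
    have : ¬ (c * b + d = 0) := by
      intro h; apply hb; field_simp; linear_combination h
    simp [bi, this]
  · simp

lemma upd_sum (p : ℕ) (c : Fin n → ZMod p) (x : Fin n → ZMod p) (i : Fin n) (t : ZMod p) :
    ∑ j, c j * Function.update x i t j = c i * t + ∑ j ∈ univ.erase i, c j * x j := by
  rw [← add_sum_erase _ _ (mem_univ i), Function.update_self]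
  congr 1
  apply sum_congr rfl; intro j hj
  rw [Function.update_of_ne (ne_of_mem_erase hj)]

lemma mu_PL (c : α → Fin n → ℤ) (u : α → ℤ) (p : ℕ) [Fact p.Prime]
    (h1 : ∀ a, ∃ i, (c a i : ZMod p) ≠ 0)
    (h2 : ∀ a b, a ≠ b → ∃ i, (c a i : ZMod p) ≠ 0 ∧ (c b i : ZMod p) = 0) :
    PL (1 / (p : ℝ)) (mu c u p) where
  nonneg := fun J => av_nonneg fun x => ind_nonneg _
  one := by
    have := sum_mu c u p (fun _ => 1)
    simp only [mul_one] at this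
    rw [this, av_const]
  marg := by
    intro a
    rw [sum_mu c u p (fun J => bi (J a))]
    obtain ⟨i, hi⟩ := h1 a
    rw [av_update i]
    simp only [pat, upd_sum, add_assoc]
    simp only [av_affine p _ _ hi, av_const]
  pair := by
    intro a b hab
    rw [sum_mu c u p (fun J => bi (J a) * bi (J b))]
    obtain ⟨i, hi, hi2⟩ := h2 a b hab
    rw [av_update i]
    simp only [pat, upd_sum, add_assoc, hi2, zero_mul, zero_add]
    simp only [av_mul_right, av_affine p _ _ hi, av_mul_left]
    congr 1
    obtain ⟨j, hj⟩ := h1 b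
    have hne : j ≠ i := by rintro rfl; exact hj hi2
    have e : ∀ x : Fin n → ZMod p, ∑ k ∈ univ.erase i, (c b k : ZMod p) * x k = ∑ k, (c b k : ZMod p) * x k := by
      intro x
      rw [← add_sum_erase _ _ (mem_univ i), hi2, zero_mul, zero_add]
    simp only [e]
    rw [av_update j]
    simp only [upd_sum, add_assoc]
    simp only [av_affine p _ _ hj, av_const]

variable {π : Type} [Fintype π]

lemma prod_biUnion_le {β : Type*} (s : Finset β) (U : β → Finset π) (f : π → ℕ) (hf : ∀ p, 1 ≤ f p) :
    ∏ p ∈ s.biUnion U, f p ≤ ∏ b ∈ s, ∏ p ∈ U b, f p := by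
  induction s using Finset.induction_on with
  | empty => simp
  | insert b s hb ih =>
    rw [biUnion_insert, prod_insert hb]
    have := prod_union_inter (s₁ := U b) (s₂ := s.biUnion U) (f := f)
    have h1 : 1 ≤ ∏ p ∈ U b ∩ s.biUnion U, f p := Finset.one_le_prod' fun p _ => hf p
    calc _ ≤ (∏ p ∈ U b ∪ s.biUnion U, f p) * ∏ p ∈ U b ∩ s.biUnion U, f p := Nat.le_mul_of_pos_right _ h1
      _ = _ := this
      _ ≤ _ := Nat.mul_le_mul_left _ ih

lemma corr_abs {κ : Type*} (pr : π → ℕ) [∀ p, Fact (pr p).Prime] (hinj : Function.Injective pr)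
    (K : Finset κ) (coef : κ → ℝ) (hcoef : ∀ k, |coef k| ≤ 1) (g : κ → π → Bool → ℝ)
    (hg : ∀ k p b, |g k p b| ≤ 1) (U : κ → Finset π) (hU : ∀ k p, p ∉ U k → ∀ b, g k p b = 1)
    (M : ℕ) (hM : ∀ k ∈ K, ∏ p ∈ U k, pr p ≤ M) (hK : K.card ≤ M)
    (G : (π → Bool) → ℝ) (hG : ∀ e, G e = ∑ k ∈ K, coef k * ∏ p, g k p (e p))
    (c : α → Fin n → ℤ) (u : α → ℤ) (H : ℕ) (hH : 0 < H) :
    |(av fun h : Fin n → Fin H => ∏ a, G (fun p => decide ((pr p : ℤ) ∣ (∑ i, c a i * ((h i : ℕ) : ℤ)) + u a)))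
      - ∑ J : π → α → Bool, (∏ a, G (fun p => J p a)) * ∏ p, mu c u (pr p) (J p)| ≤
      (M : ℝ) ^ Fintype.card α * (n * (2 * (M : ℝ) ^ Fintype.card α / H)) := by
  have : ∀ p, NeZero (pr p) := fun p => ⟨(Fact.out : (pr p).Prime).ne_zero⟩
  have exp1 : ∀ e : α → π → Bool, ∏ a, G (e a) = ∑ k ∈ Fintype.piFinset (fun _ : α => K),
      (∏ a, coef (k a)) * ∏ p, ∏ a, g (k a) p (e a p) := by
    intro e
    simp_rw [hG]
    rw [prod_univ_sum]
    apply sum_congr rfl; intro k _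
    rw [prod_mul_distrib]; congr 1; exact Finset.prod_comm
  have hpat : ∀ (h : Fin n → Fin H) (a : α) (p : π), decide ((pr p : ℤ) ∣ (∑ i, c a i * ((h i : ℕ) : ℤ)) + u a) =
      pat c u (pr p) (fun i => ((h i : ℕ) : ZMod (pr p))) a := by
    intro h a p
    unfold pat
    congr 1
    rw [← ZMod.intCast_zmod_eq_zero_iff_dvd]
    push_cast; rfl
  have e1 : (av fun h : Fin n → Fin H => ∏ a, G (fun p => decide ((pr p : ℤ) ∣ (∑ i, c a i * ((h i : ℕ) : ℤ)) + u a)))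
      = ∑ k ∈ Fintype.piFinset (fun _ : α => K), (∏ a, coef (k a)) *
        av fun h : Fin n → Fin H => ∏ p, ∏ a, g (k a) p (pat c u (pr p) (fun i => ((h i : ℕ) : ZMod (pr p))) a) := by
    simp_rw [hpat, exp1, ← av_mul_left]
    rw [av_sum]
  have e2 : ∑ J : π → α → Bool, (∏ a, G (fun p => J p a)) * ∏ p, mu c u (pr p) (J p) =
      ∑ k ∈ Fintype.piFinset (fun _ : α => K), (∏ a, coef (k a)) *
        ∏ p, av fun x : Fin n → ZMod (pr p) => ∏ a, g (k a) p (pat c u (pr p) x a) := by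
    have : ∀ J : π → α → Bool, (∏ a, G (fun p => J p a)) = _ := fun J => exp1 (fun a p => J p a)
    simp_rw [this, sum_mul]
    rw [sum_comm]
    apply sum_congr rfl; intro k _
    simp_rw [mul_assoc, ← prod_mul_distrib]
    rw [← mul_sum, sum_pi_prod (fun p (j : α → Bool) => (∏ a, g (k a) p (j a)) * mu c u (pr p) j)]
    congr 1
    apply prod_congr rfl; intro p _
    rw [← sum_mu c u (pr p) (fun j => ∏ a, g (k a) p (j a))]
    apply sum_congr rfl; intro j _; ring
  rw [e1, e2, ← sum_sub_distrib]
  refine (abs_sum_le_sum_abs _ _).trans ?_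
  have hterm : ∀ k ∈ Fintype.piFinset (fun _ : α => K),
      |(∏ a, coef (k a)) * (av fun h : Fin n → Fin H => ∏ p, ∏ a, g (k a) p (pat c u (pr p) (fun i => ((h i : ℕ) : ZMod (pr p))) a))
      - (∏ a, coef (k a)) * ∏ p, av fun x : Fin n → ZMod (pr p) => ∏ a, g (k a) p (pat c u (pr p) x a)| ≤
        n * (2 * (M : ℝ) ^ Fintype.card α / H) := by
    intro k hk
    rw [Fintype.mem_piFinset] at hk
    rw [← mul_sub, abs_mul]
    have h1 : |∏ a, coef (k a)| ≤ 1 := by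
      rw [abs_prod]; exact prod_le_one (fun _ _ => abs_nonneg _) fun a _ => hcoef _
    have h2 := transfer_sub pr (fun i j hij => (Nat.coprime_primes Fact.out Fact.out).2 (hinj.ne hij)) n
      (fun p x => ∏ a, g (k a) p (pat c u (pr p) x a)) (fun p x => by
        rw [abs_prod]; exact prod_le_one (fun _ _ => abs_nonneg _) fun a _ => hg _ _ _)
      (univ.biUnion fun a => U (k a)) (fun p hp x => by
        apply prod_eq_one; intro a _
        apply hU; intro h; exact hp (mem_biUnion.2 ⟨a, mem_univ _, h⟩)) H hH
    have h3 : ∏ i ∈ univ.biUnion (fun a => U (k a)), pr i ≤ M ^ Fintype.card α := by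
      calc ∏ i ∈ univ.biUnion (fun a => U (k a)), pr i ≤ ∏ a, ∏ i ∈ U (k a), pr i := by
            exact prod_biUnion_le univ _ pr fun p => (Fact.out : (pr p).Prime).one_le
        _ ≤ ∏ a : α, M := prod_le_prod' fun a _ => hM _ (hk a)
        _ = _ := by simp
    have h4 : ((∏ i ∈ univ.biUnion (fun a => U (k a)), pr i : ℕ) : ℝ) ≤ (M : ℝ) ^ Fintype.card α := by exact_mod_cast h3
    calc _ ≤ 1 * _ := mul_le_mul h1 h2 (abs_nonneg _) zero_le_one
      _ ≤ _ := by rw [one_mul]; gcongr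
  refine (sum_le_sum hterm).trans ?_
  rw [sum_const, nsmul_eq_mul]
  apply mul_le_mul_of_nonneg_right _ (by positivity)
  rw [Fintype.card_piFinset, prod_const, card_univ]
  push_cast
  gcongr

end forms
end GT
namespace GT

/-- reciprocal -/
noncomputable def qq (P : Finset ℕ) (p : P) : ℝ := 1 / (p : ℝ)

/-- squarefree products of primes in P of size at most R -/
noncomputable def SS (P : Finset ℕ) (R : ℕ) : Finset (Finset P) :=
  univ.filter fun l => ∏ p ∈ l, (p : ℕ) ≤ R

noncomputable def Ls (P : Finset ℕ) (R : ℕ) : ℝ := Lc (SS P R) (fun p => qq P p / (1 - qq P p))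

noncomputable def VV (P : Finset ℕ) : ℝ := ∏ p : P, (1 - qq P p)

/-- the unnormalised majorant as a function of the divisibility pattern -/
noncomputable def GG (P1 P2 : Finset ℕ) (r R : ℕ) (e : P1 ⊕ P2 → Bool) : ℝ :=
  Bf r (fun p => e (Sum.inl p)) * Xf (SS P2 R) (fun p => qq P2 p / (1 - qq P2 p)) (fun p => e (Sum.inr p)) ^ 2

def prr (P1 P2 : Finset ℕ) : P1 ⊕ P2 → ℕ := Sum.elim (fun p => (p : ℕ)) (fun p => (p : ℕ))

/-- the sieve majorant on the integers -/
noncomputable def nt (P1 P2 : Finset ℕ) (r R : ℕ) (m : ℤ) : ℝ :=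
  Ls P2 R / VV P1 * GG P1 P2 r R (fun p => decide ((prr P1 P2 p : ℤ) ∣ m))

lemma card_le_of_prod (P : Finset ℕ) (hP : ∀ p ∈ P, p.Prime) (T : Finset (Finset P)) (M : ℕ)
    (hT : ∀ s ∈ T, ∏ p ∈ s, (p : ℕ) ≤ M) : T.card ≤ M := by
  have : T.card ≤ (Icc 1 M).card := by
    apply card_le_card_of_injOn (fun s : Finset P => ∏ p ∈ s, (p : ℕ))
    · intro s hs
      rw [mem_coe, mem_Icc]
      exact ⟨Finset.one_le_prod' fun p _ => (hP p p.2).one_le, hT s hs⟩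
    · intro s _ s' _ h
      have e : ∀ s : Finset P, (∏ p ∈ s, (p : ℕ)).primeFactors = s.map (Function.Embedding.subtype _) := by
        intro s
        rw [← Nat.primeFactors_prod (s := s.map (Function.Embedding.subtype _)) (by
          intro p hp; rw [Finset.mem_map] at hp; obtain ⟨q, _, rfl⟩ := hp; exact hP q q.2), prod_map]
        rfl
      have := e s
      simp only at h
      rw [h, e s'] at this
      exact (map_injective _ this).symm
  simpa using this

lemma qq_nonneg (P : Finset ℕ) (hP : ∀ p ∈ P, p.Prime) (p : P) : 0 ≤ qq P p := by unfold qq; positivity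
lemma qq_le (P : Finset ℕ) (hP : ∀ p ∈ P, p.Prime) (p : P) : qq P p ≤ 1 / 2 := by
  have : (2 : ℝ) ≤ p := by exact_mod_cast (hP p p.2).two_le
  unfold qq; gcongr
lemma hh_nonneg (P : Finset ℕ) (hP : ∀ p ∈ P, p.Prime) (p : P) : 0 ≤ qq P p / (1 - qq P p) :=
  div_nonneg (qq_nonneg P hP p) (by linarith [qq_le P hP p])
lemma hh_le (P : Finset ℕ) (hP : ∀ p ∈ P, p.Prime) (p : P) : qq P p / (1 - qq P p) ≤ 1 := by
  rw [div_le_one (by linarith [qq_le P hP p])]; linarith [qq_le P hP p]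
lemma empty_SS (P : Finset ℕ) (hP : ∀ p ∈ P, p.Prime) (R : ℕ) (hR : 1 ≤ R) : ∅ ∈ SS P R := by simp [SS, hR]
lemma SS_down (P : Finset ℕ) (hP : ∀ p ∈ P, p.Prime) (R : ℕ) : ∀ l ∈ SS P R, ∀ l' ⊆ l, l' ∈ SS P R := by
  intro l hl l' h
  simp only [SS, mem_filter, mem_univ, true_and] at hl ⊢
  exact (prod_le_prod_of_subset_of_one_le' h fun p _ _ => (hP p p.2).one_le).trans hl
lemma one_le_Ls (P : Finset ℕ) (hP : ∀ p ∈ P, p.Prime) (R : ℕ) (hR : 1 ≤ R) : 1 ≤ Ls P R :=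
  one_le_Lc _ _ (hh_nonneg P hP) (empty_SS P hP R hR)
lemma Ls_le (P : Finset ℕ) (hP : ∀ p ∈ P, p.Prime) (R : ℕ) : Ls P R ≤ Real.exp (2 * ∑ p, qq P p) :=
  Lc_le _ _ (qq_nonneg P hP) (qq_le P hP)
lemma VV_pos (P : Finset ℕ) (hP : ∀ p ∈ P, p.Prime) : 0 < VV P := prod_pos fun p _ => by linarith [qq_le P hP p]
lemma VV_inv_le (P : Finset ℕ) (hP : ∀ p ∈ P, p.Prime) : 1 / VV P ≤ Real.exp (2 * ∑ p, qq P p) := by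
  unfold VV
  rw [one_div, ← prod_inv_distrib, mul_sum]
  apply prod_le_exp
  · intro p; have := qq_le P hP p; exact inv_nonneg.2 (by linarith)
  · intro p; have := qq_le P hP p; have h0 := qq_nonneg P hP p
    rw [inv_le_iff_one_le_mul₀ (by linarith)]; nlinarith

lemma nt_nonneg (P1 P2 : Finset ℕ) (h1 : ∀ p ∈ P1, p.Prime) (h2 : ∀ p ∈ P2, p.Prime) (r R : ℕ) (hR : 1 ≤ R) (m : ℤ) :
    0 ≤ nt P1 P2 r R m := by
  have := one_le_Ls P2 h2 R hR
  exact mul_nonneg (div_nonneg (by linarith) (VV_pos P1 h1).le) (mul_nonneg (Bf_nonneg _ _) (sq_nonneg _))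

lemma GG_exp (P1 P2 : Finset ℕ) (r R : ℕ) (e : P1 ⊕ P2 → Bool) :
    GG P1 P2 r R e = ∑ k ∈ (univ.filter fun s : Finset P1 => s.card ≤ 2 * r) ×ˢ SS P2 R ×ˢ SS P2 R,
      (-1) ^ k.1.card / (Ls P2 R * Ls P2 R) * ∏ p, Sum.elim (fun p b => if p ∈ k.1 then bi b else 1)
        (fun p b => (if p ∈ k.2.1 then ph (fun p => qq P2 p / (1 - qq P2 p)) p b else 1) *
          (if p ∈ k.2.2 then ph (fun p => qq P2 p / (1 - qq P2 p)) p b else 1)) p (e p) := by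
  unfold GG Bf Xf
  change _ * (_ / Ls P2 R) ^ 2 = _
  rw [div_pow, pow_two, sum_mul_sum, ← sum_product', sum_div, sum_mul_sum, ← sum_product']
  apply sum_congr rfl
  intro k _
  rw [Fintype.prod_sum_type]
  simp only [Sum.elim_inl, Sum.elim_inr, prod_mul_distrib]
  simp only [prod_ite_mem, univ_inter]
  ring

lemma sum_split {π₁ π₂ T : Type*} (i0 : Fintype (π₁ ⊕ π₂ → T)) (i1 : Fintype (π₁ → T)) (i2 : Fintype (π₂ → T))
    (F1 : (π₁ → T) → ℝ) (F2 : (π₂ → T) → ℝ) :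
    ∑ J : π₁ ⊕ π₂ → T, F1 (fun p => J (Sum.inl p)) * F2 (fun p => J (Sum.inr p)) = (∑ J, F1 J) * ∑ J, F2 J := by
  rw [← (Equiv.sumArrowEquivProdArrow π₁ π₂ T).symm.sum_comp, sum_mul_sum, ← Fintype.sum_prod_type']
  rfl

set_option maxHeartbeats 800000 in
lemma nt_box {α : Type} [Fintype α] {n : ℕ} (P1 P2 : Finset ℕ) (h1 : ∀ p ∈ P1, p.Prime) (h2 : ∀ p ∈ P2, p.Prime)
    (hdis : Disjoint P1 P2) (z r R : ℕ) (hR : 1 ≤ R) (hz : ∀ p ∈ P1, p ≤ z) (hz1 : 1 ≤ z)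
    (ht : ∀ p ∈ P1, 2 * Fintype.card α ≤ p)
    (c : α → Fin n → ℤ) (u : α → ℤ)
    (hc1 : ∀ p ∈ P1 ∪ P2, ∀ a, ∃ i, ¬ (p : ℤ) ∣ c a i)
    (hc2 : ∀ p ∈ P1 ∪ P2, ∀ a b, a ≠ b → ∃ i, (¬ (p : ℤ) ∣ c a i) ∧ c b i = 0)
    (H : ℕ) (hH : 0 < H) (t : ℕ) (htt : t = Fintype.card α) (M : ℕ) (hM : M = z ^ (2 * r) * (R * R)) (ε₁ ε₂ : ℝ)
    (hε₁ : (Real.exp (2 * t ^ 2 * ∑ p, qq P1 p * qq P1 p) - 1) + t *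
      Real.exp (-(2 * r : ℝ) + (6 ^ t * t + 2 * t) * ∑ p, qq P1 p) ≤ ε₁)
    (hε₂ : c4 t * Real.exp ((2 * t + c4 t) * ∑ p, qq P2 p) * ∑ p, qq P2 p * qq P2 p ≤ ε₂) :
    |(av fun h : Fin n → Fin H => ∏ a, nt P1 P2 r R ((∑ i, c a i * ((h i : ℕ) : ℤ)) + u a)) - 1| ≤
      ε₁ + ε₂ + ε₁ * ε₂ + Real.exp (2 * ∑ p, qq P2 p + 2 * ∑ p, qq P1 p) ^ t * ((M : ℝ) ^ t * (n * (2 * (M : ℝ) ^ t / H))) := by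
  subst htt
  set t := Fintype.card α
  set hh : P2 → ℝ := fun p => qq P2 p / (1 - qq P2 p) with hhh
  have hL1 := one_le_Ls P2 h2 R hR
  have hV := VV_pos P1 h1
  have fact : ∀ p, Fact (prr P1 P2 p).Prime := by
    rintro (p | p)
    · exact ⟨h1 p p.2⟩
    · exact ⟨h2 p p.2⟩
  have hinj : Function.Injective (prr P1 P2) := by
    rintro (p | p) (q | q) h
    · exact congrArg _ (Subtype.ext h)
    · exact absurd (show (p : ℕ) = q from h) (fun h => (Finset.disjoint_left.1 hdis p.2) (h ▸ q.2))
    · exact absurd (show (p : ℕ) = q from h) (fun h => (Finset.disjoint_left.1 hdis q.2) (h ▸ p.2))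
    · exact congrArg _ (Subtype.ext h)
  have hs : ∀ s ∈ (univ.filter fun s : Finset P1 => s.card ≤ 2 * r), ∏ p ∈ s, (p : ℕ) ≤ z ^ (2 * r) := by
    intro s hs
    simp only [mem_filter, mem_univ, true_and] at hs
    calc ∏ p ∈ s, (p : ℕ) ≤ z ^ s.card := prod_le_pow_card _ _ _ fun p _ => hz p p.2
      _ ≤ _ := Nat.pow_le_pow_right hz1 hs
  have hl : ∀ l ∈ SS P2 R, ∏ p ∈ l, (p : ℕ) ≤ R := by
    intro l hl; simpa [SS] using hl
  have key := corr_abs (prr P1 P2) hinj ((univ.filter fun s : Finset P1 => s.card ≤ 2 * r) ×ˢ SS P2 R ×ˢ SS P2 R)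
    (fun k => (-1) ^ k.1.card / (Ls P2 R * Ls P2 R)) (by
      intro k
      rw [abs_div, abs_pow, abs_neg, abs_one, one_pow, abs_of_pos (by positivity), div_le_one (by positivity)]
      nlinarith)
    (fun k p b => Sum.elim (fun p b => if p ∈ k.1 then bi b else 1)
        (fun p b => (if p ∈ k.2.1 then ph hh p b else 1) * (if p ∈ k.2.2 then ph hh p b else 1)) p b) (by
      have hph : ∀ p b, |ph hh p b| ≤ 1 := by
        intro p b; unfold ph; split_ifs
        · simp
        · rw [abs_of_nonneg (hh_nonneg P2 h2 p)]; exact hh_le P2 h2 p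
      rintro k (p | p) b
      · simp only [Sum.elim_inl]; split_ifs
        · rw [abs_of_nonneg (bi_nonneg b)]; exact bi_le_one b
        · simp
      · simp only [Sum.elim_inr]
        have : ∀ l : Finset P2, |if p ∈ l then ph hh p b else 1| ≤ 1 := by
          intro l; split_ifs
          · exact hph p b
          · simp
        rw [abs_mul]
        exact mul_le_one₀ (this _) (abs_nonneg _) (this _))
    (fun k => k.1.disjSum (k.2.1 ∪ k.2.2)) (by
      rintro k (p | p) hp b
      · simp only [inl_mem_disjSum] at hp; simp [hp]
      · simp only [inr_mem_disjSum, mem_union, not_or] at hp; simp [hp]) M (by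
      intro k hk
      simp only [mem_product] at hk
      rw [prod_disjSum, hM]
      apply Nat.mul_le_mul (hs _ hk.1)
      refine le_trans ?_ (Nat.mul_le_mul (hl _ hk.2.1) (hl _ hk.2.2))
      rw [← prod_union_inter]
      exact Nat.le_mul_of_pos_right _ (Finset.one_le_prod' fun p _ => (fact (Sum.inr p)).out.one_le)) (by
      rw [card_product, card_product, hM]
      exact Nat.mul_le_mul (card_le_of_prod P1 h1 _ _ hs) (Nat.mul_le_mul (card_le_of_prod P2 h2 _ _ hl)
        (card_le_of_prod P2 h2 _ _ hl)))
    (GG P1 P2 r R) (GG_exp P1 P2 r R) c u H hH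
  have : ∀ p, NeZero (prr P1 P2 p) := fun p => ⟨(fact p).out.ne_zero⟩
  have f1 : ∀ p : P1, Fact (p : ℕ).Prime := fun p => ⟨h1 p p.2⟩
  have f2 : ∀ p : P2, Fact (p : ℕ).Prime := fun p => ⟨h2 p p.2⟩
  have : ∀ p : P1, NeZero (p : ℕ) := fun p => ⟨(f1 p).out.ne_zero⟩
  have : ∀ p : P2, NeZero (p : ℕ) := fun p => ⟨(f2 p).out.ne_zero⟩
  set m1 : P1 → (α → Bool) → ℝ := fun p => mu c u (p : ℕ) with hm1
  set m2 : P2 → (α → Bool) → ℝ := fun p => mu c u (p : ℕ) with hm2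
  have esplit : ∀ i : Fintype (P1 ⊕ P2 → α → Bool), ∑ J ∈ @univ _ i, (∏ a, GG P1 P2 r R (fun p => J p a)) * ∏ p, mu c u (prr P1 P2 p) (J p)
      = E1 r m1 * E2 (SS P2 R) hh m2 := by
    intro i
    unfold E1 E2
    refine Eq.trans (sum_congr rfl fun J _ => ?_) (sum_split (π₁ := P1) (π₂ := P2) (T := α → Bool) i _ _
      (fun J1 => (∏ a, Bf r (fun p => J1 p a)) * ∏ p, m1 p (J1 p))
      (fun J2 => (∏ a, Xf (SS P2 R) hh (fun p => J2 p a) ^ 2) * ∏ p, m2 p (J2 p)))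
    rw [Fintype.prod_sum_type]
    simp only [GG, prod_mul_distrib]
    change _ * ((∏ p, m1 p (J (Sum.inl p))) * ∏ p, m2 p (J (Sum.inr p))) = _
    ring
  have hPL : ∀ p ∈ P1 ∪ P2, ∀ [Fact p.Prime], PL (1 / (p : ℝ)) (mu c u p) := by
    intro p hp _
    apply mu_PL
    · intro a; obtain ⟨i, hi⟩ := hc1 p hp a
      exact ⟨i, by rwa [Ne, ZMod.intCast_zmod_eq_zero_iff_dvd]⟩
    · intro a b hab; obtain ⟨i, hi, hi2⟩ := hc2 p hp a b hab
      exact ⟨i, by rwa [Ne, ZMod.intCast_zmod_eq_zero_iff_dvd], by simp [hi2]⟩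
  have r1 := E1_rel r (qq P1) m1 (fun p => hPL p (mem_union_left _ p.2)) (qq_nonneg P1 h1) (qq_le P1 h1) (by
    intro p
    have : (2 * (t : ℝ)) ≤ p := by exact_mod_cast ht p p.2
    have h0 : (0 : ℝ) < p := by exact_mod_cast (h1 p p.2).pos
    change (t : ℝ) * (1 / p) ≤ 1 / 2
    rw [mul_one_div, div_le_iff₀ h0]; linarith)
  have r2 := E2_rel (SS P2 R) (empty_SS P2 h2 R hR) (SS_down P2 h2 R) (qq P2) m2
    (fun p => hPL p (mem_union_right _ p.2)) (qq_nonneg P2 h2) (qq_le P2 h2)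
  have r1' := r1.trans hε₁
  have r2' := r2.trans hε₂
  clear r1 r2 hε₁ hε₂
  change |E1 r m1 / VV P1 ^ t - 1| ≤ ε₁ at r1'
  change |E2 (SS P2 R) hh m2 * Ls P2 R ^ t - 1| ≤ ε₂ at r2'
  rw [esplit] at key
  have eav : (av fun h : Fin n → Fin H => ∏ a, nt P1 P2 r R ((∑ i, c a i * ((h i : ℕ) : ℤ)) + u a)) =
      (Ls P2 R / VV P1) ^ t * av fun h : Fin n → Fin H => ∏ a, GG P1 P2 r R
        (fun p => decide ((prr P1 P2 p : ℤ) ∣ (∑ i, c a i * ((h i : ℕ) : ℤ)) + u a)) := by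
    rw [← av_mul_left]
    apply av_congr; intro h
    unfold nt
    rw [prod_mul_distrib, prod_const, card_univ]
  set A := E1 r m1 / VV P1 ^ t
  set B := E2 (SS P2 R) hh m2 * Ls P2 R ^ t
  have hAB : (Ls P2 R / VV P1) ^ t * (E1 r m1 * E2 (SS P2 R) hh m2) = A * B := by
    simp only [A, B]; rw [div_pow]; ring
  rw [eav]
  set X := av fun h : Fin n → Fin H => ∏ a, GG P1 P2 r R
        (fun p => decide ((prr P1 P2 p : ℤ) ∣ (∑ i, c a i * ((h i : ℕ) : ℤ)) + u a))
  have e3 : (Ls P2 R / VV P1) ^ t * X - 1 = (A - 1) + (B - 1) + (A - 1) * (B - 1) +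
      (Ls P2 R / VV P1) ^ t * (X - E1 r m1 * E2 (SS P2 R) hh m2) := by
    linear_combination -hAB
  rw [e3]
  refine (abs_add_le _ _).trans (add_le_add ?_ ?_)
  · refine (abs_add_le _ _).trans (add_le_add ((abs_add_le _ _).trans (add_le_add r1' r2')) ?_)
    rw [abs_mul]
    exact mul_le_mul r1' r2' (abs_nonneg _) ((abs_nonneg _).trans r1')
  · have hd : 0 ≤ Ls P2 R / VV P1 := div_nonneg (by linarith) hV.le
    rw [abs_mul, abs_of_nonneg (pow_nonneg hd t)]
    apply mul_le_mul _ key (abs_nonneg _) (by positivity)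
    apply pow_le_pow_left₀ hd
    rw [Real.exp_add, div_eq_mul_one_div]
    exact mul_le_mul (Ls_le P2 h2 R) (VV_inv_le P1 h1) (by positivity) (by positivity)

end GT
namespace GT

/-- primes in (a,b] -/
noncomputable def prs (a b : ℕ) : Finset ℕ := (Ioc a b).filter Nat.Prime

lemma prs_prime (a b : ℕ) : ∀ p ∈ prs a b, p.Prime := fun p hp => (mem_filter.1 hp).2
lemma prs_gt {a b p : ℕ} (hp : p ∈ prs a b) : a < p := (mem_Ioc.1 (mem_filter.1 hp).1).1
lemma prs_le {a b p : ℕ} (hp : p ∈ prs a b) : p ≤ b := (mem_Ioc.1 (mem_filter.1 hp).1).2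

lemma qq_sum (P : Finset ℕ) : ∑ p, qq P p = ∑ p ∈ P, 1 / (p : ℝ) :=
  sum_coe_sort P (fun p => 1 / (p : ℝ))

lemma harm_le (n : ℕ) : ∑ i ∈ Icc 1 n, 1 / (i : ℝ) ≤ 1 + Real.log n := by
  have := harmonic_le_one_add_log n
  rw [harmonic_eq_sum_Icc] at this
  push_cast at this
  simpa using this

lemma prs_sum_le (a b : ℕ) : ∑ p, qq (prs a b) p ≤ 1 + Real.log b := by
  rw [qq_sum]
  refine le_trans (sum_le_sum_of_subset_of_nonneg ?_ fun _ _ _ => by positivity) (harm_le b)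
  intro p hp
  rw [mem_Icc]
  exact ⟨(prs_prime a b p hp).one_le, prs_le hp⟩

lemma prs_sq_le (a b : ℕ) : ∑ p, qq (prs a b) p * qq (prs a b) p ≤ 2 / (a + 1) := by
  have e : ∑ p, qq (prs a b) p * qq (prs a b) p = ∑ p ∈ prs a b, ((p : ℝ) ^ 2)⁻¹ := by
    rw [← sum_coe_sort (prs a b) (fun p => ((p : ℝ) ^ 2)⁻¹)]
    apply sum_congr rfl; intro p _; unfold qq; rw [pow_two, mul_inv, one_div]
  rw [e]
  refine le_trans (sum_le_sum_of_subset_of_nonneg ?_ fun _ _ _ => by positivity) (sum_Ioo_inv_sq_le a (b + 1))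
  intro p hp
  rw [mem_Ioo]
  exact ⟨prs_gt hp, Nat.lt_succ_of_le (prs_le hp)⟩

lemma block_le (j : ℕ) (hj : 1 ≤ j) (P : Finset ℕ) (hP : ∀ p ∈ P, p.Prime ∧ Real.exp j < p ∧ (p : ℝ) ≤ Real.exp (j + 1)) :
    ∑ p ∈ P, 1 / (p : ℝ) ≤ 4 / j := by
  have hj0 : (0 : ℝ) < j := by exact_mod_cast hj
  have h1 : ∀ p ∈ P, 1 / (p : ℝ) ≤ Real.log p / (j * Real.exp j) := by
    intro p hp
    obtain ⟨a, b, c⟩ := hP p hp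
    have hp0 : (0 : ℝ) < p := lt_trans (Real.exp_pos _) b
    have : (j : ℝ) ≤ Real.log p := by
      rw [Real.le_log_iff_exp_le hp0]; exact b.le
    rw [div_le_div_iff₀ hp0 (by positivity), one_mul]
    exact mul_le_mul this b.le (Real.exp_pos _).le (by linarith)
  have h2 : ∑ p ∈ P, Real.log p ≤ Chebyshev.theta (Real.exp (j + 1)) := by
    unfold Chebyshev.theta
    apply sum_le_sum_of_subset_of_nonneg
    · intro p hp
      obtain ⟨a, b, c⟩ := hP p hp
      rw [mem_filter, mem_Ioc]
      exact ⟨⟨a.pos, Nat.le_floor c⟩, a⟩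
    · intro p hp _
      exact Real.log_natCast_nonneg p
  have h3 := Chebyshev.theta_le_log4_mul_x (Real.exp_pos ((j : ℝ) + 1)).le
  refine (sum_le_sum h1).trans ?_
  rw [← sum_div, div_le_div_iff₀ (by positivity) hj0]
  have h4 : Real.log 4 ≤ 1.4 := by
    have : Real.log 4 = 2 * Real.log 2 := by
      rw [show (4 : ℝ) = 2 ^ 2 by norm_num, Real.log_pow]; norm_num
    rw [this]; linarith [Real.log_two_lt_d9]
  have h5 : Real.exp 1 ≤ 2.8 := by linarith [Real.exp_one_lt_d9]
  have h6 : Real.log 4 * Real.exp 1 ≤ 4 := by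
    have := mul_le_mul h4 h5 (Real.exp_pos _).le (by norm_num)
    linarith
  calc (∑ p ∈ P, Real.log p) * j ≤ (Real.log 4 * Real.exp (j + 1)) * j := by
        apply mul_le_mul_of_nonneg_right (h2.trans h3) hj0.le
    _ = (Real.log 4 * Real.exp 1) * (j * Real.exp j) := by rw [Real.exp_add]; ring
    _ ≤ _ := by gcongr

lemma prs_big_le (y Y : ℕ) (hy : 1 ≤ y) (P : Finset ℕ) (hP : ∀ p ∈ P, p.Prime ∧ Real.exp y < p ∧ (p : ℝ) ≤ Real.exp Y) :
    ∑ p ∈ P, 1 / (p : ℝ) ≤ 4 * (1 + Real.log Y) := by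
  have hmap : ∀ p ∈ P, ⌈Real.log p⌉₊ - 1 ∈ Icc 1 Y ∧ Real.exp ((⌈Real.log p⌉₊ - 1 : ℕ) : ℝ) < p ∧
      (p : ℝ) ≤ Real.exp (((⌈Real.log p⌉₊ - 1 : ℕ) : ℝ) + 1) := by
    intro p hp
    obtain ⟨a, b, c⟩ := hP p hp
    have hp0 : (0 : ℝ) < p := lt_trans (Real.exp_pos _) b
    have h1 : (y : ℝ) < Real.log p := by rwa [Real.lt_log_iff_exp_lt hp0]
    have h2 : Real.log p ≤ Y := by rwa [Real.log_le_iff_le_exp hp0]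
    have h3 : y < ⌈Real.log p⌉₊ := Nat.lt_ceil.2 h1
    have h4 : ⌈Real.log p⌉₊ ≤ Y := Nat.ceil_le.2 h2
    have h5 : ((⌈Real.log p⌉₊ - 1 : ℕ) : ℝ) + 1 = ⌈Real.log p⌉₊ := by
      rw [Nat.cast_sub (by omega)]; simp
    refine ⟨mem_Icc.2 ⟨by omega, by omega⟩, ?_, ?_⟩
    · rw [← Real.lt_log_iff_exp_lt hp0]
      exact Nat.lt_ceil.1 (by omega)
    · rw [h5, ← Real.log_le_iff_le_exp hp0]; exact Nat.le_ceil _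
  rw [← sum_fiberwise_of_maps_to (fun p hp => (hmap p hp).1)]
  calc _ ≤ ∑ j ∈ Icc 1 Y, 4 * (1 / (j : ℝ)) := by
        apply sum_le_sum; intro j hj
        rw [mul_one_div]
        apply block_le j (mem_Icc.1 hj).1
        intro p hp
        rw [mem_filter] at hp
        obtain ⟨h1, rfl⟩ := hp
        exact ⟨(hP p h1).1, (hmap p h1).2⟩
    _ ≤ _ := by rw [← mul_sum]; gcongr; exact harm_le Y

/-- parameters -/
noncomputable def zz (y : ℕ) : ℕ := ⌊Real.exp y⌋₊
noncomputable def RR (D y : ℕ) : ℕ := ⌊Real.exp ((y : ℝ) ^ 3 / D)⌋₊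

lemma zz_le (y : ℕ) : (zz y : ℝ) ≤ Real.exp y := Nat.floor_le (Real.exp_pos _).le
lemma zz_pos (y : ℕ) : 1 ≤ zz y := by
  apply Nat.le_floor; simp
lemma RR_le (D y : ℕ) : (RR D y : ℝ) ≤ Real.exp ((y : ℝ) ^ 3 / D) := Nat.floor_le (Real.exp_pos _).le
lemma RR_pos (D y : ℕ) : 1 ≤ RR D y := by
  apply Nat.le_floor; rw [Nat.cast_one]; apply Real.one_le_exp; positivity

lemma P2_sum (D y : ℕ) (hD : 1 ≤ D) (hy : 1 ≤ y) : ∑ p, qq (prs (zz y) (RR D y)) p ≤ 4 + 12 * Real.log y := by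
  rw [qq_sum]
  have := prs_big_le y (y ^ 3) hy (prs (zz y) (RR D y)) (by
    intro p hp
    refine ⟨prs_prime _ _ p hp, ?_, ?_⟩
    · exact (Nat.floor_lt (Real.exp_pos _).le).1 (prs_gt hp)
    · have : (p : ℝ) ≤ RR D y := by exact_mod_cast prs_le hp
      refine this.trans ((RR_le D y).trans ?_)
      rw [Real.exp_le_exp]; push_cast
      apply div_le_self (by positivity)
      exact_mod_cast hD)
  refine this.trans (le_of_eq ?_)
  push_cast
  rw [Real.log_pow]; push_cast; ring

lemma P1_sum (w y : ℕ) : ∑ p, qq (prs w (zz y)) p ≤ 1 + y := by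
  refine (prs_sum_le _ _).trans ?_
  have h0 : (0 : ℝ) < zz y := by exact_mod_cast zz_pos y
  have : Real.log (zz y) ≤ y := by rw [Real.log_le_iff_le_exp h0]; exact zz_le y
  linarith

/-- the small-prime error -/
lemma err1 (t K : ℕ) (hK : 6 ^ t * t + 2 * t ≤ K) (hK1 : 1 ≤ K) (ε : ℝ) (hε : 0 < ε) :
    ∃ w₀ : ℕ, ∀ w ≥ w₀, ∀ᶠ y : ℕ in atTop,
     (Real.exp (2 * t ^ 2 * ∑ p, qq (prs w (zz y)) p * qq (prs w (zz y)) p) - 1) + t *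
      Real.exp (-(2 * (K * y : ℕ) : ℝ) + (6 ^ t * t + 2 * t) * ∑ p, qq (prs w (zz y)) p) ≤ ε := by
  have T1 : Tendsto (fun w : ℕ => Real.exp (2 * (t : ℝ) ^ 2 * (2 * (1 / ((w : ℝ) + 1)))) - 1) atTop (𝓝 (Real.exp (2 * (t : ℝ) ^ 2 * (2 * 0)) - 1)) :=
    ((Real.continuous_exp.tendsto _).comp ((tendsto_one_div_add_atTop_nhds_zero_nat.const_mul _).const_mul _)).sub_const _
  simp only [mul_zero, Real.exp_zero, sub_self] at T1
  obtain ⟨w₀, hw₀⟩ := eventually_atTop.1 (T1.eventually (ge_mem_nhds (half_pos hε)))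
  refine ⟨w₀, fun w hw => ?_⟩
  have T2 : Tendsto (fun y : ℕ => (t : ℝ) * Real.exp (K - K * y)) atTop (𝓝 (t * 0)) := by
    apply Tendsto.const_mul
    apply Real.tendsto_exp_atBot.comp
    apply tendsto_atBot_add_const_left atTop (K : ℝ) (f := fun y : ℕ => -((K : ℝ) * y))
    apply tendsto_neg_atTop_atBot.comp
    exact tendsto_natCast_atTop_atTop.const_mul_atTop (by exact_mod_cast hK1)
  rw [mul_zero] at T2
  filter_upwards [T2.eventually (ge_mem_nhds (half_pos hε))] with y hy
  have k1 := hw₀ w hw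
  have k2 := prs_sq_le w (zz y)
  have k3 := P1_sum w y
  have hK' : (6 : ℝ) ^ t * t + 2 * t ≤ K := by exact_mod_cast hK
  have k4 : Real.exp (2 * (t : ℝ) ^ 2 * ∑ p, qq (prs w (zz y)) p * qq (prs w (zz y)) p) ≤ Real.exp (2 * (t : ℝ) ^ 2 * (2 * (1 / ((w : ℝ) + 1)))) := by
    rw [Real.exp_le_exp]
    rw [mul_one_div]; gcongr
  have k5 : (t : ℝ) * Real.exp (-(2 * (K * y : ℕ) : ℝ) + (6 ^ t * t + 2 * t) * ∑ p, qq (prs w (zz y)) p) ≤ t * Real.exp (K - K * y) := by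
    gcongr
    have : ((6 : ℝ) ^ t * t + 2 * t) * ∑ p, qq (prs w (zz y)) p ≤ K * (1 + y) :=
      mul_le_mul hK' k3 (sum_nonneg fun p _ => qq_nonneg _ (prs_prime _ _) p) (by positivity)
    push_cast; linarith
  linarith

lemma log_small (η : ℝ) (hη : 0 < η) (C : ℝ) : ∀ᶠ y : ℕ in atTop, C + 12 * Real.log y ≤ η * y := by
  have h1 := (Real.isLittleO_log_id_atTop.comp_tendsto tendsto_natCast_atTop_atTop).bound (c := η / 24) (by positivity)
  have h2 : ∀ᶠ y : ℕ in atTop, C ≤ η / 2 * y :=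
    (tendsto_natCast_atTop_atTop.const_mul_atTop (by positivity : 0 < η / 2)).eventually_ge_atTop C
  filter_upwards [h1, h2] with y h1 h2
  simp only [Function.comp, id, Real.norm_eq_abs, Nat.abs_cast] at h1
  have := (le_abs_self _).trans h1
  linarith

lemma err2 (t D : ℕ) (hD : 1 ≤ D) (ε : ℝ) (hε : 0 < ε) : ∀ᶠ y : ℕ in atTop,
    c4 t * Real.exp ((2 * t + c4 t) * ∑ p, qq (prs (zz y) (RR D y)) p) *
      ∑ p, qq (prs (zz y) (RR D y)) p * qq (prs (zz y) (RR D y)) p ≤ ε := by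
  have hc := c4_nonneg t
  set A := 2 * (t : ℝ) + c4 t
  have hA : 0 ≤ A := by positivity
  have T : Tendsto (fun y : ℕ => c4 t * 2 * Real.exp (-(1 / 2 * (y : ℝ)))) atTop (𝓝 (c4 t * 2 * 0)) := by
    apply Tendsto.const_mul
    apply Real.tendsto_exp_atBot.comp
    apply tendsto_neg_atTop_atBot.comp
    exact tendsto_natCast_atTop_atTop.const_mul_atTop (by norm_num)
  rw [mul_zero] at T
  filter_upwards [T.eventually (ge_mem_nhds hε), log_small (1 / (2 * (A + 1))) (by positivity) 4, eventually_ge_atTop 1] with y h1 h2 h3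
  have k1 := P2_sum D y hD h3
  have k2 := prs_sq_le (zz y) (RR D y)
  refine le_trans ?_ h1
  have k3 : (2 : ℝ) / (zz y + 1) ≤ 2 * Real.exp (-y) := by
    rw [Real.exp_neg, ← div_eq_mul_inv]
    apply div_le_div_of_nonneg_left (by norm_num) (Real.exp_pos _)
    exact (Nat.lt_floor_add_one _).le
  have k4 : A * ∑ p, qq (prs (zz y) (RR D y)) p ≤ 1 / 2 * y := by
    calc _ ≤ A * (1 / (2 * (A + 1)) * y) := by gcongr; linarith
      _ = (A / (A + 1)) * (1 / 2 * y) := by field_simp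
      _ ≤ 1 * (1 / 2 * y) := by
          gcongr; rw [div_le_one (by linarith)]; linarith
      _ = _ := one_mul _
  calc _ ≤ c4 t * Real.exp (1 / 2 * y) * (2 * Real.exp (-y)) := by
        gcongr
        · exact sum_nonneg fun p _ => mul_self_nonneg _
        · exact k2.trans k3
    _ = c4 t * 2 * (Real.exp (1 / 2 * y) * Real.exp (-y)) := by ring
    _ = _ := by rw [← Real.exp_add]; ring_nf

lemma err3 (t n K D : ℕ) (hD : 16 * t + 1 ≤ D) (ε : ℝ) (hε : 0 < ε) : ∀ᶠ y : ℕ in atTop, ∀ w H M : ℕ,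
    Real.exp ((y : ℝ) ^ 3 / 2) ≤ 2 * H → M = zz y ^ (2 * (K * y)) * (RR D y * RR D y) →
    Real.exp (2 * ∑ p, qq (prs (zz y) (RR D y)) p + 2 * ∑ p, qq (prs w (zz y)) p) ^ t *
      ((M : ℝ) ^ t * (n * (2 * (M : ℝ) ^ t / H))) ≤ ε := by
  have T : Tendsto (fun y : ℕ => 4 * (n : ℝ) * Real.exp (-((y : ℝ) ^ 2 * (1 / 4 * y + (-(6 * t + 4 * t * K)))))) atTop (𝓝 (4 * n * 0)) := by
    apply Tendsto.const_mul
    apply Real.tendsto_exp_atBot.comp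
    apply tendsto_neg_atTop_atBot.comp
    apply Tendsto.atTop_mul_atTop₀
    · exact (tendsto_pow_atTop two_ne_zero).comp tendsto_natCast_atTop_atTop
    · apply tendsto_atTop_add_const_right
      exact tendsto_natCast_atTop_atTop.const_mul_atTop (by norm_num)
  rw [mul_zero] at T
  filter_upwards [T.eventually (ge_mem_nhds hε), log_small 1 one_pos 4, eventually_ge_atTop 1] with y h1 h2 h3 w H M hH hM
  have k1 := P2_sum D y (by omega) h3
  have k2 := P1_sum w y
  have hy1 : (1 : ℝ) ≤ y := by exact_mod_cast h3
  have hH0 : (0 : ℝ) < H := by have := Real.exp_pos ((y : ℝ) ^ 3 / 2); linarith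
  refine le_trans ?_ h1
  have hM' : (M : ℝ) ≤ Real.exp (2 * K * y ^ 2 + 2 * (y ^ 3 / D)) := by
    rw [hM]; push_cast
    have a1 : (zz y : ℝ) ^ (2 * (K * y)) ≤ Real.exp (2 * K * y ^ 2) := by
      refine (pow_le_pow_left₀ (by positivity) (zz_le y) _).trans (le_of_eq ?_)
      rw [← Real.exp_nat_mul]; push_cast; ring_nf
    have a2 : (RR D y : ℝ) * RR D y ≤ Real.exp (2 * (y ^ 3 / D)) := by
      rw [two_mul, Real.exp_add]
      exact mul_le_mul (RR_le D y) (RR_le D y) (by positivity) (Real.exp_pos _).le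
    rw [Real.exp_add]
    exact mul_le_mul a1 a2 (by positivity) (Real.exp_pos _).le
  have hMt : (M : ℝ) ^ t ≤ Real.exp (t * (2 * K * y ^ 2 + 2 * (y ^ 3 / D))) := by
    rw [Real.exp_nat_mul]; exact pow_le_pow_left₀ (by positivity) hM' t
  have hE : Real.exp (2 * ∑ p, qq (prs (zz y) (RR D y)) p + 2 * ∑ p, qq (prs w (zz y)) p) ^ t ≤
      Real.exp (t * (6 * y ^ 2)) := by
    rw [← Real.exp_nat_mul, Real.exp_le_exp]
    gcongr
    nlinarith
  have hHi : 1 / (H : ℝ) ≤ 2 * Real.exp (-((y : ℝ) ^ 3 / 2)) := by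
    rw [Real.exp_neg, ← div_eq_mul_inv, div_le_div_iff₀ hH0 (Real.exp_pos _)]; linarith
  have hDt : (t : ℝ) * (y ^ 3 / D) ≤ y ^ 3 / 16 := by
    have hD0 : (0 : ℝ) < D := by
      have : 0 < D := by omega
      exact_mod_cast this
    have : 16 * (t : ℝ) + 1 ≤ D := by exact_mod_cast hD
    rw [mul_div_assoc', div_le_div_iff₀ hD0 (by norm_num)]
    have : 0 ≤ (y : ℝ) ^ 3 := by positivity
    nlinarith
  calc _ = Real.exp (2 * ∑ p, qq (prs (zz y) (RR D y)) p + 2 * ∑ p, qq (prs w (zz y)) p) ^ t *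
      ((M : ℝ) ^ t * (n * (2 * (M : ℝ) ^ t * (1 / H)))) := by ring
    _ ≤ Real.exp (t * (6 * y ^ 2)) * (Real.exp (t * (2 * K * y ^ 2 + 2 * (y ^ 3 / D))) *
        (n * (2 * Real.exp (t * (2 * K * y ^ 2 + 2 * (y ^ 3 / D))) * (2 * Real.exp (-((y : ℝ) ^ 3 / 2)))))) := by
        gcongr
    _ = 4 * n * (Real.exp (t * (6 * y ^ 2)) * Real.exp (t * (2 * K * y ^ 2 + 2 * (y ^ 3 / D))) *
        Real.exp (t * (2 * K * y ^ 2 + 2 * (y ^ 3 / D))) * Real.exp (-((y : ℝ) ^ 3 / 2))) := by ring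
    _ ≤ _ := by
        rw [← Real.exp_add, ← Real.exp_add, ← Real.exp_add]
        gcongr
        nlinarith

/-- box correlation estimate, in asymptotic form -/
theorem box_main (t n K D : ℕ) (hK : 6 ^ t * t + 2 * t ≤ K) (hK1 : 1 ≤ K) (hD : 16 * t + 1 ≤ D) (ε : ℝ) (hε : 0 < ε) :
    ∃ w₀ : ℕ, ∀ w ≥ w₀, ∀ᶠ y : ℕ in atTop, ∀ (α : Type) [Fintype α], Fintype.card α = t →
      ∀ (c : α → Fin n → ℤ) (u : α → ℤ), (∀ p : ℕ, p.Prime → w < p → ∀ a, ∃ i, ¬ (p : ℤ) ∣ c a i) →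
      (∀ p : ℕ, p.Prime → w < p → ∀ a b, a ≠ b → ∃ i, (¬ (p : ℤ) ∣ c a i) ∧ c b i = 0) →
      ∀ H : ℕ, Real.exp ((y : ℝ) ^ 3 / 2) ≤ 2 * H →
      |(av fun h : Fin n → Fin H => ∏ a, nt (prs w (zz y)) (prs (zz y) (RR D y)) (K * y) (RR D y)
        ((∑ i, c a i * ((h i : ℕ) : ℤ)) + u a)) - 1| ≤ ε := by
  obtain ⟨ε', hε', hε1⟩ : ∃ ε' : ℝ, 0 < ε' ∧ ε' + ε' + ε' * ε' + ε' ≤ ε := by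
    refine ⟨min 1 (ε / 4), by positivity, ?_⟩
    have h1 := min_le_left 1 (ε / 4)
    have h2 := min_le_right 1 (ε / 4)
    have h3 : 0 < min 1 (ε / 4) := by positivity
    nlinarith
  obtain ⟨w₀, hw₀⟩ := err1 t K hK hK1 ε' hε'
  refine ⟨max w₀ (2 * t), fun w hw => ?_⟩
  filter_upwards [hw₀ w (le_trans (le_max_left _ _) hw), err2 t D (by omega) ε' hε', err3 t n K D hD ε' hε',
    (Real.tendsto_exp_atTop.comp tendsto_natCast_atTop_atTop).eventually_ge_atTop ((w : ℝ) + 1)] with y h1 h2 h3 h4 α _ hα c u hc1 hc2 H hH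
  have hwz : w ≤ zz y := by
    apply Nat.le_floor; simp only [Function.comp] at h4; linarith
  have hH0 : 0 < H := by
    have := Real.exp_pos ((y : ℝ) ^ 3 / 2)
    have h : (0 : ℝ) < H := by linarith
    exact_mod_cast h
  have hgt : ∀ p ∈ prs w (zz y) ∪ prs (zz y) (RR D y), p.Prime ∧ w < p := by
    intro p hp
    rcases mem_union.1 hp with hp | hp
    · exact ⟨prs_prime _ _ p hp, prs_gt hp⟩
    · exact ⟨prs_prime _ _ p hp, lt_of_le_of_lt hwz (prs_gt hp)⟩
  have key := nt_box (prs w (zz y)) (prs (zz y) (RR D y)) (prs_prime _ _) (prs_prime _ _) (by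
      rw [Finset.disjoint_left]; intro p hp hp'
      have := prs_le hp; have := prs_gt hp'; omega) (zz y) (K * y) (RR D y) (RR_pos D y)
    (fun p hp => prs_le hp) (zz_pos y) (by
      intro p hp
      have := prs_gt hp
      have := le_trans (le_max_right w₀ (2 * t)) hw
      omega) c u (fun p hp => hc1 p (hgt p hp).1 (hgt p hp).2) (fun p hp => hc2 p (hgt p hp).1 (hgt p hp).2)
    H hH0 t hα.symm _ rfl ε' ε' h1 h2
  refine key.trans (le_trans ?_ hε1)
  have := h3 w H _ hH rfl
  linarith

end GT
namespace GT

/-- the completely multiplicative function 1/n -/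
noncomputable def recHom : ℕ →* ℝ where
  toFun n := 1 / (n : ℝ)
  map_one' := by simp
  map_mul' a b := by push_cast; rw [one_div_mul_one_div]

lemma factored_sum_le (s : Finset ℕ) (hs : ∀ p ∈ s, p.Prime) (T : Finset ℕ) (hT : ∀ m ∈ T, m ∈ Nat.factoredNumbers s) :
    ∑ m ∈ T, 1 / (m : ℝ) ≤ ∏ p ∈ s, (1 - 1 / (p : ℝ))⁻¹ := by
  have h := (EulerProduct.summable_and_hasSum_factoredNumbers_prod_filter_prime_geometric (f := recHom) (by
    intro p hp
    change ‖1 / (p : ℝ)‖ < 1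
    have : (1 : ℝ) < p := by exact_mod_cast hp.one_lt
    rw [Real.norm_of_nonneg (by positivity), div_lt_one (by linarith)]; exact this) s).2
  rw [filter_true_of_mem hs] at h
  have h2 := (hasSum_subtype_iff_indicator (f := fun n : ℕ => recHom n) (s := Nat.factoredNumbers s)).1 h
  refine le_trans (le_of_eq ?_) (sum_le_hasSum T (fun i _ => ?_) h2)
  · apply sum_congr rfl; intro m hm
    rw [Set.indicator_of_mem (hT m hm)]; rfl
  · apply Set.indicator_nonneg; intro n _; change 0 ≤ 1 / (n : ℝ); positivity

lemma prod_dvd_of_primes (l : Finset ℕ) (hl : ∀ p ∈ l, p.Prime) (n : ℕ) (h : ∀ p ∈ l, p ∣ n) : ∏ p ∈ l, p ∣ n :=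
  Finset.prod_primes_dvd n (fun p hp => (hl p hp).prime) h

lemma log_le_euler (z R : ℕ) :
    Real.log R ≤ (∏ p ∈ prs 0 z, (1 - 1 / (p : ℝ))⁻¹) * Ls (prs z R) R := by
  set P := prs z R
  have hP := prs_prime z R
  have h1 : Real.log R ≤ ∑ n ∈ Icc 1 R, 1 / (n : ℝ) := by
    have := log_add_one_le_harmonic R
    rw [harmonic_eq_sum_Icc] at this
    push_cast at this
    rcases Nat.eq_zero_or_pos R with h0 | h0
    · subst h0; simp
    refine le_trans (Real.log_le_log (by exact_mod_cast h0) (by linarith : (R : ℝ) ≤ R + 1)) ?_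
    simpa using this
  refine h1.trans ?_
  set ra : ℕ → Finset P := fun n => univ.filter fun p : P => (p : ℕ) ∣ n with hra
  have emap : ∀ l : Finset P, ∏ p ∈ l, (p : ℕ) = ∏ p ∈ l.map (Function.Embedding.subtype _), p := by
    intro l; rw [prod_map]; rfl
  have hdvd : ∀ n, ∏ p ∈ ra n, (p : ℕ) ∣ n := by
    intro n
    rw [emap]
    apply prod_dvd_of_primes
    · intro p hp; rw [Finset.mem_map] at hp; obtain ⟨q, _, rfl⟩ := hp; exact hP q q.2
    · intro p hp; rw [Finset.mem_map] at hp; obtain ⟨q, hq, rfl⟩ := hp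
      simpa [hra] using hq
  have hmaps : ∀ n ∈ Icc 1 R, ra n ∈ SS P R := by
    intro n hn
    rw [mem_Icc] at hn
    simp only [SS, mem_filter, mem_univ, true_and]
    exact (Nat.le_of_dvd (by omega) (hdvd n)).trans hn.2
  rw [← sum_fiberwise_of_maps_to hmaps, Ls, Lc, mul_sum]
  apply sum_le_sum
  intro l hl
  set d := ∏ p ∈ l, (p : ℕ)
  have hd : 0 < d := prod_pos fun p _ => (hP p p.2).pos
  set lm := l.map (Function.Embedding.subtype _) with hlm
  have hlP : ∀ p ∈ lm, p ∈ P := by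
    intro p hp; rw [hlm, Finset.mem_map] at hp; obtain ⟨q, _, rfl⟩ := hp; exact q.2
  set F := (Icc 1 R).filter fun n => ra n = l
  have hF : ∀ n ∈ F, n ≤ R ∧ 1 ≤ n ∧ ra n = l ∧ d ∣ n := by
    intro n hn
    rw [mem_filter, mem_Icc] at hn
    refine ⟨hn.1.2, hn.1.1, hn.2, ?_⟩
    have := hdvd n
    rwa [hn.2] at this
  have e1 : ∑ n ∈ F, 1 / (n : ℝ) = 1 / (d : ℝ) * ∑ m ∈ F.image (fun n => n / d), 1 / (m : ℝ) := by
    rw [sum_image, mul_sum]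
    · apply sum_congr rfl; intro n hn
      rw [one_div_mul_one_div, ← Nat.cast_mul, Nat.mul_div_cancel' (hF n hn).2.2.2]
    · intro a ha b hb h
      have ha' := (hF a ha).2.2.2
      have hb' := (hF b hb).2.2.2
      simp only at h
      rw [← Nat.mul_div_cancel' ha', h, Nat.mul_div_cancel' hb']
  have hdis : Disjoint (prs 0 z) lm := by
    rw [Finset.disjoint_left]; intro p hp hp'
    have := prs_le hp; have := prs_gt (hlP p hp'); omega
  have h2 := factored_sum_le (prs 0 z ∪ lm) (by
    intro p hp
    rcases mem_union.1 hp with hp | hp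
    · exact prs_prime _ _ p hp
    · exact hP p (hlP p hp)) (F.image fun n => n / d) (by
    intro m hm
    rw [mem_image] at hm
    obtain ⟨n, hn, rfl⟩ := hm
    obtain ⟨a1, a2, a3, a4⟩ := hF n hn
    rw [Nat.mem_factoredNumbers']
    intro p hp hpd
    have hpn : p ∣ n := hpd.trans (Nat.div_dvd_of_dvd a4)
    have hpR : p ≤ R := (Nat.le_of_dvd (by omega) hpn).trans a1
    rw [mem_union]
    by_cases hpz : p ≤ z
    · left; simp [prs, hp, hpz, hp.pos]
    · right
      have hpP : p ∈ P := by simp [P, prs, hp, hpR]; omega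
      rw [hlm, Finset.mem_map]
      refine ⟨⟨p, hpP⟩, ?_, rfl⟩
      rw [← a3]; simp [hra, hpn])
  rw [prod_union hdis] at h2
  have e2 : ∏ p ∈ lm, (1 - 1 / (p : ℝ))⁻¹ = ∏ p ∈ l, (1 - qq P p)⁻¹ := by
    rw [hlm, prod_map]; rfl
  have e3 : 1 / (d : ℝ) * ∏ p ∈ l, (1 - qq P p)⁻¹ = ∏ p ∈ l, (qq P p / (1 - qq P p)) := by
    simp only [d, qq]; push_cast
    rw [one_div, ← prod_inv_distrib, ← prod_mul_distrib]
    apply prod_congr rfl; intro p _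
    ring
  change ∑ n ∈ F, 1 / (n : ℝ) ≤ _
  rw [e1, ← e3, ← e2]
  calc _ ≤ 1 / (d : ℝ) * _ := mul_le_mul_of_nonneg_left h2 (by positivity)
    _ = _ := by ring

lemma VV_eq (P : Finset ℕ) : VV P = ∏ p ∈ P, (1 - 1 / (p : ℝ)) := by
  unfold VV; exact prod_coe_sort P (fun p => 1 - 1 / (p : ℝ))

/-- lower bound for the majorant on numbers without prime factors in the sieving range -/
lemma nt_lower (w z r R : ℕ) (hwz : w ≤ z) (hR : 1 ≤ R) (m : ℤ)
    (hm : ∀ p : ℕ, p.Prime → w < p → p ≤ R ∨ p ≤ z → ¬ (p : ℤ) ∣ m) :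
    VV (prs 0 w) * Real.log R ≤ nt (prs w z) (prs z R) r R m := by
  have e1 : nt (prs w z) (prs z R) r R m = Ls (prs z R) R / VV (prs w z) := by
    unfold nt GG
    rw [Bf_zero, Xf_zero _ _ (hh_nonneg _ (prs_prime _ _)) (empty_SS _ (prs_prime _ _) R hR)]
    · ring
    · intro p
      rw [decide_eq_false_iff_not]
      exact hm p (prs_prime _ _ p p.2) (lt_of_le_of_lt hwz (prs_gt p.2)) (Or.inl (prs_le p.2))
    · intro p
      rw [decide_eq_false_iff_not]
      exact hm p (prs_prime _ _ p p.2) (prs_gt p.2) (Or.inr (prs_le p.2))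
  have e2 : prs 0 z = prs 0 w ∪ prs w z := by
    ext p; simp only [prs, mem_union, mem_filter, mem_Ioc]
    constructor
    · rintro ⟨⟨h1, h2⟩, h3⟩
      by_cases h : p ≤ w
      · left; exact ⟨⟨h1, h⟩, h3⟩
      · right; exact ⟨⟨by omega, h2⟩, h3⟩
    · rintro (⟨⟨h1, h2⟩, h3⟩ | ⟨⟨h1, h2⟩, h3⟩)
      · exact ⟨⟨h1, by omega⟩, h3⟩
      · exact ⟨⟨by omega, h2⟩, h3⟩
  have hdis : Disjoint (prs 0 w) (prs w z) := by
    rw [Finset.disjoint_left]; intro p hp hp'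
    have := prs_le hp; have := prs_gt hp'; omega
  have h := log_le_euler z R
  rw [e2, prod_union hdis, prod_inv_distrib, prod_inv_distrib, ← VV_eq, ← VV_eq] at h
  have h1 := VV_pos (prs 0 w) (prs_prime _ _)
  have h2 := VV_pos (prs w z) (prs_prime _ _)
  rw [e1]
  calc _ ≤ VV (prs 0 w) * ((VV (prs 0 w))⁻¹ * (VV (prs w z))⁻¹ * Ls (prs z R) R) := by gcongr
    _ = _ := by field_simp

end GT
namespace GT

/-- restriction of an integer function to residues away from the edges -/
noncomputable def wrap (N Te : ℕ) (g : ℤ → ℝ) (u : ZMod N) : ℝ :=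
  if Te ≤ u.val ∧ u.val + Te < N then g u.val else 0

lemma wrap_nonneg (N Te : ℕ) (g : ℤ → ℝ) (hg : ∀ m, 0 ≤ g m) (u : ZMod N) : 0 ≤ wrap N Te g u := by
  unfold wrap; split_ifs
  · exact hg _
  · exact le_rfl

lemma val_add_int (N : ℕ) [NeZero N] (u : ZMod N) (m : ℤ) : ∃ q : ℤ, ((u + (m : ZMod N)).val : ℤ) = u.val + m + N * q := by
  have h : (((u + (m : ZMod N)).val : ℤ) : ZMod N) = ((u.val + m : ℤ) : ZMod N) := by
    push_cast; rw [ZMod.natCast_zmod_val, ZMod.natCast_zmod_val]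
  rw [ZMod.intCast_eq_intCast_iff_dvd_sub] at h
  obtain ⟨q, hq⟩ := h
  exact ⟨-q, by linarith⟩

lemma wrap_le (N Te : ℕ) [NeZero N] (g : ℤ → ℝ) (hg : ∀ m, 0 ≤ g m) (u : ZMod N) (m : ℤ) (hm : |m| ≤ Te) :
    wrap N Te g (u + m) ≤ g (u.val + m) := by
  unfold wrap
  split_ifs with h
  · obtain ⟨q, hq⟩ := val_add_int N u m
    have h1 := ZMod.val_lt u
    have h2 := abs_le.1 hm
    have h3 : q = 0 := by
      have a1 : (N : ℤ) * q < N * 1 := by omega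
      have a2 : (N : ℤ) * (-1) < N * q := by omega
      have hN : (0 : ℤ) < N := by omega
      have := lt_of_mul_lt_mul_left a1 hN.le
      have := lt_of_mul_lt_mul_left a2 hN.le
      omega
    rw [hq, h3]; simp
  · exact hg _

lemma wrap_eq (N Te : ℕ) [NeZero N] (g : ℤ → ℝ) (u : ZMod N) (m : ℤ) (hm : |m| ≤ Te)
    (hu : 2 * Te ≤ u.val ∧ u.val + 2 * Te < N) :
    wrap N Te g (u + m) = g (u.val + m) := by
  obtain ⟨q, hq⟩ := val_add_int N u m
  have h1 := ZMod.val_lt (u + (m : ZMod N))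
  have h2 := abs_le.1 hm
  have h3 : q = 0 := by
    have a1 : (N : ℤ) * q < N * 1 := by omega
    have a2 : (N : ℤ) * (-1) < N * q := by omega
    have hN : (0 : ℤ) < N := by omega
    have := lt_of_mul_lt_mul_left a1 hN.le
    have := lt_of_mul_lt_mul_left a2 hN.le
    omega
  subst h3
  unfold wrap
  rw [if_pos (by omega), hq]; simp

lemma av_lin {n N : ℕ} [NeZero N] (c : Fin n → ZMod N) (hc : ∃ i, IsUnit (c i)) (b : ZMod N → ℝ) :
    av (fun x : Fin n → ZMod N => b (∑ i, c i * x i)) = av b := by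
  obtain ⟨i, hi⟩ := hc
  rw [av_update i]
  have : ∀ x : Fin n → ZMod N, (av fun t => b (∑ j, c j * Function.update x i t j)) = av b := by
    intro x
    have e : ∀ t : ZMod N, ∑ j, c j * Function.update x i t j = c i * t + ∑ j ∈ univ.erase i, c j * x j := by
      intro t
      rw [← add_sum_erase univ _ (mem_univ i), Function.update_self]
      congr 1
      apply sum_congr rfl; intro j hj
      rw [Function.update_of_ne (ne_of_mem_erase hj)]
    simp only [e]
    apply av_bij (fun t => c i * t + ∑ j ∈ univ.erase i, c j * x j) (f := b)
    apply Function.Injective.bijective_of_finite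
    intro t t' h
    exact hi.mul_left_cancel (add_right_cancel h)
  rw [av_congr this, av_const]

noncomputable def badf (N Te : ℕ) (u : ZMod N) : ℝ := if 2 * Te ≤ u.val ∧ u.val + 2 * Te < N then 0 else 1

lemma badf_nonneg (N Te : ℕ) (u : ZMod N) : 0 ≤ badf N Te u := by unfold badf; split_ifs <;> norm_num

lemma av_badf (N Te : ℕ) [NeZero N] : av (badf N Te) ≤ 4 * Te / N := by
  rw [av_eq, ZMod.card]
  gcongr
  have : ∑ u : ZMod N, badf N Te u = ((univ.filter fun u : ZMod N => ¬ (2 * Te ≤ u.val ∧ u.val + 2 * Te < N)).card : ℝ) := by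
    rw [card_filter]; push_cast
    apply sum_congr rfl; intro u _; unfold badf; split_ifs <;> simp_all
  rw [this]
  have h : (univ.filter fun u : ZMod N => ¬ (2 * Te ≤ u.val ∧ u.val + 2 * Te < N)).card ≤ (range (2 * Te) ∪ Ico (N - 2 * Te) N).card := by
    apply card_le_card_of_injOn ZMod.val
    · intro u hu
      have hu := (mem_filter.1 (mem_coe.1 hu)).2
      have := ZMod.val_lt u
      simp only [coe_union, Set.mem_union, mem_coe, mem_range, mem_Ico]
      omega
    · exact (ZMod.val_injective N).injOn
  have h2 := card_union_le (range (2 * Te)) (Ico (N - 2 * Te) N)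
  rw [card_range, Nat.card_Ico] at h2
  have : (univ.filter fun u : ZMod N => ¬ (2 * Te ≤ u.val ∧ u.val + 2 * Te < N)).card ≤ 4 * Te := by omega
  exact_mod_cast this

lemma wrap_forms {α : Type} [Fintype α] {n N H Te C : ℕ} [NeZero N] (c : α → Fin n → ℤ) (hC : ∀ a i, |c a i| ≤ C)
    (hTe : n * C * H ≤ Te) (hu : ∀ a, ∃ i, IsUnit ((c a i : ℤ) : ZMod N)) (g : ℤ → ℝ) (hg : ∀ m, 0 ≤ g m) (ε : ℝ)
    (hε : 0 ≤ ε) (hH : 0 < H)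
    (hbox : ∀ u : α → ℤ, |av (fun h : Fin n → Fin H => ∏ a, g ((∑ i, c a i * ((h i : ℕ) : ℤ)) + u a)) - 1| ≤ ε) :
    |av (fun x : Fin n → ZMod N => ∏ a, wrap N Te g (∑ i, ((c a i : ℤ) : ZMod N) * x i)) - 1|
      ≤ ε + Fintype.card α * (4 * Te / N) := by
  have : Nonempty (Fin H) := ⟨⟨0, hH⟩⟩
  set F : (Fin n → ZMod N) → ℝ := fun x => ∏ a, wrap N Te g (∑ i, ((c a i : ℤ) : ZMod N) * x i) with hF
  set lin : α → (Fin n → ZMod N) → ZMod N := fun a x => ∑ i, ((c a i : ℤ) : ZMod N) * x i with hlin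
  set hc : (Fin n → Fin H) → (Fin n → ZMod N) := fun h i => ((h i : ℕ) : ZMod N)
  set mm : α → (Fin n → Fin H) → ℤ := fun a h => ∑ i, c a i * ((h i : ℕ) : ℤ) with hmm
  have hm : ∀ a h, |mm a h| ≤ Te := by
    intro a h
    refine (abs_sum_le_sum_abs _ _).trans ?_
    refine le_trans (sum_le_sum (g := fun _ => (C : ℤ) * H) fun i _ => ?_) ?_
    · rw [abs_mul]
      have : |((h i : ℕ) : ℤ)| ≤ H := by
        rw [abs_of_nonneg (by positivity)]; exact_mod_cast (h i).2.le
      exact mul_le_mul (hC a i) this (abs_nonneg _) (by positivity)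
    · simp only [sum_const, card_univ, Fintype.card_fin, nsmul_eq_mul]
      rw [← mul_assoc]; exact_mod_cast hTe
  have hlm : ∀ a x h, lin a (x + hc h) = lin a x + ((mm a h : ℤ) : ZMod N) := by
    intro a x h
    simp only [hlin, hmm, hc, Pi.add_apply, mul_add, sum_add_distrib]
    push_cast; rfl
  have e1 : av F = av fun x => av fun h => F (x + hc h) := by
    rw [av_comm]
    have : ∀ h, (av fun x => F (x + hc h)) = av F := fun h => av_equiv (Equiv.addRight (hc h)) F
    rw [av_congr this, av_const]
  have key : ∀ x, |(av fun h => F (x + hc h)) - 1| ≤ ε + ∑ a, badf N Te (lin a x) := by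
    intro x
    have hb := hbox fun a => ((lin a x).val : ℤ)
    have hle : ∀ h, F (x + hc h) ≤ ∏ a, g (mm a h + ((lin a x).val : ℤ)) := by
      intro h
      apply Finset.prod_le_prod
      · intro a _; exact wrap_nonneg _ _ _ hg _
      · intro a _
        change wrap N Te g (lin a (x + hc h)) ≤ _
        rw [hlm, add_comm (mm a h)]
        exact wrap_le N Te g hg _ _ (hm a h)
    by_cases hgood : ∀ a, 2 * Te ≤ (lin a x).val ∧ (lin a x).val + 2 * Te < N
    · have heq : ∀ h, F (x + hc h) = ∏ a, g (mm a h + ((lin a x).val : ℤ)) := by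
        intro h
        apply prod_congr rfl
        intro a _
        change wrap N Te g (lin a (x + hc h)) = _
        rw [hlm, add_comm (mm a h)]
        exact wrap_eq N Te g _ _ (hm a h) (hgood a)
      rw [av_congr heq]
      refine hb.trans ?_
      have : 0 ≤ ∑ a, badf N Te (lin a x) := sum_nonneg fun a _ => badf_nonneg _ _ _
      linarith
    · push Not at hgood
      obtain ⟨a, ha⟩ := hgood
      have h1 : 1 ≤ ∑ a, badf N Te (lin a x) := by
        refine le_trans (le_of_eq ?_) (single_le_sum (fun a _ => badf_nonneg N Te (lin a x)) (mem_univ a))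
        unfold badf; rw [if_neg]; push Not; exact ha
      have h2 := av_mono hle
      have h3 : 0 ≤ av fun h => F (x + hc h) := av_nonneg fun h => prod_nonneg fun a _ => wrap_nonneg _ _ _ hg _
      have h4 := (abs_le.1 hb).2
      rw [abs_le]; constructor
      · linarith
      · change av (fun h => ∏ a, g (mm a h + ((lin a x).val : ℤ))) - 1 ≤ ε at h4
        linarith
  rw [e1]
  have e2 : (av fun x => av fun h => F (x + hc h)) - 1 = av fun x => (av fun h => F (x + hc h)) - 1 := by
    rw [av_sub, av_const]
  rw [e2]
  refine (abs_av_le _).trans ((av_mono key).trans ?_)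
  rw [av_add, av_const, av_sum]
  gcongr
  refine le_trans (sum_le_sum (g := fun _ => (4 * Te / N : ℝ)) fun a _ => ?_) (by simp)
  refine le_trans (le_of_eq ?_) (av_badf N Te)
  exact av_lin (fun i => ((c a i : ℤ) : ZMod N)) (hu a) (badf N Te)

end GT
namespace GT

/-- coefficients of the linear forms in the linear forms condition -/
noncomputable def ca (r : ℕ) (p : Fin (r + 2) × Finset (Fin (r + 2))) : Fin (r + 2) ⊕ Fin (r + 2) → ℤ :=
  Sum.elim (fun i => if i ∈ p.2 then 0 else ((i : ℕ) : ℤ) - ((p.1 : ℕ) : ℤ))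
    (fun i => if i ∈ p.2 then ((i : ℕ) : ℤ) - ((p.1 : ℕ) : ℤ) else 0)

/-- the variable with index i in the form p -/
noncomputable def cv (r : ℕ) (p : Fin (r + 2) × Finset (Fin (r + 2))) (i : Fin (r + 2)) : Fin (r + 2) ⊕ Fin (r + 2) :=
  if i ∈ p.2 then Sum.inr i else Sum.inl i

lemma ca_cv (r : ℕ) (p : Fin (r + 2) × Finset (Fin (r + 2))) (i : Fin (r + 2)) :
    ca r p (cv r p i) = ((i : ℕ) : ℤ) - ((p.1 : ℕ) : ℤ) := by
  unfold ca cv; split_ifs with h <;> simp [h]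

lemma ca_abs (r : ℕ) (p : Fin (r + 2) × Finset (Fin (r + 2))) (v) : |ca r p v| ≤ (r + 2 : ℕ) := by
  unfold ca
  have h : ∀ i : Fin (r + 2), |((i : ℕ) : ℤ) - ((p.1 : ℕ) : ℤ)| ≤ (r + 2 : ℕ) := by
    intro i; rw [abs_le]; have := i.2; have := p.1.2; omega
  rcases v with i | i <;> simp only [Sum.elim_inl, Sum.elim_inr] <;> split_ifs <;> first | exact h i | (rw [abs_zero]; positivity)

lemma ca_sum (r N : ℕ) (p : Fin (r + 2) × Finset (Fin (r + 2))) (x y : Fin (r + 2) → ZMod N) :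
    LA r N p.1 (p.2.piecewise y x) = ∑ v, ((ca r p v : ℤ) : ZMod N) * Sum.elim x y v := by
  rw [Fintype.sum_sum_type, ← sum_add_distrib]
  unfold LA cc
  apply sum_congr rfl; intro i _
  simp only [ca, Sum.elim_inl, Sum.elim_inr, Finset.piecewise]
  split_ifs <;> push_cast <;> ring

lemma sep_cv (r : ℕ) (p q : Fin (r + 2) × Finset (Fin (r + 2))) (hp : p.1 ∉ p.2) (hq : q.1 ∉ q.2) (hpq : p ≠ q) :
    ∃ i, i ≠ p.1 ∧ ca r q (cv r p i) = 0 := by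
  by_cases h : p.1 = q.1
  · have h2 : p.2 ≠ q.2 := fun h2 => hpq (Prod.ext h h2)
    obtain ⟨i, hi⟩ : ∃ i, ¬ (i ∈ p.2 ↔ i ∈ q.2) := by
      by_contra hc; push Not at hc; exact h2 (Finset.ext hc)
    refine ⟨i, ?_, ?_⟩
    · rintro rfl; rw [← h] at hq; tauto
    · unfold cv ca
      by_cases h3 : i ∈ p.2
      · have : i ∉ q.2 := by tauto
        simp [h3, this]
      · have : i ∈ q.2 := by tauto
        simp [h3, this]
  · refine ⟨q.1, fun h' => h h'.symm, ?_⟩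
    unfold cv ca
    split_ifs <;> simp

/-- product of the small primes -/
noncomputable def Wp (w : ℕ) : ℕ := ∏ p ∈ prs 0 w, p

lemma Wp_not_dvd (w p : ℕ) (hp : p.Prime) (hw : w < p) : ¬ p ∣ Wp w := by
  unfold Wp
  rw [hp.prime.dvd_finsetProd_iff]
  rintro ⟨q, hq, hpq⟩
  have := (Nat.prime_dvd_prime_iff_eq hp (prs_prime _ _ q hq)).1 hpq
  have := prs_le hq
  omega

lemma diff_not_dvd (r p : ℕ) (hw : r + 2 ≤ p) (i j : Fin (r + 2)) (hij : i ≠ j) :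
    ¬ (p : ℤ) ∣ ((i : ℕ) : ℤ) - ((j : ℕ) : ℤ) := by
  intro h
  have hne : ((i : ℕ) : ℤ) - ((j : ℕ) : ℤ) ≠ 0 := by
    intro h0; apply hij; apply Fin.ext; omega
  have := Int.le_of_dvd (abs_pos.2 hne) ((dvd_abs _ _).2 h)
  have h3 : |((i : ℕ) : ℤ) - ((j : ℕ) : ℤ)| < p := by
    rw [abs_lt]; have := i.2; have := j.2; omega
  omega

/-- width of the edge -/
noncomputable def Te (r N : ℕ) : ℕ := ((r + 2) + (r + 2)) * (r + 2) * Nat.sqrt N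

/-- the majorant -/
noncomputable def nuf (r K D w y N : ℕ) (b : ℤ) : ZMod N → ℝ :=
  wrap N (Te r N) fun m => nt (prs w (zz y)) (prs (zz y) (RR D y)) (K * y) (RR D y) (Wp w * m + b)

lemma exists_ne_fin (r : ℕ) (j : Fin (r + 2)) : ∃ i : Fin (r + 2), i ≠ j := exists_ne j

lemma lf_one (r K D w y N : ℕ) (b : ℤ) [NeZero N] (hN : N.Prime) (hNr : r + 2 ≤ N) (ε : ℝ) (hε : 0 ≤ ε) (hw : r + 2 ≤ w)
    (hy : Real.exp ((y : ℝ) ^ 3 / 2) ≤ 2 * (Nat.sqrt N : ℕ))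
    (S : Finset (Fin (r + 2) × Finset (Fin (r + 2)))) (hS : ∀ p ∈ S, p.1 ∉ p.2)
    (hbox : ∀ (c : S → Fin ((r + 2) + (r + 2)) → ℤ) (u : S → ℤ),
      (∀ p : ℕ, p.Prime → w < p → ∀ a, ∃ i, ¬ (p : ℤ) ∣ c a i) →
      (∀ p : ℕ, p.Prime → w < p → ∀ a b, a ≠ b → ∃ i, (¬ (p : ℤ) ∣ c a i) ∧ c b i = 0) →
      ∀ H : ℕ, Real.exp ((y : ℝ) ^ 3 / 2) ≤ 2 * H →
      |(av fun h : Fin ((r + 2) + (r + 2)) → Fin H => ∏ a, nt (prs w (zz y)) (prs (zz y) (RR D y)) (K * y) (RR D y)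
        ((∑ i, c a i * ((h i : ℕ) : ℤ)) + u a)) - 1| ≤ ε) :
    |(av fun x : Fin (r + 2) → ZMod N => av fun z : Fin (r + 2) → ZMod N =>
      ∏ p ∈ S, nuf r K D w y N b (LA r N p.1 (p.2.piecewise z x))) - 1| ≤ ε + (S.card : ℝ) * (4 * (Te r N : ℕ) / N) := by
  set e : Fin (r + 2) ⊕ Fin (r + 2) ≃ Fin ((r + 2) + (r + 2)) := finSumFinEquiv
  set c : S → Fin ((r + 2) + (r + 2)) → ℤ := fun a v => ca r a (e.symm v) with hc
  have hsq : 0 < Nat.sqrt N := Nat.sqrt_pos.2 hN.pos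
  have key := wrap_forms (N := N) (H := Nat.sqrt N) (Te := Te r N) (C := r + 2) c
    (fun a v => ca_abs r a _) (by unfold Te; exact le_rfl) (by
      intro a
      obtain ⟨i, hi⟩ := exists_ne_fin r a.1.1
      refine ⟨e (cv r a i), ?_⟩
      simp only [hc, Equiv.symm_apply_apply, ca_cv]
      have : Fact N.Prime := ⟨hN⟩
      rw [isUnit_iff_ne_zero, Ne, ZMod.intCast_zmod_eq_zero_iff_dvd]
      exact diff_not_dvd r N hNr _ _ hi)
    (fun m => nt (prs w (zz y)) (prs (zz y) (RR D y)) (K * y) (RR D y) (Wp w * m + b))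
    (fun m => nt_nonneg _ _ (prs_prime _ _) (prs_prime _ _) _ _ (RR_pos D y) _) ε hε hsq (by
      intro u
      have h := hbox (fun a v => Wp w * c a v) (fun a => Wp w * u a + b) (by
        intro p hp hpw a
        obtain ⟨i, hi⟩ := exists_ne_fin r a.1.1
        refine ⟨e (cv r a i), ?_⟩
        simp only [hc, Equiv.symm_apply_apply, ca_cv]
        rw [(Nat.prime_iff_prime_int.1 hp).dvd_mul]
        rintro (h | h)
        · exact Wp_not_dvd w p hp hpw (by exact_mod_cast h)
        · exact diff_not_dvd r p (by omega) _ _ hi h) (by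
        intro p hp hpw a a' haa
        obtain ⟨i, hi, h0⟩ := sep_cv r a a' (hS a a.2) (hS a' a'.2) (fun h => haa (Subtype.ext h))
        refine ⟨e (cv r a i), ?_, ?_⟩
        · simp only [hc, Equiv.symm_apply_apply, ca_cv]
          rw [(Nat.prime_iff_prime_int.1 hp).dvd_mul]
          rintro (h | h)
          · exact Wp_not_dvd w p hp hpw (by exact_mod_cast h)
          · exact diff_not_dvd r p (by omega) _ _ hi h
        · simp only [hc, Equiv.symm_apply_apply, h0, mul_zero]) (Nat.sqrt N) hy
      refine le_trans (le_of_eq ?_) h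
      refine congrArg (fun t : ℝ => |t - 1|) ?_
      apply av_congr; intro h
      apply prod_congr rfl; intro a _
      refine congrArg (nt _ _ _ _) ?_
      rw [mul_add, mul_sum, add_assoc]
      congr 1
      apply sum_congr rfl; intro i _; ring)
  rw [Fintype.card_coe] at key
  have e0 : (av fun x : Fin (r + 2) → ZMod N => av fun z : Fin (r + 2) → ZMod N =>
      ∏ p ∈ S, nuf r K D w y N b (LA r N p.1 (p.2.piecewise z x))) =
      av fun q : Fin ((r + 2) + (r + 2)) → ZMod N => ∏ a : S, nuf r K D w y N b (∑ i, ((c a i : ℤ) : ZMod N) * q i) := by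
    set F : (Fin (r + 2) ⊕ Fin (r + 2) → ZMod N) → ℝ := fun q => ∏ p ∈ S,
      nuf r K D w y N b (∑ v, ((ca r p v : ℤ) : ZMod N) * q v) with hF
    have h1 : (av fun x : Fin (r + 2) → ZMod N => av fun z : Fin (r + 2) → ZMod N =>
      ∏ p ∈ S, nuf r K D w y N b (LA r N p.1 (p.2.piecewise z x))) = av F := by
      rw [av_sumArrow F]
      apply av_congr; intro x; apply av_congr; intro z
      apply prod_congr rfl; intro p _
      rw [← ca_sum]
    rw [h1, ← av_equiv (Equiv.arrowCongr e.symm (Equiv.refl (ZMod N))) F]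
    apply av_congr; intro q
    simp only [hF]
    rw [← prod_coe_sort S]
    apply prod_congr rfl; intro a _
    refine congrArg (nuf r K D w y N b) ?_
    rw [← e.sum_comp]
    apply sum_congr rfl; intro v _
    simp [hc]
  rw [e0]
  simp only [nuf]
  exact key

end GT
namespace GT

lemma ev_exp (M : ℝ) : ∀ᶠ y : ℕ in atTop, M ≤ Real.exp ((y : ℝ) ^ 3 / 2) := by
  have h1 : Tendsto (fun y : ℕ => (y : ℝ) ^ 3 / 2) atTop atTop := by
    apply Tendsto.atTop_div_const (by norm_num)
    exact (tendsto_pow_atTop (by norm_num)).comp tendsto_natCast_atTop_atTop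
  exact (Real.tendsto_exp_atTop.comp h1).eventually_ge_atTop M

theorem lf_main (r : ℕ) : ∃ K D : ℕ, 1 ≤ K ∧ 2 ≤ D ∧ ∀ ε : ℝ, 0 < ε → ∃ w₀ : ℕ, ∀ w ≥ w₀, ∀ᶠ y : ℕ in atTop,
    ∀ (N : ℕ) [NeZero N], N.Prime → Real.exp ((y : ℝ) ^ 3) ≤ N → ∀ b : ℤ,
    LF (fun j x => nuf r K D w y N b (LA r N j x)) ε := by
  set T := Fintype.card (Fin (r + 2) × Finset (Fin (r + 2))) with hT
  refine ⟨6 ^ T * T + 2 * T + 1, 16 * T + 1, by omega, by have : 0 < T := Fintype.card_pos; omega, ?_⟩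
  set K := 6 ^ T * T + 2 * T + 1 with hK
  set D := 16 * T + 1 with hD
  intro ε hε
  have hb := fun t (ht : t ∈ range (T + 1)) => box_main t ((r + 2) + (r + 2)) K D (by
    have : t ≤ T := by rw [mem_range] at ht; omega
    have h6 : 6 ^ t * t ≤ 6 ^ T * T := Nat.mul_le_mul (Nat.pow_le_pow_right (by norm_num) this) this
    omega) (by omega) (by rw [mem_range] at ht; omega) (ε / 2) (by positivity)
  choose! wt hwt using hb
  refine ⟨(r + 2) + ∑ t ∈ range (T + 1), wt t, ?_⟩
  intro w hw
  have hev : ∀ᶠ y : ℕ in atTop, ∀ t ∈ range (T + 1), ∀ (α : Type) [Fintype α], Fintype.card α = t →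
      ∀ (c : α → Fin ((r + 2) + (r + 2)) → ℤ) (u : α → ℤ), (∀ p : ℕ, p.Prime → w < p → ∀ a, ∃ i, ¬ (p : ℤ) ∣ c a i) →
      (∀ p : ℕ, p.Prime → w < p → ∀ a b, a ≠ b → ∃ i, (¬ (p : ℤ) ∣ c a i) ∧ c b i = 0) →
      ∀ H : ℕ, Real.exp ((y : ℝ) ^ 3 / 2) ≤ 2 * H →
      |(av fun h : Fin ((r + 2) + (r + 2)) → Fin H => ∏ a, nt (prs w (zz y)) (prs (zz y) (RR D y)) (K * y) (RR D y)
        ((∑ i, c a i * ((h i : ℕ) : ℤ)) + u a)) - 1| ≤ ε / 2 := by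
    rw [eventually_all_finset]
    intro t ht
    apply hwt t ht
    have : wt t ≤ ∑ t ∈ range (T + 1), wt t := single_le_sum (fun _ _ => Nat.zero_le _) ht
    omega
  set C : ℝ := ((((r + 2) + (r + 2)) * (r + 2) : ℕ) : ℝ) with hC
  filter_upwards [hev, ev_exp (8 * T * C / ε), ev_exp ((r + 2 : ℕ) : ℝ)] with y h1 h2 h3
  intro N _ hN hyN b S hS
  set E := Real.exp ((y : ℝ) ^ 3 / 2) with hE
  have hE1 : 1 ≤ E := Real.one_le_exp (by positivity)
  have hEN : E * E ≤ N := by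
    rw [hE, ← Real.exp_add, add_halves]; exact hyN
  set s := Nat.sqrt N with hs
  have hs1 : (s : ℝ) * s ≤ N := by exact_mod_cast Nat.sqrt_le N
  have hs2 : (N : ℝ) < (s + 1) * (s + 1) := by exact_mod_cast Nat.lt_succ_sqrt N
  have hs0 : (1 : ℝ) ≤ s := by exact_mod_cast Nat.sqrt_pos.2 hN.pos
  have hEs : E ≤ 2 * s := by
    have : E < s + 1 := by
      by_contra hc; push Not at hc
      have := mul_le_mul hc hc (by linarith) (by linarith)
      linarith
    linarith
  have hcard : S.card ≤ T := card_le_univ S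
  have hNr : r + 2 ≤ N := by
    have : ((r + 2 : ℕ) : ℝ) ≤ N := by nlinarith
    exact_mod_cast this
  have key := lf_one r K D w y N b hN hNr (ε / 2) (by positivity) (by omega) hEs S hS (by
    intro c u hc1 hc2 H hH
    exact h1 S.card (by rw [mem_range]; omega) S (Fintype.card_coe S) c u hc1 hc2 H hH)
  refine key.trans ?_
  have hN0 : (0 : ℝ) < N := by exact_mod_cast hN.pos
  have hTe : ((Te r N : ℕ) : ℝ) = C * s := by
    rw [hC, hs]; unfold Te; push_cast; ring
  have hC0 : 0 ≤ C := by positivity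
  have hsE : s * E ≤ N := by nlinarith [sq_nonneg (s - E)]
  have : (S.card : ℝ) * (4 * (Te r N : ℕ) / N) ≤ ε / 2 := by
    rw [hTe, ← mul_div_assoc, div_le_iff₀ hN0]
    rw [div_le_iff₀ hε] at h2
    have h4 : (S.card : ℝ) ≤ T := by exact_mod_cast hcard
    calc (S.card : ℝ) * (4 * (C * s)) ≤ T * (4 * (C * s)) := by gcongr
      _ = (8 * T * C) * s / 2 := by ring
      _ ≤ (E * ε) * s / 2 := by gcongr
      _ = ε / 2 * (s * E) := by ring
      _ ≤ _ := by gcongr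
  linarith

end GT
namespace GT

lemma tend_Y : Tendsto (fun y : ℕ => (y : ℝ) ^ 3 / 2) atTop atTop := by
  apply Tendsto.atTop_div_const (by norm_num)
  exact (tendsto_pow_atTop (by norm_num)).comp tendsto_natCast_atTop_atTop

lemma ev_pow (n : ℕ) (M : ℝ) : ∀ᶠ y : ℕ in atTop, M * ((y : ℝ) ^ 3) ^ n ≤ Real.exp ((y : ℝ) ^ 3 / 2) := by
  have h := ((Real.tendsto_exp_div_pow_atTop n).comp tend_Y).eventually_ge_atTop (M * 2 ^ n)
  filter_upwards [h, eventually_ge_atTop 1] with y hy hy1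
  have hy1 : (1 : ℝ) ≤ y := by exact_mod_cast hy1
  have hp : (0 : ℝ) < ((y : ℝ) ^ 3 / 2) ^ n := by positivity
  simp only [Function.comp] at hy
  rw [le_div_iff₀ hp] at hy
  calc _ = M * 2 ^ n * ((y : ℝ) ^ 3 / 2) ^ n := by rw [div_pow]; field_simp
    _ ≤ _ := hy

set_option maxHeartbeats 1000000 in
lemma many_primes (W C : ℕ) (hW : 0 < W) : ∀ᶠ y : ℕ in atTop, ∀ N : ℕ, Real.exp ((y : ℝ) ^ 3) ≤ N →
    (N : ℝ) ≤ 4 * Real.exp ((y : ℝ) ^ 3) →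
    (W : ℝ) * N / (36 * (y : ℝ) ^ 3) ≤ (((Ico (W * (C * Nat.sqrt N)) (W * (N / 2))).filter Nat.Prime).card : ℝ) := by
  filter_upwards [ev_pow 1 (36 * (C + 1)), ev_pow 0 W, eventually_ge_atTop 2] with y h1 h2 h3
  intro N hN1 hN2
  have hy : (2 : ℝ) ≤ y := by exact_mod_cast h3
  set Y : ℝ := (y : ℝ) ^ 3 with hY
  have hY8 : 8 ≤ Y := by
    calc (8 : ℝ) = 2 ^ 3 := by norm_num
      _ ≤ Y := by rw [hY]; gcongr
  set E := Real.exp (Y / 2) with hE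
  have hEE : Real.exp Y = E * E := by rw [hE, ← Real.exp_add, add_halves]
  rw [pow_one] at h1
  rw [pow_zero, mul_one] at h2
  rw [hEE] at hN1 hN2
  have hC0 : (0 : ℝ) ≤ C := by positivity
  have hE36 : 36 * Y ≤ E := by nlinarith
  have hE1 : 288 ≤ E := by linarith
  have hEN : E ≤ N := by nlinarith
  have hN3 : (288 : ℝ) ≤ N := by linarith
  set s := Nat.sqrt N with hs
  have hs1 : (s : ℝ) * s ≤ N := by exact_mod_cast Nat.sqrt_le N
  have hs0 : (1 : ℝ) ≤ s := by
    have : 0 < N := by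
      have : (0 : ℝ) < N := by linarith
      exact_mod_cast this
    exact_mod_cast Nat.sqrt_pos.2 this
  have hsE : s * E ≤ N := by nlinarith [sq_nonneg (s - E)]
  have hW1 : (1 : ℝ) ≤ W := by exact_mod_cast hW
  set n := W * (N / 2) with hn
  have hhalf : ((N / 2 : ℕ) : ℝ) ≥ N / 3 := by
    have : N ≤ 2 * (N / 2) + 1 := by omega
    have : (N : ℝ) ≤ 2 * ((N / 2 : ℕ) : ℝ) + 1 := by exact_mod_cast this
    linarith
  have hhalf2 : ((N / 2 : ℕ) : ℝ) ≤ N / 2 := Nat.cast_div_le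
  have hnr : (n : ℝ) = W * ((N / 2 : ℕ) : ℝ) := by rw [hn]; push_cast; ring
  have hnlow : W * (N : ℝ) / 3 ≤ n := by rw [hnr]; nlinarith
  have hnup : (n : ℝ) + 1 ≤ W * N := by rw [hnr]; nlinarith
  have hN3n : (N : ℝ) / 3 ≤ n := by
    have : 1 * (N : ℝ) ≤ W * N := by gcongr
    linarith
  have hn96 : (96 : ℝ) ≤ n := by linarith
  have hlogWN : Real.log (W * N) ≤ 3 * Y := by
    have : (W : ℝ) * N ≤ Real.exp (3 * Y) := by
      have e3 : Real.exp (3 * Y) = E * (E * E) * (E * (E * E)) := by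
        rw [hE, ← Real.exp_add, ← Real.exp_add, ← Real.exp_add]; congr 1; ring
      rw [e3]
      have : (N : ℝ) ≤ E * (E * E) := by nlinarith [mul_nonneg (by linarith : (0:ℝ) ≤ E) (by linarith : (0:ℝ) ≤ E)]
      have h5 : (W : ℝ) ≤ E * (E * E) := by nlinarith [mul_nonneg (by linarith : (0:ℝ) ≤ E) (by linarith : (0:ℝ) ≤ E)]
      exact mul_le_mul h5 this (by linarith) (by positivity)
    calc _ ≤ Real.log (Real.exp (3 * Y)) := Real.log_le_log (by positivity) this
      _ = _ := Real.log_exp _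
  have hl1 : Real.log ((n : ℝ) + 1) ≤ 3 * Y := (Real.log_le_log (by linarith) hnup).trans hlogWN
  have hl2 : Real.log (n : ℝ) ≤ 3 * Y := (Real.log_le_log (by linarith) (by linarith)).trans hlogWN
  have hl0 : 0 < Real.log (n : ℝ) := Real.log_pos (by linarith)
  have hpi := Chebyshev.pi_ge n
  have hnum : (n : ℝ) / 2 ≤ n * Real.log 2 - Real.log (n + 1) := by
    have := Real.log_two_gt_d9
    have h6 : 288 * (36 * Y) ≤ E * E := mul_le_mul hE1 hE36 (by linarith) (by linarith)
    have h7 : (n : ℝ) * 0.69 ≤ n * Real.log 2 := by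
      apply mul_le_mul_of_nonneg_left _ (by linarith); linarith
    linarith
  have hpi2 : W * (N : ℝ) / (18 * Y) ≤ (Nat.primeCounting n : ℝ) := by
    refine le_trans ?_ hpi
    rw [le_div_iff₀ hl0]
    refine le_trans ?_ hnum
    calc W * (N : ℝ) / (18 * Y) * Real.log n ≤ W * (N : ℝ) / (18 * Y) * (3 * Y) := by gcongr
      _ = (W * N / 3) / 2 := by field_simp; norm_num
      _ ≤ _ := by gcongr
  have hcard : Nat.primeCounting n ≤ ((Ico (W * (C * s)) n).filter Nat.Prime).card + (W * (C * s) + 1) := by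
    rw [Nat.primeCounting, Nat.primeCounting', Nat.count_eq_card_filter_range]
    have hsub : (range (n + 1)).filter Nat.Prime ⊆ (Ico (W * (C * s)) n).filter Nat.Prime ∪ (range (W * (C * s)) ∪ {n}) := by
      intro p hp
      simp only [mem_filter, mem_range, mem_union, mem_Ico, mem_singleton] at hp ⊢
      by_cases h : p < W * (C * s)
      · tauto
      · by_cases h' : p = n
        · tauto
        · left; exact ⟨⟨by omega, by omega⟩, hp.2⟩
    refine (card_le_card hsub).trans ((card_union_le _ _).trans ?_)
    gcongr
    refine (card_union_le _ _).trans ?_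
    simp
  have hcardR : (Nat.primeCounting n : ℝ) ≤ (((Ico (W * (C * s)) n).filter Nat.Prime).card : ℝ) + (W * (C * s) + 1) := by
    exact_mod_cast hcard
  have hedge : (W : ℝ) * (C * s) + 1 ≤ W * N / (36 * Y) := by
    rw [le_div_iff₀ (by positivity)]
    calc ((W : ℝ) * (C * s) + 1) * (36 * Y) ≤ (W * (C * s) + W * s) * (36 * Y) := by gcongr; exact one_le_mul_of_one_le_of_one_le hW1 hs0
      _ = W * ((36 * (C + 1) * Y) * s) := by ring
      _ ≤ W * (E * s) := by gcongr
      _ ≤ W * N := by rw [mul_comm E]; gcongr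
  have : W * (N : ℝ) / (18 * Y) = W * N / (36 * Y) + W * N / (36 * Y) := by field_simp; norm_num
  linarith

lemma ap_extract (r N h W b : ℕ) [NeZero N] (hN : 2 * h ≤ N) (hW : 0 < W) (a d : ZMod N) (hd : d ≠ 0)
    (hp : ∀ j : ℕ, j < r + 2 → (a + (j : ZMod N) * d).val < h ∧ (W * (a + (j : ZMod N) * d).val + b).Prime) :
    ∃ b' d' : ℕ, 0 < d' ∧ ∀ i < r + 2, Nat.Prime (b' + i * d') := by
  set v : ℕ → ℕ := fun j => (a + (j : ZMod N) * d).val with hv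
  have hcast : ∀ j, ((v j : ℤ) : ZMod N) = a + (j : ZMod N) * d := by
    intro j; simp [hv]
  have hstep : ∀ j, j + 1 < r + 2 → (v (j + 1) : ℤ) - v j = v 1 - v 0 := by
    intro j hj
    have h1 : (((v 1 - v 0 : ℤ)) : ZMod N) = (((v (j + 1) : ℤ) - v j : ℤ) : ZMod N) := by
      rw [Int.cast_sub, Int.cast_sub, hcast, hcast, hcast, hcast]; push_cast; ring
    rw [ZMod.intCast_eq_intCast_iff_dvd_sub] at h1
    obtain ⟨q, hq⟩ := h1
    have a1 := (hp j (by omega)).1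
    have a2 := (hp (j + 1) hj).1
    have a3 := (hp 0 (by omega)).1
    have a4 := (hp 1 (by omega)).1
    change v j < h at a1
    change v (j + 1) < h at a2
    change v 0 < h at a3
    change v 1 < h at a4
    have hq0 : q = 0 := by
      have b1 : (N : ℤ) * q < N * 1 := by omega
      have b2 : (N : ℤ) * (-1) < N * q := by omega
      have hN : (0 : ℤ) < N := by omega
      have := lt_of_mul_lt_mul_left b1 hN.le
      have := lt_of_mul_lt_mul_left b2 hN.le
      omega
    subst hq0
    omega
  have hlin : ∀ j, j < r + 2 → (v j : ℤ) = v 0 + j * (v 1 - v 0) := by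
    intro j
    induction j with
    | zero => intro _; simp
    | succ j ih =>
      intro hj
      have := ih (by omega)
      have := hstep j hj
      push_cast
      linarith
  have hne : v 1 ≠ v 0 := by
    intro he
    have h1 := hcast 1
    rw [he, hcast 0] at h1
    simp at h1
    exact hd h1
  have hpv : ∀ j, j < r + 2 → (W * v j + b).Prime := fun j hj => (hp j hj).2
  rcases lt_or_gt_of_ne hne with hlt | hlt
  · refine ⟨W * v (r + 1) + b, W * (v 0 - v 1), Nat.mul_pos hW (by omega), ?_⟩
    intro i hi
    have h1 := hpv (r + 1 - i) (by omega)
    have h2 := hlin (r + 1) (by omega)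
    have h3 := hlin (r + 1 - i) (by omega)
    have e : v (r + 1 - i) = v (r + 1) + i * (v 0 - v 1) := by
      zify [hlt.le]
      rw [h2, h3]
      rw [Nat.cast_sub (by omega : i ≤ r + 1)]
      ring
    rw [e] at h1
    convert h1 using 1
    ring
  · refine ⟨W * v 0 + b, W * (v 1 - v 0), Nat.mul_pos hW (by omega), ?_⟩
    intro i hi
    have h1 := hpv i hi
    have h3 := hlin i hi
    have e : v i = v 0 + i * (v 1 - v 0) := by
      zify [hlt.le]
      rw [h3]
    rw [e] at h1
    convert h1 using 1
    ring

end GT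
namespace GT

lemma Wp_pos (w : ℕ) : 0 < Wp w := prod_pos fun p hp => (prs_prime _ _ p hp).pos

lemma VV_Wp (w : ℕ) : VV (prs 0 w) = (Nat.totient (Wp w) : ℝ) / Wp w := by
  have h := Nat.totient_eq_mul_prod_factors (Wp w)
  have hpf : (Wp w).primeFactors = prs 0 w := Nat.primeFactors_prod (prs_prime 0 w)
  rw [hpf] at h
  have h2 : (Nat.totient (Wp w) : ℝ) = Wp w * ∏ p ∈ prs 0 w, (1 - (p : ℝ)⁻¹) := by
    have h3 := congrArg (fun q : ℚ => (q : ℝ)) h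
    push_cast at h3
    exact h3
  have h0 : (Wp w : ℝ) ≠ 0 := by exact_mod_cast (Wp_pos w).ne'
  rw [VV_eq, h2]
  field_simp

/-- the weighted indicator of primes in a residue class -/
noncomputable def ff (W b T h : ℕ) (Θ : ℝ) (N : ℕ) (x : ZMod N) : ℝ :=
  if T ≤ x.val ∧ x.val < h ∧ (W * x.val + b).Prime then Θ else 0

lemma dens_exists (W N T h : ℕ) [NeZero N] (hW : 0 < W) (hh : h ≤ N) (Θ : ℝ) (hΘ : 0 ≤ Θ)
    (hcop : ∀ p ∈ (Ico (W * T) (W * h)).filter Nat.Prime, W.Coprime p) :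
    ∃ b : ℕ, Θ * ((((Ico (W * T) (W * h)).filter Nat.Prime).card : ℝ) / Nat.totient W) / N ≤ av (ff W b T h Θ N) := by
  set A := (Ico (W * T) (W * h)).filter Nat.Prime with hA
  set B := (range W).filter fun a => W.Coprime a with hB
  have hBc : B.card = Nat.totient W := (Nat.totient_eq_card_coprime W).symm
  have hφ : 0 < Nat.totient W := Nat.totient_pos.2 hW
  have hBne : B.Nonempty := by rw [← card_pos, hBc]; exact hφ
  have hmaps : ∀ p ∈ A, p % W ∈ B := by
    intro p hp
    rw [hB, mem_filter, mem_range]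
    refine ⟨Nat.mod_lt _ hW, ?_⟩
    have := hcop p hp
    rw [Nat.coprime_comm, Nat.Coprime, ← Nat.mod_add_div p W] at this
    rw [Nat.coprime_comm, Nat.Coprime]
    simpa using this
  have hsum := card_eq_sum_card_fiberwise hmaps
  obtain ⟨b, hb, hle⟩ := exists_le_of_sum_le (s := B) (f := fun _ => (A.card : ℝ) / Nat.totient W)
    (g := fun b => ((A.filter fun p => p % W = b).card : ℝ)) hBne (by
      rw [sum_const, hBc, nsmul_eq_mul, hsum]
      have : (Nat.totient W : ℝ) ≠ 0 := by exact_mod_cast hφ.ne'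
      push_cast
      rw [mul_div_cancel₀ _ this])
  refine ⟨b, ?_⟩
  have hcard : (A.filter fun p => p % W = b).card ≤
      (univ.filter fun x : ZMod N => T ≤ x.val ∧ x.val < h ∧ (W * x.val + b).Prime).card := by
    have hAx : ∀ p ∈ A.filter (fun p => p % W = b), W * (p / W) + b = p ∧ p.Prime ∧ T ≤ p / W ∧ p / W < h := by
      intro p hp
      rw [mem_filter, hA, mem_filter, mem_Ico] at hp
      obtain ⟨⟨⟨h1, h2⟩, h3⟩, h4⟩ := hp
      refine ⟨?_, h3, ?_, ?_⟩
      · rw [← h4]; exact Nat.div_add_mod p W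
      · rw [Nat.le_div_iff_mul_le hW, mul_comm]; exact h1
      · rw [Nat.div_lt_iff_lt_mul hW, mul_comm]; exact h2
    have hval : ∀ p ∈ A.filter (fun p => p % W = b), (((p / W : ℕ) : ZMod N)).val = p / W := by
      intro p hp
      exact ZMod.val_cast_of_lt (lt_of_lt_of_le (hAx p hp).2.2.2 hh)
    apply card_le_card_of_injOn (fun p => ((p / W : ℕ) : ZMod N))
    · intro p hp
      have h1 := hAx p hp
      rw [mem_coe, mem_filter, hval p hp, h1.1]
      exact ⟨mem_univ _, h1.2.2.1, h1.2.2.2, h1.2.1⟩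
    · intro p hp q hq hpq
      have h1 := hval p hp
      have h2 := hval q hq
      simp only at hpq
      rw [hpq, h2] at h1
      rw [← (hAx p hp).1, ← (hAx q hq).1, h1]
  have hav : av (ff W b T h Θ N) = Θ * ((univ.filter fun x : ZMod N => T ≤ x.val ∧ x.val < h ∧ (W * x.val + b).Prime).card : ℝ) / N := by
    rw [av_eq, ZMod.card]
    congr 1
    unfold ff
    rw [← sum_filter, sum_const, nsmul_eq_mul, mul_comm]
  rw [hav]
  gcongr
  exact hle.trans (by exact_mod_cast hcard)

lemma exists_pos_term (r N : ℕ) [NeZero N] (f : ZMod N → ℝ) (Θ c : ℝ) (h0 : ∀ x, 0 ≤ f x) (h1 : ∀ x, f x ≤ Θ)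
    (hc : Θ ^ (r + 2) / N < c)
    (h : c ≤ av fun a : ZMod N => av fun d : ZMod N => ∏ j : Fin (r + 2), f (a + (j : ℕ) * d)) :
    ∃ a d : ZMod N, d ≠ 0 ∧ ∀ j : ℕ, j < r + 2 → f (a + (j : ZMod N) * d) ≠ 0 := by
  by_contra! hcon
  have hz : ∀ a d : ZMod N, d ≠ 0 → ∏ j : Fin (r + 2), f (a + (j : ℕ) * d) = 0 := by
    intro a d hd
    obtain ⟨j, hj, hj0⟩ := hcon a d hd
    exact prod_eq_zero (mem_univ (⟨j, hj⟩ : Fin (r + 2))) hj0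
  have : (av fun a : ZMod N => av fun d : ZMod N => ∏ j : Fin (r + 2), f (a + (j : ℕ) * d)) ≤ Θ ^ (r + 2) / N := by
    apply av_le_of_le
    intro a
    rw [av_eq, ZMod.card, sum_eq_single (0 : ZMod N) (fun d _ hd => hz a d hd) (fun h => absurd (mem_univ _) h)]
    gcongr
    refine le_trans (Finset.prod_le_prod (fun j _ => h0 _) (fun j _ => h1 _)) ?_
    simp
  linarith

set_option maxHeartbeats 1000000 in
theorem gt_main (r : ℕ) : ∃ b d : ℕ, 0 < d ∧ ∀ i < r + 2, Nat.Prime (b + i * d) := by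
  obtain ⟨K, D, hK, hD, hLF⟩ := lf_main r
  have hDr : (2 : ℝ) ≤ D := by exact_mod_cast hD
  obtain ⟨c, hc, ε, hε, N₀, hsz⟩ := rel_szem r (1 / (72 * D)) (by positivity)
  obtain ⟨w, hw⟩ := hLF ε hε
  have hLw := hw w le_rfl
  set W := Wp w with hW
  have hWpos : 0 < W := Wp_pos w
  set C := ((r + 2) + (r + 2)) * (r + 2) with hC
  have hC8 : 8 ≤ C := by rw [hC]; nlinarith
  obtain ⟨y, h1, h2, h3, h4, h5, h6⟩ := (hLw.and ((many_primes W C hWpos).and ((ev_pow 0 (N₀ + w + 2 * C)).and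
    ((ev_pow (r + 2) (2 / c)).and ((eventually_ge_atTop (2 * D + 2)).and (eventually_ge_atTop w)))))).exists
  have hyD : 2 * (D : ℝ) + 2 ≤ y := by exact_mod_cast h5
  set Y : ℝ := (y : ℝ) ^ 3 with hY
  have hy2 : (2 : ℝ) ≤ y := by linarith
  have hYy : 4 * (y : ℝ) ≤ Y := by
    have : (2 : ℝ) * 2 ≤ y * y := mul_le_mul hy2 hy2 (by norm_num) (by linarith)
    calc 4 * (y : ℝ) ≤ (y * y) * y := by gcongr; linarith
      _ = Y := by rw [hY]; ring
  set E := Real.exp (Y / 2) with hE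
  have hEE : Real.exp Y = E * E := by rw [hE, ← Real.exp_add, add_halves]
  have hE1 : 1 ≤ E := Real.one_le_exp (by linarith)
  rw [pow_zero, mul_one] at h3
  have hN0r : (0 : ℝ) ≤ N₀ := by positivity
  have hw0r : (0 : ℝ) ≤ w := by positivity
  have hC0r : (8 : ℝ) ≤ C := by exact_mod_cast hC8
  -- choose the prime modulus
  obtain ⟨N, hN, hNlo, hNhi⟩ := Nat.exists_prime_lt_and_le_two_mul ⌈Real.exp Y⌉₊ (by
    have : 0 < ⌈Real.exp Y⌉₊ := Nat.ceil_pos.2 (Real.exp_pos _)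
    omega)
  have hNlo' : Real.exp Y ≤ N := (Nat.le_ceil _).trans (by exact_mod_cast hNlo.le)
  have hNhi' : (N : ℝ) ≤ 4 * Real.exp Y := by
    have a1 : (N : ℝ) ≤ 2 * (⌈Real.exp Y⌉₊ : ℝ) := by exact_mod_cast hNhi
    have a2 := (Nat.ceil_lt_add_one (Real.exp_pos Y).le).le
    have a3 : 1 ≤ Real.exp Y := Real.one_le_exp (by linarith)
    linarith
  have : NeZero N := ⟨hN.ne_zero⟩
  have hA := h2 N hNlo' hNhi'
  have hEN : E * E ≤ N := by rw [← hEE]; exact hNlo'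
  have hEN' : E ≤ N := le_trans (by nlinarith) hEN
  have hNpos : (0 : ℝ) < N := by linarith
  set s := Nat.sqrt N with hs
  have hs1 : (s : ℝ) * s ≤ N := by exact_mod_cast Nat.sqrt_le N
  have hs2 : (N : ℝ) < (s + 1) * (s + 1) := by exact_mod_cast Nat.lt_succ_sqrt N
  have hs0 : (1 : ℝ) ≤ s := by exact_mod_cast Nat.sqrt_pos.2 hN.pos
  have hEs : E < s + 1 := by
    by_contra hcn; push Not at hcn
    have := mul_le_mul hcn hcn (by linarith) (by linarith)
    linarith
  have hsE : s * E ≤ N := by nlinarith [sq_nonneg (s - E)]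
  have hTe : Te r N = C * s := rfl
  have hTeN : 2 * Te r N ≤ N := by
    have : (2 * C : ℝ) * s ≤ N := by
      calc (2 * C : ℝ) * s ≤ E * s := by gcongr; linarith
        _ = s * E := mul_comm _ _
        _ ≤ N := hsE
    rw [hTe, ← mul_assoc]; exact_mod_cast this
  have hETe : E < (Te r N : ℝ) := by
    rw [hTe]; push_cast
    have : (8 : ℝ) * s ≤ C * s := by gcongr
    linarith
  have hN0N : N₀ ≤ N := by
    have : (N₀ : ℝ) ≤ N := by linarith
    exact_mod_cast this
  -- bounds on the sieve parameters
  have hRE : (RR D y : ℝ) ≤ E := by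
    refine (RR_le D y).trans ?_
    rw [hE]; apply Real.exp_le_exp.2
    exact div_le_div_of_nonneg_left (by linarith) (by norm_num) hDr
  have hzE : (zz y : ℝ) ≤ E := by
    refine (zz_le y).trans ?_
    rw [hE]; apply Real.exp_le_exp.2; linarith
  have hwz : w ≤ zz y := by
    apply Nat.le_floor
    have : (w : ℝ) ≤ y := by exact_mod_cast h6
    linarith [Real.add_one_le_exp (y : ℝ)]
  have hR1 : 1 ≤ RR D y := RR_pos D y
  have hR1r : (1 : ℝ) ≤ RR D y := by exact_mod_cast hR1
  have hlogR0 : 0 ≤ Real.log (RR D y) := Real.log_nonneg hR1r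
  have hlogRup : Real.log (RR D y) ≤ Y := by
    calc _ ≤ Real.log (Real.exp (Y / D)) := Real.log_le_log (by linarith) (RR_le D y)
      _ = Y / D := Real.log_exp _
      _ ≤ Y := div_le_self (by linarith) (by linarith)
  have hlogRlo : Y / (2 * D) ≤ Real.log (RR D y) := by
    have a1 : Real.exp (Y / D) < RR D y + 1 := Nat.lt_floor_add_one _
    have a2 : Real.exp (Y / D) ≤ 2 * RR D y := by linarith
    have a3 : Y / D ≤ Real.log (2 * RR D y) := by
      rw [Real.le_log_iff_exp_le (by linarith)]; exact a2
    rw [Real.log_mul (by norm_num) (by linarith)] at a3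
    have a4 := Real.log_two_lt_d9
    have a5 : 1 ≤ Y / (2 * D) := by rw [le_div_iff₀ (by linarith)]; linarith
    have a6 : Y / D = Y / (2 * D) + Y / (2 * D) := by field_simp; norm_num
    linarith
  set φ : ℝ := (Nat.totient W : ℝ) with hφ
  have hφ0 : 0 < φ := by rw [hφ]; exact_mod_cast Nat.totient_pos.2 hWpos
  have hWr : (0 : ℝ) < W := by exact_mod_cast hWpos
  have hφW : φ ≤ W := by rw [hφ]; exact_mod_cast Nat.totient_le W
  set Θ := VV (prs 0 w) * Real.log (RR D y) with hΘ
  have hVV : VV (prs 0 w) = φ / W := VV_Wp w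
  have hΘ0 : 0 ≤ Θ := mul_nonneg (by rw [hVV]; positivity) hlogR0
  have hΘY : Θ ≤ Y := by
    have : VV (prs 0 w) ≤ 1 := by rw [hVV, div_le_one hWr]; exact hφW
    calc Θ ≤ 1 * Real.log (RR D y) := by rw [hΘ]; gcongr
      _ ≤ Y := by rw [one_mul]; exact hlogRup
  have hbig : ∀ p : ℕ, W * Te r N ≤ p → E < p := by
    intro p hp
    have a1 : Te r N ≤ W * Te r N := Nat.le_mul_of_pos_left _ hWpos
    have a2 : (Te r N : ℝ) ≤ p := by exact_mod_cast a1.trans hp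
    linarith
  obtain ⟨b, hb⟩ := dens_exists W N (Te r N) (N / 2) hWpos (Nat.div_le_self N 2) Θ hΘ0 (by
    intro p hp
    rw [mem_filter, mem_Ico] at hp
    rw [Nat.coprime_comm, hp.2.coprime_iff_not_dvd]
    apply Wp_not_dvd w p hp.2
    have := hbig p hp.1.1
    have : (w : ℝ) < p := by linarith
    exact_mod_cast this)
  set f := ff W b (Te r N) (N / 2) Θ N with hf
  have hf0 : ∀ x, 0 ≤ f x := by
    intro x; rw [hf]; unfold ff; split_ifs
    · exact hΘ0
    · exact le_rfl
  have hf1 : ∀ x, f x ≤ Θ := by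
    intro x; rw [hf]; unfold ff; split_ifs
    · exact le_rfl
    · exact hΘ0
  have hfν : ∀ x, f x ≤ nuf r K D w y N b x := by
    intro x
    rw [hf]; unfold ff
    split_ifs with hx
    · obtain ⟨x1, x2, x3⟩ := hx
      unfold nuf wrap
      rw [if_pos ⟨x1, by omega⟩]
      apply nt_lower w (zz y) (K * y) (RR D y) hwz hR1
      intro q hq _ hq2 hdvd
      have hdvd' : q ∣ W * x.val + b := by
        have : ((q : ℕ) : ℤ) ∣ ((W * x.val + b : ℕ) : ℤ) := by push_cast; exact hdvd
        exact_mod_cast this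
      have heq := (Nat.prime_dvd_prime_iff_eq hq x3).1 hdvd'
      have hqE : E < q := by
        apply hbig
        rw [heq]
        exact (Nat.mul_le_mul_left W x1).trans (Nat.le_add_right _ _)
      rcases hq2 with hq2 | hq2
      · have : (q : ℝ) ≤ RR D y := by exact_mod_cast hq2
        linarith
      · have : (q : ℝ) ≤ zz y := by exact_mod_cast hq2
        linarith
    · exact wrap_nonneg _ _ _ (fun m => nt_nonneg _ _ (prs_prime _ _) (prs_prime _ _) _ _ hR1 _) _
  have hδ : 1 / (72 * (D : ℝ)) ≤ av f := by
    refine le_trans ?_ hb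
    rw [hTe]
    have hY0 : 0 < Y := by linarith
    calc 1 / (72 * (D : ℝ)) = (φ / W * (Y / (2 * D))) * ((W * N / (36 * Y)) / φ) / N := by
          field_simp; norm_num
      _ ≤ Θ * ((((Ico (W * (C * s)) (W * (N / 2))).filter Nat.Prime).card : ℝ) / φ) / N := by
          rw [hΘ, hVV]; gcongr
  have hfin := hsz N hN hN0N (nuf r K D w y N b) f (h1 N hN hNlo' b) hf0 hfν hδ
  obtain ⟨a, d, hd, hap⟩ := exists_pos_term r N f Θ c hf0 hf1 (by
    rw [div_lt_iff₀ hNpos]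
    have a1 : Θ ^ (r + 2) ≤ Y ^ (r + 2) := by gcongr
    have a2 : 2 / c * Y ^ (r + 2) ≤ N := h4.trans hEN'
    rw [div_mul_eq_mul_div, div_le_iff₀ hc] at a2
    have a3 : 0 < c * N := by positivity
    linarith) hfin
  apply ap_extract r N (N / 2) W b (by omega) hWpos a d hd
  intro j hj
  have := hap j hj
  rw [hf] at this
  unfold ff at this
  split_ifs at this with hx
  · exact hx.2
  · exact absurd rfl this

end GT

/-- Green–Tao theorem: the primes contain arbitrarily long arithmetic progressions. -/
theorem green_tao (k : ℕ) (hk : 0 < k) :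
    ∃ (b d : ℕ), 0 < d ∧ ∀ i < k, Nat.Prime (b + i * d) := by
  obtain ⟨b, d, hd, h⟩ := GT.gt_main k
  exact ⟨b, d, hd, fun i hi => h i (by omega)⟩
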